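/- For i ∈ {h,v} let Ψ^{(i)} ∈ W₂^q, let ℰ_j be a standard edge fragment, let R_γ be the rotation matrix by an angle γ ∈ [0, 2π), and let r ∈ ℕ₀² be a multi-index with |r|₁ ≤ q. Then for even j ≥ 10 and |ℓ| ≤ 2^{j/2} there is a constant C(q) > 0 such that ‖∂^r[𝓕ℰ_j(R_γᵀ ·)·Ψ_{j,ℓ}^{(i)}]‖²_{L₂(ℝ²)} ≤ C(q) · 2^{−j(3/2 + |r|₁)} · (1 + 2^{j/2}|sin(θ_{j,ℓ}^{(i)} − γ)|)^{−5}. -/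

import Mathlib

open Real MeasureTheory Set
open scoped Classical

noncomputable section

/-- A window function `g ∈ 𝒲`: nonnegative, even, with support `(-2/3, 2/3)`,
and whose integer translates form a partition of unity. -/
structure IsWindow (g : ℝ → ℝ) : Prop where
  nonneg : ∀ x, 0 ≤ g x
  even_fun : ∀ x, g (-x) = g x
  supp_eq : Function.support g = Ioo (-(2/3) : ℝ) (2/3)
  partition : ∀ x : ℝ, HasSum (fun z : ℤ => g (x + (z : ℝ))) 1

/-- `g ∈ 𝒲^q`: a window function that is `q`-times continuously differentiable. -/
def IsWindowQ (g : ℝ → ℝ) (q : ℕ) : Prop := IsWindow g ∧ ContDiff ℝ q g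

/-- `g̃(x) = g(x/2) - g(x)`. -/
def gtilde (g : ℝ → ℝ) : ℝ → ℝ := fun x => g (x / 2) - g x

/-- Horizontal bivariate window `Ψ^{(h)}(x) = g̃(x₁) g(x₂)`. -/
def PsiH (g : ℝ → ℝ) : ℝ × ℝ → ℝ := fun x => gtilde g x.1 * g x.2

/-- Vertical bivariate window `Ψ^{(v)}(x) = g(x₁) g̃(x₂)`. -/
def PsiV (g : ℝ → ℝ) : ℝ × ℝ → ℝ := fun x => g x.1 * gtilde g x.2

/-- `Ψ_{j,ℓ}^{(i)}(ξ) = Ψ^{(i)}((N_{j,ℓ}^{(i)})^{-T} ξ)`, where the inverse transpose of the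
shear matrices has been written out explicitly.  `i = true` is the horizontal case `(h)`,
`i = false` the vertical case `(v)`. -/
def PsiJL (g : ℝ → ℝ) (i : Bool) (j : ℕ) (ℓ : ℤ) : ℝ × ℝ → ℝ := fun ξ =>
  if i then
    PsiH g ((2:ℝ) ^ (-(j:ℝ)) * ξ.1,
            (2:ℝ) ^ (-(j:ℝ)/2) * ξ.2 - (ℓ:ℝ) * (2:ℝ) ^ (-(j:ℝ)) * ξ.1)
  else
    PsiV g ((2:ℝ) ^ (-(j:ℝ)/2) * ξ.1 - (ℓ:ℝ) * (2:ℝ) ^ (-(j:ℝ)) * ξ.2,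
            (2:ℝ) ^ (-(j:ℝ)) * ξ.2)

/-- Discrete angles `θ_{j,ℓ}^{(h)} = arctan(ℓ 2^{-j/2})`,
`θ_{j,ℓ}^{(v)} = arccot(ℓ 2^{-j/2}) = π/2 - arctan(ℓ 2^{-j/2})`. -/
def thetaJL (i : Bool) (j : ℕ) (ℓ : ℤ) : ℝ :=
  if i then arctan ((ℓ:ℝ) * (2:ℝ) ^ (-(j:ℝ)/2))
  else π/2 - arctan ((ℓ:ℝ) * (2:ℝ) ^ (-(j:ℝ)/2))

/-- The pattern `𝒫(N_{j,ℓ}^{(i)}) = (N_{j,ℓ}^{(i)})^{-1} ℤ² ∩ [-1/2,1/2)²`: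
`y` belongs to the pattern iff `N_{j,ℓ}^{(i)} y ∈ ℤ²` and `y ∈ [-1/2,1/2)²`. -/
def pattern (i : Bool) (j : ℕ) (ℓ : ℤ) : Set (ℝ × ℝ) :=
  {y : ℝ × ℝ |
    (∃ k : ℤ × ℤ,
      (if i then ((2:ℝ)^(j:ℝ) * y.1 + (ℓ:ℝ) * (2:ℝ)^((j:ℝ)/2) * y.2, (2:ℝ)^((j:ℝ)/2) * y.2)
       else ((2:ℝ)^((j:ℝ)/2) * y.1, (ℓ:ℝ) * (2:ℝ)^((j:ℝ)/2) * y.1 + (2:ℝ)^(j:ℝ) * y.2))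
        = ((k.1 : ℝ), (k.2 : ℝ)))
    ∧ y.1 ∈ Ico (-(1/2) : ℝ) (1/2) ∧ y.2 ∈ Ico (-(1/2) : ℝ) (1/2)}

/-- `ỹ = y - (2^{-j-1},0)ᵀ` in the horizontal case, `ỹ = y - (0,2^{-j-1})ᵀ` in the vertical one. -/
def ytilde (i : Bool) (j : ℕ) (y : ℝ × ℝ) : ℝ × ℝ :=
  if i then (y.1 - (2:ℝ) ^ (-(j:ℝ) - 1), y.2) else (y.1, y.2 - (2:ℝ) ^ (-(j:ℝ) - 1))

/-- The trigonometric polynomial shearlet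
`ψ_{j,ℓ,y}^{(i)}(x) = ∑_{k∈ℤ²} Ψ_{j,ℓ}^{(i)}(k) e^{i k·(x - 2πỹ)}`. -/
def shearlet (g : ℝ → ℝ) (i : Bool) (j : ℕ) (ℓ : ℤ) (y : ℝ × ℝ) : ℝ × ℝ → ℂ := fun x =>
  ∑' k : ℤ × ℤ, (PsiJL g i j ℓ ((k.1 : ℝ), (k.2 : ℝ)) : ℂ) *
    Complex.exp (Complex.I *
      (((k.1 : ℝ) * (x.1 - 2*π*(ytilde i j y).1)
        + (k.2 : ℝ) * (x.2 - 2*π*(ytilde i j y).2) : ℝ) : ℂ))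

/-- `⟨f,h⟩₂ = (2π)^{-2} ∫_{𝕋²} f(x) conj(h(x)) dx`, with the torus realised as `[-π,π]²`. -/
def inner2 (f h : ℝ × ℝ → ℂ) : ℂ :=
  ((2*π)^2 : ℂ)⁻¹ * ∫ x in (Icc (-π) π ×ˢ Icc (-π) π : Set (ℝ × ℝ)), f x * (starRingEnd ℂ) (h x)

/-- The `2π`-periodization `f^{2π} = ∑_{n∈ℤ²} f(· + 2πn)`. -/
def periodize (f : ℝ × ℝ → ℝ) : ℝ × ℝ → ℝ := fun x =>
  ∑' n : ℤ × ℤ, f (x.1 + 2*π*(n.1 : ℝ), x.2 + 2*π*(n.2 : ℝ))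

/-- Euclidean norm `|x|₂` on `ℝ²`. -/
def nrm2 (x : ℝ × ℝ) : ℝ := Real.sqrt (x.1^2 + x.2^2)

/-- First partial derivative of a complex-valued function of two real variables. -/
def pd1 (f : ℝ × ℝ → ℂ) : ℝ × ℝ → ℂ := fun x => deriv (fun t => f (t, x.2)) x.1

/-- Second partial derivative of a complex-valued function of two real variables. -/
def pd2 (f : ℝ × ℝ → ℂ) : ℝ × ℝ → ℂ := fun x => deriv (fun t => f (x.1, t)) x.2

/-- `∂^r = ∂^{r₁+r₂}/∂x₁^{r₁}∂x₂^{r₂}` (complex-valued). -/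
def pd (r : ℕ × ℕ) (f : ℝ × ℝ → ℂ) : ℝ × ℝ → ℂ := pd1^[r.1] (pd2^[r.2] f)

/-- First partial derivative of a real-valued function of two real variables. -/
def pdR1 (f : ℝ × ℝ → ℝ) : ℝ × ℝ → ℝ := fun x => deriv (fun t => f (t, x.2)) x.1

/-- Second partial derivative of a real-valued function of two real variables. -/
def pdR2 (f : ℝ × ℝ → ℝ) : ℝ × ℝ → ℝ := fun x => deriv (fun t => f (x.1, t)) x.2

/-- `∂^r = ∂^{r₁+r₂}/∂x₁^{r₁}∂x₂^{r₂}` (real-valued). -/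
def pdR (r : ℕ × ℕ) (f : ℝ × ℝ → ℝ) : ℝ × ℝ → ℝ := pdR1^[r.1] (pdR2^[r.2] f)

/-- The Fourier transform `𝓕f(x) = (2π)^{-2} ∫_{ℝ²} f(ξ) e^{-iξ·x} dξ`. -/
def FT (f : ℝ × ℝ → ℂ) : ℝ × ℝ → ℂ := fun x =>
  ((2*π)^2 : ℂ)⁻¹ * ∫ ξ : ℝ × ℝ, f ξ * Complex.exp (-(Complex.I) * ((ξ.1*x.1 + ξ.2*x.2 : ℝ) : ℂ))

/-- Rotation matrix `R_γ` acting on `ℝ²`. -/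
def rotM (γ : ℝ) (x : ℝ × ℝ) : ℝ × ℝ :=
  (Real.cos γ * x.1 - Real.sin γ * x.2, Real.sin γ * x.1 + Real.cos γ * x.2)

/-- Transposed rotation matrix `R_γᵀ` acting on `ℝ²`. -/
def rotT (γ : ℝ) (x : ℝ × ℝ) : ℝ × ℝ :=
  (Real.cos γ * x.1 + Real.sin γ * x.2, -(Real.sin γ) * x.1 + Real.cos γ * x.2)

/-- The standard edge fragment `ℰ_j(x) = f(x) φ(2^{j/2}x) χ_{{x₁ ≥ E(x₂)}}(x)`. -/
def edgeFragment (f φ : ℝ × ℝ → ℝ) (E : ℝ → ℝ) (j : ℕ) : ℝ × ℝ → ℝ := fun x =>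
  f x * φ ((2:ℝ)^((j:ℝ)/2) * x.1, (2:ℝ)^((j:ℝ)/2) * x.2) * (if E x.2 ≤ x.1 then 1 else 0)

/-- The second-order differential operator `L = I + 2^j Δ`. -/
def Lop (j : ℕ) (f : ℝ × ℝ → ℂ) : ℝ × ℝ → ℂ := fun x =>
  f x + (Complex.ofReal ((2:ℝ)^(j:ℝ))) * (pd (2,0) f x + pd (0,2) f x)

/-- The dyadic square `Q` indexed by `(n₁,n₂)` at scale `j`. -/
def dyadicSquare (j : ℕ) (n : ℕ × ℕ) : Set (ℝ × ℝ) :=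
  Ico (2*π*(n.1:ℝ)*(2:ℝ)^(-(j:ℝ)/2) - π) (2*π*((n.1:ℝ)+1)*(2:ℝ)^(-(j:ℝ)/2) - π) ×ˢ
  Ico (2*π*(n.2:ℝ)*(2:ℝ)^(-(j:ℝ)/2) - π) (2*π*((n.2:ℝ)+1)*(2:ℝ)^(-(j:ℝ)/2) - π)

/-- The indices of the dyadic squares at scale `j` meeting `∂T` (the set `𝒬_j^1`). -/
def Q1set (T : Set (ℝ × ℝ)) (j : ℕ) : Finset (ℕ × ℕ) :=
  (Finset.range (2^(j/2)) ×ˢ Finset.range (2^(j/2))).filter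
    (fun n => (frontier T ∩ dyadicSquare j n).Nonempty)

/-- Fresnel integral `Fc(x) = ∫₀ˣ cos v/√v dv`. -/
def Fc (x : ℝ) : ℝ := ∫ v in (0:ℝ)..x, Real.cos v / Real.sqrt v

/-- Fresnel integral `Fs(x) = ∫₀ˣ sin v/√v dv`. -/
def Fs (x : ℝ) : ℝ := ∫ v in (0:ℝ)..x, Real.sin v / Real.sqrt v

/-- `F⁺ = Fc + Fs`. -/
def Fp (x : ℝ) : ℝ := Fc x + Fs x

/-- `F⁻ = Fc - Fs`. -/
def Fm (x : ℝ) : ℝ := Fc x - Fs x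

/-- `a(λ,p,A)` of the paper. -/
def aInt (g : ℝ → ℝ) (l p A : ℝ) : ℝ :=
  ∫ v in Ioi (0:ℝ),
    (g (2*Real.sqrt (A*l*v) + p*l) + g (2*Real.sqrt (A*l*v) - p*l)) * (Real.cos v / Real.sqrt v)

/-- `b(λ,p,A)` of the paper. -/
def bInt (g : ℝ → ℝ) (l p A : ℝ) : ℝ :=
  ∫ v in Ioi (0:ℝ),
    (g (2*Real.sqrt (A*l*v) + p*l) + g (2*Real.sqrt (A*l*v) - p*l)) * (Real.sin v / Real.sqrt v)

/-- `P₁(D,p,A)` of the paper. -/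
def P1 (g : ℝ → ℝ) (D p A : ℝ) : ℝ :=
  ∫ l in (1/3 : ℝ)..(4/3),
    gtilde g l * l⁻¹ *
      ((aInt g l p A + bInt g l p A) * Real.cos (D*l)
        + (aInt g l p A - bInt g l p A) * Real.sin (D*l))

/-- `P₂(D,p,A)` of the paper. -/
def P2 (g : ℝ → ℝ) (D p A : ℝ) : ℝ :=
  ∫ l in (1/3 : ℝ)..(4/3),
    gtilde g l * l⁻¹ *
      ((aInt g l p A + bInt g l p A) * Real.sin (D*l)
        - (aInt g l p A - bInt g l p A) * Real.cos (D*l))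


lemma integral_gaussian_mul_cexp {δ : ℝ} (hδ : 0 < δ) (u : ℝ) :
    ‖∫ ρ : ℝ, Complex.exp (-(δ : ℂ) * (ρ : ℂ) ^ 2) * Complex.exp (-Complex.I * ((ρ * u : ℝ) : ℂ))‖
      = √(π / δ) * Real.exp (-u ^ 2 / (4 * δ)) := by
  have h := fourierIntegral_gaussian (b := (δ : ℂ)) (by simpa using hδ) (-(u : ℂ))
  have e : (fun ρ : ℝ => Complex.exp (-(δ : ℂ) * (ρ : ℂ) ^ 2) *
      Complex.exp (-Complex.I * ((ρ * u : ℝ) : ℂ))) =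
      fun x : ℝ => Complex.exp (Complex.I * (-(u : ℂ)) * x) *
        Complex.exp (-(δ : ℂ) * (x : ℂ) ^ 2) := by
    funext ρ
    rw [mul_comm]
    congr 2
    push_cast
    ring
  rw [e, h, norm_mul]
  congr 1
  · have h1 : ((π : ℂ) / (δ : ℂ)) = ((π / δ : ℝ) : ℂ) := by push_cast; rfl
    rw [h1, Complex.norm_cpow_eq_rpow_re_of_pos (by positivity), Real.sqrt_eq_rpow]
    norm_num
  · have h1 : (-(-(u : ℂ)) ^ 2 / (4 * (δ : ℂ))) = ((-u ^ 2 / (4 * δ) : ℝ) : ℂ) := by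
      push_cast; ring
    rw [h1, Complex.norm_exp_ofReal]

/-- A Schur test for oscillatory integrals against a Gaussian weight in the frequency. -/
lemma gaussian_schur {Ω : Type*} [MeasurableSpace Ω] (μ : Measure Ω) [IsFiniteMeasure μ]
    {b : Ω → ℂ} (hb : AEStronglyMeasurable b μ) {M : ℝ} (hM : ∀ x, ‖b x‖ ≤ M) {w : Ω → ℝ}
    (hw : Measurable w) {δ κ : ℝ} (hδ : 0 < δ)
    (hκ : ∀ x, ∫ y, Real.exp (-(w x - w y) ^ 2 / (4 * δ)) ∂μ ≤ κ * √δ) :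
    ∫ ρ : ℝ, Real.exp (-δ * ρ ^ 2) *
        ‖∫ x, b x * Complex.exp (-Complex.I * ((ρ * w x : ℝ) : ℂ)) ∂μ‖ ^ 2
      ≤ M ^ 2 * μ.real univ * κ * √π := by
  set Q : ℝ → ℂ := fun ρ => ∫ x, b x * Complex.exp (-Complex.I * ((ρ * w x : ℝ) : ℂ)) ∂μ with hQ
  set B : Ω × Ω → ℂ := fun z => b z.1 * (starRingEnd ℂ) (b z.2) with hB
  have hexp1 : ∀ u : ℝ, ‖Complex.exp (-Complex.I * (u : ℂ))‖ = 1 := by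
    intro u
    rw [Complex.norm_exp]
    simp
  have hBm : AEStronglyMeasurable B (μ.prod μ) := by
    apply (hb.comp_fst).mul
    exact (Complex.continuous_conj.comp_aestronglyMeasurable (hb.comp_snd))
  have hBb : ∀ z, ‖B z‖ ≤ M ^ 2 := by
    intro z
    simp only [hB, norm_mul, RCLike.norm_conj, sq]
    exact mul_le_mul (hM _) (hM _) (norm_nonneg _) ((norm_nonneg _).trans (hM z.1))
  have key : ∀ ρ, ((‖Q ρ‖ ^ 2 : ℝ) : ℂ) = ∫ z, B z *
      Complex.exp (-Complex.I * ((ρ * (w z.1 - w z.2) : ℝ) : ℂ)) ∂(μ.prod μ) := by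
    intro ρ
    have h1 : ((‖Q ρ‖ ^ 2 : ℝ) : ℂ) = Q ρ * (starRingEnd ℂ) (Q ρ) := by
      rw [Complex.mul_conj, Complex.normSq_eq_norm_sq]
    rw [h1, hQ, ← integral_conj, ← integral_prod_mul]
    congr 1
    funext z
    rw [map_mul, ← Complex.exp_conj]
    have : (starRingEnd ℂ) (-Complex.I * ((ρ * w z.2 : ℝ) : ℂ)) =
        Complex.I * ((ρ * w z.2 : ℝ) : ℂ) := by
      rw [map_mul, Complex.conj_ofReal]; simp
    rw [this]
    calc _ = B z * (Complex.exp (-Complex.I * ((ρ * w z.1 : ℝ) : ℂ)) *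
          Complex.exp (Complex.I * ((ρ * w z.2 : ℝ) : ℂ))) := by simp only [hB]; ring
      _ = _ := by
        rw [← Complex.exp_add]
        congr 2
        push_cast
        ring
  have hint : Integrable (Function.uncurry fun (ρ : ℝ) (z : Ω × Ω) =>
      Complex.exp (-(δ : ℂ) * (ρ : ℂ) ^ 2) * (B z *
      Complex.exp (-Complex.I * ((ρ * (w z.1 - w z.2) : ℝ) : ℂ))))
      ((volume : Measure ℝ).prod (μ.prod μ)) := by
    have hg : Integrable (fun q : ℝ × (Ω × Ω) => Real.exp (-δ * q.1 ^ 2) * M ^ 2)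
        ((volume : Measure ℝ).prod (μ.prod μ)) :=
      Integrable.mul_prod (integrable_exp_neg_mul_sq hδ) (integrable_const (M ^ 2))
    refine hg.mono' ?_ (ae_of_all _ ?_)
    · apply AEStronglyMeasurable.mul
      · apply Measurable.aestronglyMeasurable
        fun_prop
      · apply hBm.comp_snd.mul
        apply Measurable.aestronglyMeasurable
        fun_prop
    · rintro ⟨ρ, z⟩
      simp only [Function.uncurry, norm_mul, hexp1, mul_one]
      have : ‖Complex.exp (-(δ : ℂ) * (ρ : ℂ) ^ 2)‖ = Real.exp (-δ * ρ ^ 2) := by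
        rw [← Complex.norm_exp_ofReal]; push_cast; rfl
      rw [this]
      exact mul_le_mul_of_nonneg_left (hBb z) (Real.exp_pos _).le
  have hswap := integral_integral_swap hint
  have hL : ((∫ ρ : ℝ, Real.exp (-δ * ρ ^ 2) * ‖Q ρ‖ ^ 2 : ℝ) : ℂ) =
      ∫ z, B z * (∫ ρ : ℝ, Complex.exp (-(δ : ℂ) * (ρ : ℂ) ^ 2) *
        Complex.exp (-Complex.I * ((ρ * (w z.1 - w z.2) : ℝ) : ℂ))) ∂(μ.prod μ) := by
    rw [← integral_complex_ofReal]
    calc _ = ∫ ρ : ℝ, ∫ z, Complex.exp (-(δ : ℂ) * (ρ : ℂ) ^ 2) * (B z *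
      Complex.exp (-Complex.I * ((ρ * (w z.1 - w z.2) : ℝ) : ℂ))) ∂(μ.prod μ) := by
          congr 1
          funext ρ
          rw [integral_const_mul, ← key]
          push_cast
          rfl
      _ = _ := by
          rw [hswap]
          congr 1
          funext z
          rw [← integral_const_mul]
          congr 1
          funext ρ
          ring
  have hnn : 0 ≤ ∫ ρ : ℝ, Real.exp (-δ * ρ ^ 2) * ‖Q ρ‖ ^ 2 :=
    integral_nonneg fun ρ => by positivity
  have hn : ∫ ρ : ℝ, Real.exp (-δ * ρ ^ 2) * ‖Q ρ‖ ^ 2 =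
      ‖((∫ ρ : ℝ, Real.exp (-δ * ρ ^ 2) * ‖Q ρ‖ ^ 2 : ℝ) : ℂ)‖ := by
    rw [Complex.norm_real, Real.norm_of_nonneg hnn]
  change ∫ ρ : ℝ, Real.exp (-δ * ρ ^ 2) * ‖Q ρ‖ ^ 2 ≤ _
  rw [hn, hL]
  have hGi : Integrable (fun z : Ω × Ω => Real.exp (-(w z.1 - w z.2) ^ 2 / (4 * δ)))
      (μ.prod μ) := by
    refine (integrable_const (1 : ℝ)).mono' (Measurable.aestronglyMeasurable (by fun_prop))
      (ae_of_all _ fun z => ?_)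
    rw [Real.norm_of_nonneg (Real.exp_pos _).le]
    apply Real.exp_le_one_iff.2
    rw [neg_div]
    exact neg_nonpos.2 (by positivity)
  calc _ ≤ ∫ z, M ^ 2 * √(π / δ) * Real.exp (-(w z.1 - w z.2) ^ 2 / (4 * δ)) ∂(μ.prod μ) := by
        refine norm_integral_le_of_norm_le (hGi.const_mul _) (ae_of_all _ fun z => ?_)
        rw [norm_mul, integral_gaussian_mul_cexp hδ, mul_assoc]
        exact mul_le_mul_of_nonneg_right (hBb z) (by positivity)
    _ = M ^ 2 * √(π / δ) * ∫ x, ∫ y, Real.exp (-(w x - w y) ^ 2 / (4 * δ)) ∂μ ∂μ := by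
        rw [integral_const_mul, integral_prod _ hGi]
    _ ≤ M ^ 2 * √(π / δ) * ∫ x, κ * √δ ∂μ := by
        apply mul_le_mul_of_nonneg_left _ (by positivity)
        exact integral_mono hGi.integral_prod_left (integrable_const _) hκ
    _ = _ := by
        rw [integral_const, smul_eq_mul, Real.sqrt_div pi_pos.le]
        have : √δ ≠ 0 := (Real.sqrt_pos.2 hδ).ne'
        field_simp

lemma norm_cexp_neg_I_mul (u : ℝ) : ‖Complex.exp (-Complex.I * (u : ℂ))‖ = 1 := by
  rw [Complex.norm_exp]
  simp

lemma continuous_oscillatory {Ω : Type*} [MeasurableSpace Ω] {μ : Measure Ω}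
    {b : Ω → ℂ} (hb : Integrable b μ) {w : Ω → ℝ} (hw : Measurable w) :
    Continuous fun ρ : ℝ => ∫ x, b x * Complex.exp (-Complex.I * ((ρ * w x : ℝ) : ℂ)) ∂μ := by
  refine continuous_of_dominated (bound := fun x => ‖b x‖) (fun ρ => ?_) (fun ρ => ?_) hb.norm ?_
  · exact hb.1.mul (Measurable.aestronglyMeasurable (by fun_prop))
  · exact ae_of_all _ fun x => by rw [norm_mul, norm_cexp_neg_I_mul, mul_one]
  · exact ae_of_all _ fun x => by fun_prop

/-- The frequency range `1/3 ≤ ε|ρ| ≤ 4/3`. -/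
def freqRange (ε : ℝ) : Set ℝ := {ρ | 1 / 3 ≤ ε * |ρ| ∧ ε * |ρ| ≤ 4 / 3}

lemma freqRange_subset {ε : ℝ} (hε : 0 < ε) :
    freqRange ε ⊆ Icc (-(4 / (3 * ε))) (4 / (3 * ε)) := by
  rintro ρ ⟨-, h⟩
  rw [mem_Icc, ← abs_le, le_div_iff₀ (by positivity)]
  linarith

lemma isClosed_freqRange (ε : ℝ) : IsClosed (freqRange ε) := by
  have h : Continuous fun ρ : ℝ => ε * |ρ| := by fun_prop
  exact (isClosed_le continuous_const h).inter (isClosed_le h continuous_const)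

lemma isCompact_freqRange {ε : ℝ} (hε : 0 < ε) : IsCompact (freqRange ε) :=
  isCompact_Icc.of_isClosed_subset (isClosed_freqRange ε) (freqRange_subset hε)

lemma volume_freqRange_le {ε : ℝ} (hε : 0 < ε) : volume.real (freqRange ε) ≤ 3 / ε := by
  refine (measureReal_mono (freqRange_subset hε) (by simp)).trans ?_
  rw [Real.volume_real_Icc_of_le (by linarith [show 0 < 4 / (3 * ε) by positivity])]
  have : 4 / (3 * ε) - -(4 / (3 * ε)) = (8 / 3) / ε := by field_simp; ring
  rw [this]
  gcongr
  norm_num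

lemma schur_freqRange {Ω : Type*} [MeasurableSpace Ω] (μ : Measure Ω) [IsFiniteMeasure μ]
    {b : Ω → ℂ} (hb : AEStronglyMeasurable b μ) {M : ℝ} (hM : ∀ x, ‖b x‖ ≤ M) {w : Ω → ℝ}
    (hw : Measurable w) {ε κ : ℝ} (hε : 0 < ε)
    (hκ : ∀ x, ∫ y, Real.exp (-(w x - w y) ^ 2 / (4 * ε ^ 2)) ∂μ ≤ κ * ε) :
    ∫ ρ in freqRange ε, ‖∫ x, b x * Complex.exp (-Complex.I * ((ρ * w x : ℝ) : ℂ)) ∂μ‖ ^ 2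
      ≤ Real.exp 2 * (M ^ 2 * μ.real univ * κ * √π) := by
  have hbi : Integrable b μ := (integrable_const M).mono' hb (ae_of_all _ hM)
  have hc := continuous_oscillatory hbi hw
  have h := gaussian_schur μ hb hM hw (δ := ε ^ 2) (κ := κ) (by positivity)
    (by simpa [Real.sqrt_sq hε.le] using hκ)
  set Q : ℝ → ℂ := fun ρ => ∫ x, b x * Complex.exp (-Complex.I * ((ρ * w x : ℝ) : ℂ)) ∂μ with hQ
  have hQb : ∀ ρ, ‖Q ρ‖ ≤ ∫ x, ‖b x‖ ∂μ := fun ρ =>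
    (norm_integral_le_integral_norm _).trans (le_of_eq (by
      congr 1; funext x; rw [norm_mul, norm_cexp_neg_I_mul, mul_one]))
  have hint : Integrable fun ρ : ℝ => Real.exp (-ε ^ 2 * ρ ^ 2) * ‖Q ρ‖ ^ 2 := by
    refine ((integrable_exp_neg_mul_sq (b := ε ^ 2) (by positivity)).mul_const
      ((∫ x, ‖b x‖ ∂μ) ^ 2)).mono' (Continuous.aestronglyMeasurable (by fun_prop))
      (ae_of_all _ fun ρ => ?_)
    rw [Real.norm_of_nonneg (by positivity)]
    gcongr
    exact hQb ρ
  calc ∫ ρ in freqRange ε, ‖Q ρ‖ ^ 2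
      ≤ ∫ ρ in freqRange ε, Real.exp 2 * (Real.exp (-ε ^ 2 * ρ ^ 2) * ‖Q ρ‖ ^ 2) := by
        refine setIntegral_mono_on ?_ (hint.const_mul _).integrableOn
          (isClosed_freqRange ε).measurableSet fun ρ hρ => ?_
        · exact ContinuousOn.integrableOn_compact (isCompact_freqRange hε) (by fun_prop)
        · rw [← mul_assoc, ← Real.exp_add]
          apply le_mul_of_one_le_left (by positivity)
          apply Real.one_le_exp
          have : ε ^ 2 * ρ ^ 2 = (ε * |ρ|) ^ 2 := by rw [mul_pow, sq_abs]
          have h2 := hρ.2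
          have h3 : 0 ≤ ε * |ρ| := by positivity
          nlinarith
    _ ≤ ∫ ρ, Real.exp 2 * (Real.exp (-ε ^ 2 * ρ ^ 2) * ‖Q ρ‖ ^ 2) :=
        setIntegral_le_integral (hint.const_mul _) (ae_of_all _ fun ρ => by positivity)
    _ ≤ _ := by
        rw [integral_const_mul]
        gcongr

lemma integral_exp_neg_sq_le {ε m : ℝ} (hε : 0 < ε) (hm : 0 < m) (c : ℝ) :
    Integrable (fun y : ℝ => Real.exp (-(c - m * y) ^ 2 / (4 * ε ^ 2))) ∧
    ∫ y : ℝ, Real.exp (-(c - m * y) ^ 2 / (4 * ε ^ 2)) = 2 * √π / m * ε := by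
  have e : (fun y : ℝ => Real.exp (-(c - m * y) ^ 2 / (4 * ε ^ 2))) =
      fun y => (fun z => Real.exp (-(m ^ 2 / (4 * ε ^ 2)) * z ^ 2)) (y - c / m) := by
    funext y
    congr 1
    field_simp
    ring
  rw [e]
  refine ⟨(integrable_exp_neg_mul_sq (b := m ^ 2 / (4 * ε ^ 2)) (by positivity)).comp_sub_right _,
    ?_⟩
  rw [integral_sub_right_eq_self (fun z => Real.exp (-(m ^ 2 / (4 * ε ^ 2)) * z ^ 2)),
    integral_gaussian, show π / (m ^ 2 / (4 * ε ^ 2)) = (2 * ε / m) ^ 2 * π by field_simp; ring,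
    Real.sqrt_mul (by positivity), Real.sqrt_sq (by positivity)]
  ring

/-- One-dimensional Schur bound for a phase with `|w x - w y| ≥ m |x - y|` on `[-4, 4]`. -/
lemma schur_interval {b : ℝ → ℂ} (hb : AEStronglyMeasurable b (volume.restrict (Icc (-4) 4)))
    {M : ℝ} (hM : ∀ x ∈ Icc (-4 : ℝ) 4, ‖b x‖ ≤ M) {w : ℝ → ℝ} (hw : Measurable w) {ε m : ℝ}
    (hε : 0 < ε) (hm : 0 < m)
    (hwm : ∀ x ∈ Icc (-4 : ℝ) 4, ∀ y ∈ Icc (-4 : ℝ) 4, m * |x - y| ≤ |w x - w y|) :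
    ∫ ρ in freqRange ε,
        ‖∫ x in Icc (-4 : ℝ) 4, b x * Complex.exp (-Complex.I * ((ρ * w x : ℝ) : ℂ))‖ ^ 2
      ≤ 16 * π * Real.exp 2 * M ^ 2 / m := by
  set μ : Measure ℝ := volume.restrict (Icc (-4) 4) with hμ
  set P : ℝ → ℝ := fun x => max (-4) (min 4 x) with hP
  have hPm : ∀ x, P x ∈ Icc (-4 : ℝ) 4 := fun x =>
    ⟨le_max_left _ _, max_le (by norm_num) (min_le_left _ _)⟩
  have hPx : ∀ x ∈ Icc (-4 : ℝ) 4, P x = x := fun x hx => by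
    simp only [hP]; rw [min_eq_right hx.2, max_eq_right hx.1]
  have hPc : Continuous P := by fun_prop
  have hae : ∀ᵐ x ∂μ, P x = x := by
    filter_upwards [ae_restrict_mem measurableSet_Icc] with x hx using hPx x hx
  set b' : ℝ → ℂ := (Icc (-4 : ℝ) 4).indicator b with hb'
  have hbe : b' =ᵐ[μ] b := by
    filter_upwards [ae_restrict_mem measurableSet_Icc] with x hx
    simp [hb', hx]
  have hM0 : 0 ≤ M := (norm_nonneg _).trans (hM 0 (by norm_num))
  have h := schur_freqRange μ (b := b') (hb.congr hbe.symm) (M := M) (fun x => by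
      by_cases hx : x ∈ Icc (-4 : ℝ) 4
      · simpa [hb', hx] using hM x hx
      · simpa [hb', hx] using hM0) (w := fun x => w (P x))
      (hw.comp hPc.measurable) (κ := 2 * √π / m) hε (fun x => by
      obtain ⟨hi, he⟩ := integral_exp_neg_sq_le hε hm (m * P x)
      rw [← he]
      calc _ ≤ ∫ y, Real.exp (-(m * P x - m * y) ^ 2 / (4 * ε ^ 2)) ∂μ := by
            refine integral_mono_of_nonneg (ae_of_all _ fun y => (Real.exp_pos _).le)
              hi.integrableOn ?_
            filter_upwards [ae_restrict_mem measurableSet_Icc] with y hy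
            apply Real.exp_le_exp.2
            gcongr ?_ / _
            rw [hPx y hy, neg_le_neg_iff, ← mul_sub, sq_le_sq, abs_mul, abs_of_pos hm]
            exact hwm _ (hPm x) y hy
        _ ≤ _ := setIntegral_le_integral hi (ae_of_all _ fun y => (Real.exp_pos _).le))
  have e : ∀ ρ : ℝ, ∫ x, b' x * Complex.exp (-Complex.I * ((ρ * w (P x) : ℝ) : ℂ)) ∂μ =
      ∫ x, b x * Complex.exp (-Complex.I * ((ρ * w x : ℝ) : ℂ)) ∂μ := by
    intro ρ
    apply integral_congr_ae
    filter_upwards [hbe, hae] with x h1 h2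
    rw [h1, h2]
  simp only [e] at h
  refine h.trans (le_of_eq ?_)
  have hv : μ.real univ = 8 := by
    simp [hμ, Measure.real]; norm_num
  rw [hv]
  have := Real.mul_self_sqrt pi_pos.le
  calc _ = 16 * (√π * √π) * Real.exp 2 * M ^ 2 / m := by ring
    _ = _ := by rw [this]

/-- Two-dimensional Schur bound for a linear phase on `[-4, 4]²`. -/
lemma schur_square {b : ℝ × ℝ → ℂ} (hb : Measurable b)
    {M : ℝ} (hM : ∀ x, ‖b x‖ ≤ M) (hb0 : ∀ x ∉ Icc (-4 : ℝ) 4 ×ˢ Icc (-4 : ℝ) 4, b x = 0)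
    {p : ℝ × ℝ} {ε : ℝ} (hε : 0 < ε) (hp : p.2 ≠ 0) :
    ∫ ρ in freqRange ε,
        ‖∫ x : ℝ × ℝ, b x * Complex.exp (-Complex.I * ((ρ * (p.1 * x.1 + p.2 * x.2) : ℝ) : ℂ))‖ ^ 2
      ≤ 1024 * π * Real.exp 2 * M ^ 2 / |p.2| := by
  set S : Set (ℝ × ℝ) := Icc (-4 : ℝ) 4 ×ˢ Icc (-4 : ℝ) 4 with hS
  have hSm : MeasurableSet S := measurableSet_Icc.prod measurableSet_Icc
  set μ : Measure (ℝ × ℝ) := (volume.restrict (Icc (-4 : ℝ) 4)).prod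
    (volume.restrict (Icc (-4 : ℝ) 4)) with hμ
  have hμS : μ = volume.restrict S := by
    rw [hμ, hS, Measure.prod_restrict]; rfl
  have h := schur_freqRange μ (b := b) hb.aestronglyMeasurable hM
      (w := fun x => p.1 * x.1 + p.2 * x.2) (by fun_prop) (κ := 16 * √π / |p.2|) hε (fun x => by
      have hp' : 0 < |p.2| := abs_pos.2 hp
      rw [hμ, integral_prod]
      · calc _ ≤ ∫ y₁ in Icc (-4 : ℝ) 4, 2 * √π / |p.2| * ε := by
              refine integral_mono_of_nonneg (ae_of_all _ fun y => integral_nonneg fun z =>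
                (Real.exp_pos _).le) (integrable_const _) (ae_of_all _ fun y₁ => ?_)
              have key : ∀ s : ℝ, s * s = 1 → p.2 = s * |p.2| →
                  (fun y₂ : ℝ => Real.exp (-(p.1 * x.1 + p.2 * x.2 -
                    (p.1 * y₁ + p.2 * y₂)) ^ 2 / (4 * ε ^ 2))) = fun y₂ : ℝ =>
                    Real.exp (-(s * (p.1 * x.1 + p.2 * x.2 - p.1 * y₁) - |p.2| * y₂) ^ 2 /
                    (4 * ε ^ 2)) := by
                intro s hs hps
                funext y₂
                congr 3
                have h1 : (p.1 * x.1 + p.2 * x.2 - (p.1 * y₁ + p.2 * y₂)) =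
                  s * (s * (p.1 * x.1 + p.2 * x.2 - p.1 * y₁) - |p.2| * y₂) := by
                  linear_combination (-(p.1 * x.1 + p.2 * x.2 - p.1 * y₁)) * hs - y₂ * hps
                rw [h1, mul_pow, pow_two s, hs, one_mul]
              obtain ⟨s, hs, hps⟩ : ∃ s : ℝ, s * s = 1 ∧ p.2 = s * |p.2| := by
                rcases le_total 0 p.2 with h0 | h0
                · exact ⟨1, by norm_num, by rw [abs_of_nonneg h0]; ring⟩
                · exact ⟨-1, by norm_num, by rw [abs_of_nonpos h0]; ring⟩
              obtain ⟨hi, he⟩ := integral_exp_neg_sq_le hε hp'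
                (s * (p.1 * x.1 + p.2 * x.2 - p.1 * y₁))
              simp only [key s hs hps]
              rw [← he]
              exact setIntegral_le_integral hi (ae_of_all _ fun y => (Real.exp_pos _).le)
          _ = _ := by
              rw [integral_const]
              simp
              ring
      · refine (integrable_const (1 : ℝ)).mono' (Measurable.aestronglyMeasurable (by fun_prop))
          (ae_of_all _ fun z => ?_)
        rw [Real.norm_of_nonneg (Real.exp_pos _).le]
        apply Real.exp_le_one_iff.2
        rw [neg_div]
        exact neg_nonpos.2 (by positivity))
  have e : ∀ ρ : ℝ, ∫ x, b x * Complex.exp (-Complex.I *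
        ((ρ * (p.1 * x.1 + p.2 * x.2) : ℝ) : ℂ)) ∂μ =
      ∫ x, b x * Complex.exp (-Complex.I * ((ρ * (p.1 * x.1 + p.2 * x.2) : ℝ) : ℂ)) := by
    intro ρ
    rw [hμS]
    apply setIntegral_eq_integral_of_forall_compl_eq_zero
    intro x hx
    rw [hb0 x hx, zero_mul]
  simp only [e] at h
  refine h.trans (le_of_eq ?_)
  have hv : μ.real univ = 64 := by
    rw [hμ, Measure.real, ← Set.univ_prod_univ, Measure.prod_prod]
    simp [ENNReal.toReal_ofReal]
    norm_num
  rw [hv]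
  have := Real.mul_self_sqrt pi_pos.le
  calc _ = 1024 * (√π * √π) * Real.exp 2 * M ^ 2 / |p.2| := by ring
    _ = _ := by rw [this]

/-- First partial derivative through the Fréchet derivative. -/
def partial₁ (F : ℝ × ℝ → ℂ) : ℝ × ℝ → ℂ := fun y => fderiv ℝ F y (1, 0)

/-- Second partial derivative through the Fréchet derivative. -/
def partial₂ (F : ℝ × ℝ → ℂ) : ℝ × ℝ → ℂ := fun y => fderiv ℝ F y (0, 1)

lemma hasDerivAt_comp_pair {F : ℝ × ℝ → ℂ} (hF : Differentiable ℝ F) {a b : ℝ → ℝ} {a' b' t : ℝ}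
    (ha : HasDerivAt a a' t) (hb : HasDerivAt b b' t) :
    HasDerivAt (fun s => F (a s, b s))
      ((a' : ℂ) * partial₁ F (a t, b t) + (b' : ℂ) * partial₂ F (a t, b t)) t := by
  have h := (hF (a t, b t)).hasFDerivAt.comp_hasDerivAt t (ha.prodMk hb)
  refine h.congr_deriv ?_
  have : ((a', b') : ℝ × ℝ) = a' • ((1, 0) : ℝ × ℝ) + b' • ((0, 1) : ℝ × ℝ) := by simp
  rw [this, map_add, map_smul, map_smul]
  simp [partial₁, partial₂]

lemma continuous_partial₁ {F : ℝ × ℝ → ℂ} (hF : ContDiff ℝ 1 F) : Continuous (partial₁ F) :=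
  (hF.continuous_fderiv one_ne_zero).clm_apply continuous_const

lemma continuous_partial₂ {F : ℝ × ℝ → ℂ} (hF : ContDiff ℝ 1 F) : Continuous (partial₂ F) :=
  (hF.continuous_fderiv one_ne_zero).clm_apply continuous_const

lemma tsupport_partial₁_subset (F : ℝ × ℝ → ℂ) : tsupport (partial₁ F) ⊆ tsupport F :=
  closure_minimal (fun y hy => by
    refine support_fderiv_subset ℝ (f := F) ?_
    intro h
    exact hy (by simp [partial₁, h])) (isClosed_tsupport F)

lemma tsupport_partial₂_subset (F : ℝ × ℝ → ℂ) : tsupport (partial₂ F) ⊆ tsupport F :=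
  closure_minimal (fun y hy => by
    refine support_fderiv_subset ℝ (f := F) ?_
    intro h
    exact hy (by simp [partial₂, h])) (isClosed_tsupport F)

lemma HasCompactSupport.partial₁ {F : ℝ × ℝ → ℂ} (hF : HasCompactSupport F) :
    HasCompactSupport (partial₁ F) := hF.of_isClosed_subset (isClosed_tsupport _)
  (tsupport_partial₁_subset F)

lemma HasCompactSupport.partial₂ {F : ℝ × ℝ → ℂ} (hF : HasCompactSupport F) :
    HasCompactSupport (partial₂ F) := hF.of_isClosed_subset (isClosed_tsupport _)
  (tsupport_partial₂_subset F)

lemma integrable_ite {e : ℝ → ℝ} (he : Continuous e) {J : ℝ × ℝ → ℂ} (hJ : Integrable J) :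
    Integrable fun y : ℝ × ℝ => if e y.2 ≤ y.1 then J y else 0 := by
  have : (fun y : ℝ × ℝ => if e y.2 ≤ y.1 then J y else 0) =
      {y : ℝ × ℝ | e y.2 ≤ y.1}.indicator J := by
    funext y; simp [Set.indicator]
  rw [this]
  exact hJ.indicator (isClosed_le (by fun_prop) (by fun_prop)).measurableSet

lemma green₁ {H : ℝ × ℝ → ℂ} (hH : ContDiff ℝ 1 H) (hc : HasCompactSupport H) {e : ℝ → ℝ}
    (he : Continuous e) {c : ℝ → ℂ} (hcc : Continuous c) :
    ∫ y : ℝ × ℝ, (if e y.2 ≤ y.1 then c y.2 * partial₁ H y else 0) =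
      -∫ y : ℝ, c y * H (e y, y) := by
  have hJ : Integrable fun y : ℝ × ℝ => c y.2 * partial₁ H y := by
    apply Continuous.integrable_of_hasCompactSupport
    · have := continuous_partial₁ hH; fun_prop
    · exact hc.partial₁.mul_left
  rw [← integral_neg, Measure.volume_eq_prod, integral_prod_symm _ (integrable_ite he hJ)]
  congr 1
  funext y
  have hs : HasCompactSupport fun x => H (x, y) := by
    refine HasCompactSupport.intro (hc.isCompact.image continuous_fst) fun x hx => ?_
    by_contra h
    exact hx ⟨(x, y), subset_tsupport _ h, rfl⟩
  have hd : ∀ x, deriv (fun x => H (x, y)) x = partial₁ H (x, y) := fun x => by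
    have := hasDerivAt_comp_pair (hH.differentiable one_ne_zero) (hasDerivAt_id x)
      (hasDerivAt_const x y)
    simpa using this.deriv
  have h := HasCompactSupport.integral_Ioi_deriv_eq
    (hH.comp (contDiff_id.prodMk contDiff_const)) hs (e y)
  have e1 : (fun x => if e y ≤ x then c y * partial₁ H (x, y) else 0) =
      (Ici (e y)).indicator fun x => c y * deriv (fun x => H (x, y)) x := by
    funext x
    simp [Set.indicator, hd]
  simp only [e1]
  rw [integral_indicator measurableSet_Ici, integral_Ici_eq_integral_Ioi, integral_const_mul]
  refine (congrArg (c y * ·) h).trans ?_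
  simp

lemma green₂ {H : ℝ × ℝ → ℂ} (hH : ContDiff ℝ 1 H) (hc : HasCompactSupport H) {e : ℝ → ℝ}
    (he : ContDiff ℝ 1 e) :
    ∫ y : ℝ × ℝ, (if e y.2 ≤ y.1 then ((deriv e y.2 : ℝ) : ℂ) * partial₁ H y + partial₂ H y else 0)
      = 0 := by
  have hec := he.continuous
  have hed : Continuous (deriv e) := he.continuous_deriv le_rfl
  have hp1 := continuous_partial₁ hH
  have hp2 := continuous_partial₂ hH
  set J : ℝ × ℝ → ℂ := fun y => ((deriv e y.2 : ℝ) : ℂ) * partial₁ H y + partial₂ H y with hJd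
  have hJc : Continuous J := by fun_prop
  have hJs : HasCompactSupport J := hc.partial₁.mul_left.add hc.partial₂
  have hJ : Integrable J := hJc.integrable_of_hasCompactSupport hJs
  have hsh : ∀ {G : ℝ × ℝ → ℂ}, HasCompactSupport G →
      HasCompactSupport fun z : ℝ × ℝ => G (z.1 + e z.2, z.2) := by
    intro G hG
    refine HasCompactSupport.intro (K := (fun z : ℝ × ℝ => (z.1 - e z.2, z.2)) '' tsupport G)
      (hG.isCompact.image (by fun_prop)) fun z hz => ?_
    by_contra h
    exact hz ⟨_, subset_tsupport _ h, by simp⟩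
  have hK : Integrable fun z : ℝ × ℝ => if (0 : ℝ) ≤ z.1 then J (z.1 + e z.2, z.2) else 0 :=
    integrable_ite (e := fun _ => 0) continuous_const
      ((hJc.comp (by fun_prop)).integrable_of_hasCompactSupport (hsh hJs))
  rw [Measure.volume_eq_prod, integral_prod_symm _ (integrable_ite hec hJ)]
  have e1 : ∀ y : ℝ, ∫ x, (if e y ≤ x then J (x, y) else 0) =
      ∫ u : ℝ, (if (0 : ℝ) ≤ u then J (u + e y, y) else 0) := by
    intro y
    rw [← integral_add_right_eq_self (fun x => if e y ≤ x then J (x, y) else 0) (e y)]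
    congr 1
    funext u
    simp
  simp only [e1]
  rw [← integral_prod_symm (fun z : ℝ × ℝ => if (0 : ℝ) ≤ z.1 then J (z.1 + e z.2, z.2) else 0)
    hK, integral_prod _ hK]
  apply integral_eq_zero_of_ae
  refine ae_of_all _ fun u => ?_
  simp only [Pi.zero_apply]
  split_ifs
  · have hder : ∀ y, HasDerivAt (fun y => H (u + e y, y)) (J (u + e y, y)) y := by
      intro y
      have := hasDerivAt_comp_pair (hH.differentiable one_ne_zero)
        (((he.differentiable one_ne_zero) y).hasDerivAt.const_add u) (hasDerivAt_id y)
      simpa [hJd] using this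
    have hslice : ∀ {G : ℝ × ℝ → ℂ}, Continuous G → HasCompactSupport G →
        Integrable fun y : ℝ => G (u + e y, y) := by
      intro G hG hGs
      apply Continuous.integrable_of_hasCompactSupport (by fun_prop)
      refine HasCompactSupport.intro (hGs.isCompact.image continuous_snd) fun x hx => ?_
      by_contra h
      exact hx ⟨(u + e x, x), subset_tsupport _ h, rfl⟩
    exact integral_eq_zero_of_hasDerivAt_of_integrable hder (hslice hJc hJs)
      (hslice hH.continuous hc)
  · simp

lemma green_direction {H : ℝ × ℝ → ℂ} (hH : ContDiff ℝ 1 H) (hc : HasCompactSupport H)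
    {e : ℝ → ℝ} (he : ContDiff ℝ 1 e) (p : ℝ × ℝ) :
    ∫ y : ℝ × ℝ, (if e y.2 ≤ y.1 then (p.1 : ℂ) * partial₁ H y + (p.2 : ℂ) * partial₂ H y else 0)
      = -∫ y : ℝ, ((p.1 - p.2 * deriv e y : ℝ) : ℂ) * H (e y, y) := by
  have hed : Continuous (deriv e) := he.continuous_deriv le_rfl
  have h1 := green₁ hH hc he.continuous (c := fun y => ((p.1 - p.2 * deriv e y : ℝ) : ℂ))
    (by fun_prop)
  have h2 := green₂ hH hc he
  rw [← h1, ← sub_eq_zero, ← integral_sub]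
  · rw [← mul_zero (p.2 : ℂ), ← h2, ← integral_const_mul]
    congr 1
    funext y
    split_ifs
    · push_cast; ring
    · simp
  · apply integrable_ite he.continuous
    have := continuous_partial₁ hH
    have := continuous_partial₂ hH
    exact Continuous.integrable_of_hasCompactSupport (by fun_prop)
      (hc.partial₁.mul_left.add hc.partial₂.mul_left)
  · apply integrable_ite he.continuous
    have := continuous_partial₁ hH
    exact Continuous.integrable_of_hasCompactSupport (by fun_prop) hc.partial₁.mul_left

/-- Fourier-type integral of `F` over the half plane `{y₁ ≥ e(y₂)}`. -/
def halfInt (e : ℝ → ℝ) (F : ℝ × ℝ → ℂ) (ζ : ℝ × ℝ) : ℂ :=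
  ∫ y : ℝ × ℝ, (if e y.2 ≤ y.1 then F y else 0) *
    Complex.exp (-Complex.I * ((ζ.1 * y.1 + ζ.2 * y.2 : ℝ) : ℂ))

/-- Fourier-type integral of `b` along the curve `y₁ = e(y₂)`. -/
def edgeInt (e : ℝ → ℝ) (b : ℝ → ℂ) (ζ : ℝ × ℝ) : ℂ :=
  ∫ y : ℝ, b y * Complex.exp (-Complex.I * ((ζ.1 * e y + ζ.2 * y : ℝ) : ℂ))

lemma partial_mul_cexp {F : ℝ × ℝ → ℂ} (hF : ContDiff ℝ 1 F) (ζ y : ℝ × ℝ) :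
    partial₁ (fun y => F y * Complex.exp (-Complex.I * ((ζ.1 * y.1 + ζ.2 * y.2 : ℝ) : ℂ))) y =
      (partial₁ F y - Complex.I * ζ.1 * F y) *
        Complex.exp (-Complex.I * ((ζ.1 * y.1 + ζ.2 * y.2 : ℝ) : ℂ)) ∧
    partial₂ (fun y => F y * Complex.exp (-Complex.I * ((ζ.1 * y.1 + ζ.2 * y.2 : ℝ) : ℂ))) y =
      (partial₂ F y - Complex.I * ζ.2 * F y) *
        Complex.exp (-Complex.I * ((ζ.1 * y.1 + ζ.2 * y.2 : ℝ) : ℂ)) := by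
  have hL : HasFDerivAt (fun y : ℝ × ℝ => -Complex.I * ((ζ.1 * y.1 + ζ.2 * y.2 : ℝ) : ℂ))
      ((-Complex.I) • (Complex.ofRealCLM.comp (ζ.1 • ContinuousLinearMap.fst ℝ ℝ ℝ +
        ζ.2 • ContinuousLinearMap.snd ℝ ℝ ℝ))) y := by
    have h := (Complex.ofRealCLM.comp (ζ.1 • ContinuousLinearMap.fst ℝ ℝ ℝ +
        ζ.2 • ContinuousLinearMap.snd ℝ ℝ ℝ)).hasFDerivAt (x := y)
    exact (h.const_mul (-Complex.I))
  have h := ((hF.differentiable one_ne_zero) y).hasFDerivAt.mul hL.cexp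
  constructor
  · refine (congrArg (fun L : (ℝ × ℝ) →L[ℝ] ℂ => L (1, 0)) h.fderiv).trans ?_
    simp [partial₁]
    ring
  · refine (congrArg (fun L : (ℝ × ℝ) →L[ℝ] ℂ => L (0, 1)) h.fderiv).trans ?_
    simp [partial₂]
    ring

/-- Integration by parts of a half plane integral in the direction `p`. -/
lemma halfInt_by_parts {F : ℝ × ℝ → ℂ} (hF : ContDiff ℝ 1 F) (hc : HasCompactSupport F)
    {e : ℝ → ℝ} (he : ContDiff ℝ 1 e) (p ζ : ℝ × ℝ) :
    Complex.I * ((p.1 * ζ.1 + p.2 * ζ.2 : ℝ) : ℂ) * halfInt e F ζ =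
      p.1 * halfInt e (partial₁ F) ζ + p.2 * halfInt e (partial₂ F) ζ +
        edgeInt e (fun y => ((p.1 - p.2 * deriv e y : ℝ) : ℂ) * F (e y, y)) ζ := by
  have hexp : ContDiff ℝ 1 fun y : ℝ × ℝ =>
      Complex.exp (-Complex.I * ((ζ.1 * y.1 + ζ.2 * y.2 : ℝ) : ℂ)) := by
    apply ContDiff.cexp
    apply contDiff_const.mul
    exact Complex.ofRealCLM.contDiff.comp
      ((contDiff_const.mul contDiff_fst).add (contDiff_const.mul contDiff_snd))
  have h := green_direction (hF.mul hexp) hc.mul_right he p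
  have hi : ∀ {G : ℝ × ℝ → ℂ}, Continuous G → HasCompactSupport G →
      Integrable fun y : ℝ × ℝ => (if e y.2 ≤ y.1 then G y else 0) *
        Complex.exp (-Complex.I * ((ζ.1 * y.1 + ζ.2 * y.2 : ℝ) : ℂ)) := by
    intro G hG hGs
    refine (integrable_ite he.continuous (J := fun y => G y *
      Complex.exp (-Complex.I * ((ζ.1 * y.1 + ζ.2 * y.2 : ℝ) : ℂ))) ?_).congr ?_
    · exact (hG.mul hexp.continuous).integrable_of_hasCompactSupport hGs.mul_right
    · exact ae_of_all _ fun y => by dsimp only; split_ifs <;> simp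
  have i0 := hi hF.continuous hc
  have i1 := hi (continuous_partial₁ hF) hc.partial₁
  have i2 := hi (continuous_partial₂ hF) hc.partial₂
  have hE : edgeInt e (fun y => ((p.1 - p.2 * deriv e y : ℝ) : ℂ) * F (e y, y)) ζ =
      ∫ y : ℝ, ((p.1 - p.2 * deriv e y : ℝ) : ℂ) * (F (e y, y) *
        Complex.exp (-Complex.I * ((ζ.1 * e y + ζ.2 * y : ℝ) : ℂ))) := by
    rw [edgeInt]; congr 1; funext y; ring
  have h' := (neg_eq_iff_eq_neg.2 h).symm
  rw [hE, h', halfInt, halfInt, halfInt, ← integral_const_mul, ← integral_const_mul,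
    ← integral_const_mul, ← integral_neg, ← integral_add (i1.const_mul _) (i2.const_mul _)]
  refine Eq.trans ?_ (integral_add ((i1.const_mul (p.1 : ℂ)).add (i2.const_mul (p.2 : ℂ))) ?_)
  · congr 1
    funext y
    obtain ⟨q1, q2⟩ := partial_mul_cexp hF ζ y
    split_ifs
    · erw [q1, q2]
      push_cast
      ring
    · simp
  · refine Integrable.neg ?_
    apply integrable_ite he.continuous
    have k1 := continuous_partial₁ (hF.mul hexp)
    have k2 := continuous_partial₂ (hF.mul hexp)
    have s1 : HasCompactSupport (F * fun y : ℝ × ℝ =>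
      Complex.exp (-Complex.I * ((ζ.1 * y.1 + ζ.2 * y.2 : ℝ) : ℂ))) := hc.mul_right
    exact Continuous.integrable_of_hasCompactSupport (by fun_prop)
      (s1.partial₁.mul_left.add s1.partial₂.mul_left)

/-- `Q` is continuous and its square integral over `freqRange ε` is at most `K`. -/
structure SqBound (ε K : ℝ) (Q : ℝ → ℂ) : Prop where
  cont : Continuous Q
  le : ∫ ρ in freqRange ε, ‖Q ρ‖ ^ 2 ≤ K

lemma integrableOn_freqRange {ε : ℝ} (hε : 0 < ε) {Q : ℝ → ℝ} (hQ : Continuous Q) :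
    IntegrableOn Q (freqRange ε) :=
  hQ.continuousOn.integrableOn_compact (isCompact_freqRange hε)

lemma SqBound.mono {ε K L : ℝ} {Q : ℝ → ℂ} (h : SqBound ε K Q) (hKL : K ≤ L) : SqBound ε L Q :=
  ⟨h.cont, h.le.trans hKL⟩

lemma SqBound.of_norm_le {ε K a : ℝ} (hε : 0 < ε) {Q R : ℝ → ℂ} (hR : SqBound ε K R)
    (hQ : Continuous Q) (h : ∀ ρ ∈ freqRange ε, ‖Q ρ‖ ≤ a * ‖R ρ‖) :
    SqBound ε (a ^ 2 * K) Q := by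
  refine ⟨hQ, ?_⟩
  calc ∫ ρ in freqRange ε, ‖Q ρ‖ ^ 2 ≤ ∫ ρ in freqRange ε, a ^ 2 * ‖R ρ‖ ^ 2 := by
        have hRc := hR.cont
        refine setIntegral_mono_on (integrableOn_freqRange hε (by fun_prop))
          (integrableOn_freqRange hε (by fun_prop)) (isClosed_freqRange ε).measurableSet
          fun ρ hρ => ?_
        rw [← mul_pow]
        exact pow_le_pow_left₀ (norm_nonneg _) (h ρ hρ) 2
    _ = a ^ 2 * ∫ ρ in freqRange ε, ‖R ρ‖ ^ 2 := integral_const_mul _ _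
    _ ≤ a ^ 2 * K := mul_le_mul_of_nonneg_left hR.le (sq_nonneg a)

lemma SqBound.of_const {ε a : ℝ} (hε : 0 < ε) {Q : ℝ → ℂ}
    (hQ : Continuous Q) (h : ∀ ρ ∈ freqRange ε, ‖Q ρ‖ ≤ a) :
    SqBound ε (a ^ 2 * (3 / ε)) Q := by
  have h1 : SqBound ε (3 / ε) (fun _ => (1 : ℂ)) := by
    refine ⟨continuous_const, ?_⟩
    simpa using volume_freqRange_le hε
  exact h1.of_norm_le hε hQ (by simpa using h)

lemma SqBound.add {ε K L : ℝ} (hε : 0 < ε) {Q R : ℝ → ℂ} (hQ : SqBound ε K Q)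
    (hR : SqBound ε L R) : SqBound ε (2 * K + 2 * L) fun ρ => Q ρ + R ρ := by
  have hQc := hQ.cont
  have hRc := hR.cont
  refine ⟨hQc.add hRc, ?_⟩
  calc ∫ ρ in freqRange ε, ‖Q ρ + R ρ‖ ^ 2
      ≤ ∫ ρ in freqRange ε, (2 * ‖Q ρ‖ ^ 2 + 2 * ‖R ρ‖ ^ 2) := by
        refine setIntegral_mono_on (integrableOn_freqRange hε (by fun_prop))
          (integrableOn_freqRange hε (by fun_prop)) (isClosed_freqRange ε).measurableSet
          fun ρ _ => ?_
        have h1 := norm_add_le (Q ρ) (R ρ)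
        nlinarith [sq_nonneg (‖Q ρ‖ - ‖R ρ‖), norm_nonneg (Q ρ + R ρ)]
    _ = 2 * (∫ ρ in freqRange ε, ‖Q ρ‖ ^ 2) + 2 * ∫ ρ in freqRange ε, ‖R ρ‖ ^ 2 := by
        rw [integral_add (integrableOn_freqRange hε (by fun_prop))
          (integrableOn_freqRange hε (by fun_prop)), integral_const_mul, integral_const_mul]
    _ ≤ 2 * K + 2 * L := by linarith [hQ.le, hR.le]

/-- Integration by parts for an oscillatory integral without boundary terms. -/
lemma osc_by_parts {w w' w'' : ℝ → ℝ} {A A' : ℝ → ℂ}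
    (hw : ∀ y, HasDerivAt w (w' y) y) (hw' : ∀ y, HasDerivAt w' (w'' y) y)
    (hw'' : Continuous w'') (hA : ∀ y ∈ Icc (-4 : ℝ) 4, HasDerivAt A (A' y) y)
    (hA' : ContinuousOn A' (Icc (-4) 4)) (h0 : ∀ y ∈ Icc (-4 : ℝ) 4, w' y ≠ 0)
    (h4 : A 4 = 0) (h4' : A (-4) = 0) (ρ : ℝ) :
    Complex.I * ρ * (∫ y in Icc (-4 : ℝ) 4, A y * Complex.exp (-Complex.I * ((ρ * w y : ℝ) : ℂ))) =
      ∫ y in Icc (-4 : ℝ) 4, (A' y / (w' y : ℂ) - A y * (w'' y : ℂ) / (w' y : ℂ) ^ 2) *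
        Complex.exp (-Complex.I * ((ρ * w y : ℝ) : ℂ)) := by
  have hle : (-4 : ℝ) ≤ 4 := by norm_num
  have hwc : Continuous w := continuous_iff_continuousAt.2 fun y => (hw y).continuousAt
  have hwc' : Continuous w' := continuous_iff_continuousAt.2 fun y => (hw' y).continuousAt
  have hAc : ContinuousOn A (Icc (-4) 4) := fun y hy => (hA y hy).continuousAt.continuousWithinAt
  have h0c : ∀ y ∈ Icc (-4 : ℝ) 4, (w' y : ℂ) ≠ 0 := fun y hy => by exact_mod_cast h0 y hy
  have hu : ∀ y ∈ uIcc (-4 : ℝ) 4, HasDerivAt (fun y => A y / (w' y : ℂ))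
      (A' y / (w' y : ℂ) - A y * (w'' y : ℂ) / (w' y : ℂ) ^ 2) y := by
    intro y hy
    rw [uIcc_of_le hle] at hy
    refine ((hA y hy).div (hw' y).ofReal_comp (h0c y hy)).congr_deriv ?_
    have := h0c y hy
    field_simp
  have hv : ∀ y ∈ uIcc (-4 : ℝ) 4, HasDerivAt
      (fun y => Complex.exp (-Complex.I * ((ρ * w y : ℝ) : ℂ)))
      (-Complex.I * ρ * w' y * Complex.exp (-Complex.I * ((ρ * w y : ℝ) : ℂ))) y := by
    intro y _
    refine ((((hw y).const_mul ρ).ofReal_comp).const_mul (-Complex.I)).cexp.congr_deriv ?_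
    push_cast
    ring
  have hu' : ContinuousOn (fun y => A' y / (w' y : ℂ) - A y * (w'' y : ℂ) / (w' y : ℂ) ^ 2)
      (Icc (-4) 4) := by
    have c1 : ContinuousOn (fun y => (w' y : ℂ)) (Icc (-4) 4) := by fun_prop
    have c2 : ContinuousOn (fun y => (w'' y : ℂ)) (Icc (-4) 4) := by fun_prop
    exact (hA'.div c1 h0c).sub ((hAc.mul c2).div (c1.pow 2) fun y hy => pow_ne_zero 2 (h0c y hy))
  have h := intervalIntegral.integral_mul_deriv_eq_deriv_mul hu hv
    (by
      apply ContinuousOn.intervalIntegrable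
      rwa [uIcc_of_le hle])
    (by
      apply Continuous.intervalIntegrable
      fun_prop)
  simp only [h4, h4', zero_div, zero_mul, sub_zero, zero_sub] at h
  rw [intervalIntegral.integral_of_le hle, intervalIntegral.integral_of_le hle,
    ← integral_Icc_eq_integral_Ioc, ← integral_Icc_eq_integral_Ioc] at h
  rw [← neg_eq_iff_eq_neg.2 h, ← integral_neg, ← integral_const_mul]
  refine setIntegral_congr_fun measurableSet_Icc fun y hy => ?_
  have := h0c y hy
  field_simp

lemma sqBound_interval {ε m M : ℝ} {b : ℝ → ℂ} {w : ℝ → ℝ} (hb : ContinuousOn b (Icc (-4) 4))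
    (hM : ∀ x ∈ Icc (-4 : ℝ) 4, ‖b x‖ ≤ M) (hw : Measurable w) (hε : 0 < ε) (hm : 0 < m)
    (hwm : ∀ x ∈ Icc (-4 : ℝ) 4, ∀ y ∈ Icc (-4 : ℝ) 4, m * |x - y| ≤ |w x - w y|) :
    SqBound ε (16 * π * Real.exp 2 * M ^ 2 / m) fun ρ =>
      ∫ x in Icc (-4 : ℝ) 4, b x * Complex.exp (-Complex.I * ((ρ * w x : ℝ) : ℂ)) :=
  ⟨continuous_oscillatory (hb.integrableOn_compact isCompact_Icc) hw,
    schur_interval (hb.aestronglyMeasurable measurableSet_Icc) hM hw hε hm hwm⟩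

lemma abs_inv_le_of_mem_freqRange {ε ρ : ℝ} (hε : 0 < ε) (hρ : ρ ∈ freqRange ε) :
    ρ ≠ 0 ∧ |ρ|⁻¹ ≤ 3 * ε := by
  have h := hρ.1
  have hρ0 : 0 < |ρ| := by
    by_contra h'
    nlinarith [abs_nonneg ρ]
  refine ⟨abs_pos.1 hρ0, ?_⟩
  rw [inv_le_iff_one_le_mul₀ hρ0]
  nlinarith

lemma sqBound_edge_amplitude {ε m M : ℝ} {w w' w'' κ κ' : ℝ → ℝ} {β β' β'' : ℝ → ℂ}
    (hε : 0 < ε) (hm : 0 < m) (hm1 : m ≤ 1) (hεm : ε ≤ 2 * m) (hε1 : ε ≤ 1)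
    (hw : ∀ y, HasDerivAt w (w' y) y) (hw' : ∀ y, HasDerivAt w' (w'' y) y)
    (hw'' : Continuous w'') (hκ : ∀ y, HasDerivAt κ (κ' y) y) (hκ' : Continuous κ')
    (hβ : ∀ y, HasDerivAt β (β' y) y) (hβ' : ∀ y, HasDerivAt β' (β'' y) y) (hβ'' : Continuous β'')
    (b4 : β 4 = 0) (b4' : β (-4) = 0) (c4 : β' 4 = 0) (c4' : β' (-4) = 0)
    (hwm : ∀ x ∈ Icc (-4 : ℝ) 4, ∀ y ∈ Icc (-4 : ℝ) 4, m * |x - y| ≤ |w x - w y|)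
    (kw' : ∀ y ∈ Icc (-4 : ℝ) 4, m ≤ |w' y|) (kw'' : ∀ y ∈ Icc (-4 : ℝ) 4, |w'' y| ≤ M * ε)
    (kκ : ∀ y ∈ Icc (-4 : ℝ) 4, |κ y| ≤ M) (kκ' : ∀ y ∈ Icc (-4 : ℝ) 4, |κ' y| ≤ M * ε)
    (kβ : ∀ y ∈ Icc (-4 : ℝ) 4, ‖β y‖ ≤ M) (kβ' : ∀ y ∈ Icc (-4 : ℝ) 4, ‖β' y‖ ≤ M)
    (kβ'' : ∀ y ∈ Icc (-4 : ℝ) 4, ‖β'' y‖ ≤ M) :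
    SqBound ε (50000 * π * Real.exp 2 * (M ^ 2 + M ^ 3) ^ 2 * (ε ^ 4 / m ^ 5)) fun ρ =>
      ∫ y in Icc (-4 : ℝ) 4, ((κ y : ℂ) * β y) *
        Complex.exp (-Complex.I * ((ρ * w y : ℝ) : ℂ)) := by
  have hM : 0 ≤ M := (abs_nonneg _).trans (kκ 0 (by norm_num))
  have hwc : Continuous w := continuous_iff_continuousAt.2 fun y => (hw y).continuousAt
  have hwc' : Continuous w' := continuous_iff_continuousAt.2 fun y => (hw' y).continuousAt
  have hκc : Continuous κ := continuous_iff_continuousAt.2 fun y => (hκ y).continuousAt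
  have hβc : Continuous β := continuous_iff_continuousAt.2 fun y => (hβ y).continuousAt
  have hβc' : Continuous β' := continuous_iff_continuousAt.2 fun y => (hβ' y).continuousAt
  have h0 : ∀ y ∈ Icc (-4 : ℝ) 4, w' y ≠ 0 := fun y hy =>
    abs_pos.1 (hm.trans_le (kw' y hy))
  have h0c : ∀ y ∈ Icc (-4 : ℝ) 4, (w' y : ℂ) ≠ 0 := fun y hy => by exact_mod_cast h0 y hy
  have cw : ContinuousOn (fun y => (w' y : ℂ)) (Icc (-4) 4) := by fun_prop
  have hinv : ∀ y ∈ Icc (-4 : ℝ) 4, ‖(w' y : ℂ)‖⁻¹ ≤ m⁻¹ := fun y hy => by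
    rw [Complex.norm_real]
    exact inv_anti₀ hm (kw' y hy)
  set Q₁ : ℝ → ℂ := fun y => κ' y * β y / w' y - κ y * β y * w'' y / (w' y : ℂ) ^ 2 with hQ₁
  set A₂ : ℝ → ℂ := fun y => κ y * β' y / w' y with hA₂
  set A₂' : ℝ → ℂ := fun y => (κ' y * β' y + κ y * β'' y) / w' y -
    κ y * β' y * w'' y / (w' y : ℂ) ^ 2 with hA₂'
  set Q₂ : ℝ → ℂ := fun y => A₂' y / w' y - A₂ y * w'' y / (w' y : ℂ) ^ 2 with hQ₂
  have cQ₁ : ContinuousOn Q₁ (Icc (-4) 4) := by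
    refine ContinuousOn.sub (ContinuousOn.div (by fun_prop) cw h0c)
      (ContinuousOn.div (by fun_prop) (cw.pow 2) fun y hy => pow_ne_zero 2 (h0c y hy))
  have cA₂ : ContinuousOn A₂ (Icc (-4) 4) := ContinuousOn.div (by fun_prop) cw h0c
  have cA₂' : ContinuousOn A₂' (Icc (-4) 4) := by
    refine ContinuousOn.sub (ContinuousOn.div (by fun_prop) cw h0c)
      (ContinuousOn.div (by fun_prop) (cw.pow 2) fun y hy => pow_ne_zero 2 (h0c y hy))
  have cQ₂ : ContinuousOn Q₂ (Icc (-4) 4) := by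
    refine ContinuousOn.sub (cA₂'.div cw h0c)
      (ContinuousOn.div (cA₂.mul (by fun_prop)) (cw.pow 2) fun y hy => pow_ne_zero 2 (h0c y hy))
  have hA₂d : ∀ y ∈ Icc (-4 : ℝ) 4, HasDerivAt A₂ (A₂' y) y := by
    intro y hy
    refine ((((hκ y).ofReal_comp.mul (hβ' y)).div (hw' y).ofReal_comp (h0c y hy))).congr_deriv ?_
    have := h0c y hy
    simp only [hA₂', Pi.mul_apply]
    field_simp
  have kQ₁ : ∀ y ∈ Icc (-4 : ℝ) 4, ‖Q₁ y‖ ≤ (M ^ 2 + M ^ 3) * (ε / m ^ 2) := by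
    intro y hy
    have e1 : ‖(κ' y * β y / w' y : ℂ)‖ ≤ M * ε * M * m⁻¹ := by
      rw [div_eq_mul_inv, norm_mul, norm_mul, norm_inv, Complex.norm_real, Real.norm_eq_abs]
      have := kκ' y hy; have := kβ y hy; have := hinv y hy
      gcongr
    have e2 : ‖(κ y * β y * w'' y / (w' y : ℂ) ^ 2 : ℂ)‖ ≤ M * M * (M * ε) * (m⁻¹) ^ 2 := by
      rw [div_eq_mul_inv, norm_mul, norm_mul, norm_mul, norm_inv, norm_pow, ← inv_pow,
        Complex.norm_real, Complex.norm_real (w'' y), Real.norm_eq_abs, Real.norm_eq_abs]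
      have := kκ y hy; have := kβ y hy; have := hinv y hy; have := kw'' y hy
      gcongr
    have e3 : m⁻¹ ≤ (m⁻¹) ^ 2 := by
      have := one_le_inv_iff₀.2 ⟨hm, hm1⟩
      nlinarith
    calc ‖Q₁ y‖ ≤ M * ε * M * m⁻¹ + M * M * (M * ε) * (m⁻¹) ^ 2 :=
          (norm_sub_le _ _).trans (add_le_add e1 e2)
      _ ≤ M * ε * M * (m⁻¹) ^ 2 + M * M * (M * ε) * (m⁻¹) ^ 2 := by gcongr
      _ = (M ^ 2 + M ^ 3) * (ε / m ^ 2) := by rw [inv_pow, ← one_div]; ring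
  have kQ₂ : ∀ y ∈ Icc (-4 : ℝ) 4, ‖Q₂ y‖ ≤ (M ^ 2 + M ^ 3) * (4 / m ^ 2) := by
    intro y hy
    have n1 := kκ y hy; have n2 := kκ' y hy; have n3 := kβ' y hy; have n4 := kβ'' y hy
    have n5 := hinv y hy; have n6 := kw'' y hy
    have hsplit : Q₂ y = κ' y * β' y * (w' y : ℂ)⁻¹ ^ 2 + κ y * β'' y * (w' y : ℂ)⁻¹ ^ 2 -
        2 * (κ y * β' y * w'' y * (w' y : ℂ)⁻¹ ^ 3) := by
      have := h0c y hy
      simp only [hQ₂, hA₂', hA₂]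
      field_simp
      ring
    have e1 : ‖(κ' y * β' y * (w' y : ℂ)⁻¹ ^ 2 : ℂ)‖ ≤ M * ε * M * m⁻¹ ^ 2 := by
      rw [norm_mul, norm_mul, norm_pow, norm_inv, Complex.norm_real, Real.norm_eq_abs]
      gcongr
    have e2 : ‖(κ y * β'' y * (w' y : ℂ)⁻¹ ^ 2 : ℂ)‖ ≤ M * M * m⁻¹ ^ 2 := by
      rw [norm_mul, norm_mul, norm_pow, norm_inv, Complex.norm_real, Real.norm_eq_abs]
      gcongr
    have e3 : ‖(κ y * β' y * w'' y * (w' y : ℂ)⁻¹ ^ 3 : ℂ)‖ ≤ M * M * (M * ε) * m⁻¹ ^ 3 := by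
      rw [norm_mul, norm_mul, norm_mul, norm_pow, norm_inv, Complex.norm_real,
        Complex.norm_real (w'' y), Real.norm_eq_abs, Real.norm_eq_abs]
      gcongr
    have e4 : ε * m⁻¹ ≤ 2 := by
      rw [← div_eq_mul_inv, div_le_iff₀ hm]; exact hεm
    have e5 : ‖Q₂ y‖ ≤ M * ε * M * m⁻¹ ^ 2 + M * M * m⁻¹ ^ 2 + 2 * (M * M * (M * ε) * m⁻¹ ^ 3) := by
      rw [hsplit]
      refine (norm_sub_le _ _).trans (add_le_add ((norm_add_le _ _).trans (add_le_add e1 e2)) ?_)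
      rw [norm_mul]
      simpa using e3
    calc ‖Q₂ y‖ ≤ _ := e5
      _ = (M ^ 2 * ε + M ^ 2 + 2 * M ^ 3 * (ε * m⁻¹)) * m⁻¹ ^ 2 := by ring
      _ ≤ (M ^ 2 * 1 + M ^ 2 + 2 * M ^ 3 * 2) * m⁻¹ ^ 2 := by gcongr
      _ ≤ ((M ^ 2 + M ^ 3) * 4) * m⁻¹ ^ 2 := by gcongr; nlinarith [sq_nonneg M]
      _ = (M ^ 2 + M ^ 3) * (4 / m ^ 2) := by rw [inv_pow, ← one_div]; ring
  have s₁ := sqBound_interval cQ₁ kQ₁ hwc.measurable hε hm hwm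
  have s₂ := sqBound_interval cQ₂ kQ₂ hwc.measurable hε hm hwm
  have cA : Continuous fun y => (κ y : ℂ) * β y := by fun_prop
  have p₁ : ∀ ρ : ℝ, Complex.I * ρ * (∫ y in Icc (-4 : ℝ) 4, ((κ y : ℂ) * β y) *
        Complex.exp (-Complex.I * ((ρ * w y : ℝ) : ℂ))) =
      (∫ y in Icc (-4 : ℝ) 4, Q₁ y * Complex.exp (-Complex.I * ((ρ * w y : ℝ) : ℂ))) +
      ∫ y in Icc (-4 : ℝ) 4, A₂ y * Complex.exp (-Complex.I * ((ρ * w y : ℝ) : ℂ)) := by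
    intro ρ
    rw [osc_by_parts (A := fun y => (κ y : ℂ) * β y) hw hw' hw'' (fun y _ => (hκ y).ofReal_comp.mul (hβ y)) (by fun_prop) h0
      (by simp [b4]) (by simp [b4']) ρ, ← integral_add]
    · congr 1
      funext y
      simp only [hQ₁, hA₂]
      ring
    · exact (cQ₁.mul (by fun_prop)).integrableOn_compact isCompact_Icc
    · exact (cA₂.mul (by fun_prop)).integrableOn_compact isCompact_Icc
  have p₂ : ∀ ρ : ℝ, Complex.I * ρ * (∫ y in Icc (-4 : ℝ) 4, A₂ y *
        Complex.exp (-Complex.I * ((ρ * w y : ℝ) : ℂ))) =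
      ∫ y in Icc (-4 : ℝ) 4, Q₂ y * Complex.exp (-Complex.I * ((ρ * w y : ℝ) : ℂ)) :=
    osc_by_parts hw hw' hw'' hA₂d cA₂' h0 (by simp [hA₂, c4]) (by simp [hA₂, c4'])
  have hdiv : ∀ {X Y : ℂ} {ρ : ℝ}, ρ ∈ freqRange ε → Complex.I * ρ * X = Y →
      ‖X‖ ≤ 3 * ε * ‖Y‖ := by
    intro X Y ρ hρ h
    obtain ⟨h1, h2⟩ := abs_inv_le_of_mem_freqRange hε hρ
    have : ‖X‖ = |ρ|⁻¹ * ‖Y‖ := by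
      rw [← h]
      simp [h1]
    rw [this]
    gcongr
  have s₃ : SqBound ε _ fun ρ : ℝ => ∫ y in Icc (-4 : ℝ) 4, A₂ y *
      Complex.exp (-Complex.I * ((ρ * w y : ℝ) : ℂ)) := s₂.of_norm_le hε
    (continuous_oscillatory (cA₂.integrableOn_compact isCompact_Icc) hwc.measurable)
    fun ρ hρ => hdiv hρ (p₂ ρ)
  have s₄ := (s₁.add hε s₃).of_norm_le hε (continuous_oscillatory
    (cA.continuousOn.integrableOn_compact isCompact_Icc) hwc.measurable)
    fun ρ hρ => hdiv hρ (p₁ ρ)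
  refine s₄.mono ?_
  have e1 : (3 * ε) ^ 2 * (2 * (16 * π * Real.exp 2 * ((M ^ 2 + M ^ 3) * (ε / m ^ 2)) ^ 2 / m) +
      2 * ((3 * ε) ^ 2 * (16 * π * Real.exp 2 * ((M ^ 2 + M ^ 3) * (4 / m ^ 2)) ^ 2 / m))) =
      41760 * (π * Real.exp 2 * (M ^ 2 + M ^ 3) ^ 2 * (ε ^ 4 / m ^ 5)) := by
    field_simp
    ring
  rw [e1]
  have : 0 ≤ π * Real.exp 2 * (M ^ 2 + M ^ 3) ^ 2 * (ε ^ 4 / m ^ 5) := by positivity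
  linarith

/-- The edge curve after dilation by `ε⁻¹`. -/
def scaledEdge (E : ℝ → ℝ) (ε : ℝ) : ℝ → ℝ := fun y => ε⁻¹ * E (ε * y)

/-- The dilate `y ↦ f(εy)`. -/
def dilate (f : ℝ × ℝ → ℂ) (ε : ℝ) : ℝ × ℝ → ℂ := fun y => f (ε * y.1, ε * y.2)

/-- The point `ρ p + v`. -/
def linePoint (p v : ℝ × ℝ) (ρ : ℝ) : ℝ × ℝ := (ρ * p.1 + v.1, ρ * p.2 + v.2)

/-- Parameters of a line `ρ ↦ ρ p + v` at scale `ε`. -/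
structure IsLineParam (ε : ℝ) (p v : ℝ × ℝ) : Prop where
  pos : 0 < ε
  le : ε ≤ 1 / 32
  one_le : 1 ≤ p.1 ^ 2 + p.2 ^ 2
  le_two : p.1 ^ 2 + p.2 ^ 2 ≤ 2
  abs_fst : |v.1| ≤ 1
  abs_snd : |v.2| ≤ 1

lemma IsLineParam.abs_p_fst {ε : ℝ} {p v : ℝ × ℝ} (h : IsLineParam ε p v) : |p.1| ≤ 2 :=
  abs_le.2 ⟨by nlinarith [h.le_two, sq_nonneg p.2], by nlinarith [h.le_two, sq_nonneg p.2]⟩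

lemma IsLineParam.abs_p_snd {ε : ℝ} {p v : ℝ × ℝ} (h : IsLineParam ε p v) : |p.2| ≤ 2 :=
  abs_le.2 ⟨by nlinarith [h.le_two, sq_nonneg p.1], by nlinarith [h.le_two, sq_nonneg p.1]⟩

/-- Quadratic bounds for the edge function near the origin. -/
structure IsFlatEdge (E : ℝ → ℝ) (c : ℝ) : Prop where
  contDiff : ContDiff ℝ 2 E
  nonneg : 0 ≤ c
  bound : ∀ x, |x| ≤ 1 → |E x| ≤ c * x ^ 2
  deriv_bound : ∀ x, |x| ≤ 1 → |deriv E x| ≤ c * |x|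
  deriv2_bound : ∀ x, |x| ≤ 1 → |deriv (deriv E) x| ≤ c

lemma abs_le_of_hasDerivAt {F F' : ℝ → ℝ} (hF : ∀ x, HasDerivAt F (F' x) x) (h0 : F 0 = 0)
    {x B : ℝ} (hB : ∀ y, |y| ≤ |x| → |F' y| ≤ B) : |F x| ≤ B * |x| := by
  have h := (convex_closedBall (0 : ℝ) |x|).norm_image_sub_le_of_norm_hasDerivWithin_le
    (f := F) (f' := F') (C := B) (x := 0) (y := x) (fun y _ => (hF y).hasDerivWithinAt)
    (fun y hy => hB y (by simpa using hy)) (by simp) (by simp)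
  simpa [h0] using h

lemma exists_isFlatEdge {E : ℝ → ℝ} (hE : ContDiff ℝ 2 E) (h0 : E 0 = 0) (h0' : deriv E 0 = 0) :
    ∃ c, IsFlatEdge E c := by
  have hE1 : ContDiff ℝ 1 (deriv E) := ((contDiff_succ_iff_deriv (n := 1)).1 hE).2.2
  have hE2 : Continuous (deriv (deriv E)) := hE1.continuous_deriv le_rfl
  obtain ⟨c, hc⟩ := (isCompact_Icc (a := (-1 : ℝ)) (b := 1)).exists_bound_of_continuousOn
    hE2.continuousOn
  have hc' : ∀ x, |x| ≤ 1 → |deriv (deriv E) x| ≤ c := fun x hx => hc x (abs_le.1 hx)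
  have hd : ∀ x, HasDerivAt (deriv E) (deriv (deriv E) x) x := fun x =>
    (hE1.differentiable one_ne_zero x).hasDerivAt
  have hd0 : ∀ x, HasDerivAt E (deriv E x) x := fun x =>
    (hE.differentiable two_ne_zero x).hasDerivAt
  have hb1 : ∀ x, |x| ≤ 1 → |deriv E x| ≤ c * |x| := fun x hx =>
    abs_le_of_hasDerivAt hd h0' fun y hy => hc' y (hy.trans hx)
  have hc0 : 0 ≤ c := (abs_nonneg _).trans (hc' 0 (by simp))
  refine ⟨c, hE, hc0, fun x hx => ?_, hb1, hc'⟩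
  have := abs_le_of_hasDerivAt hd0 h0 (x := x) (B := c * |x|) fun y hy =>
    (hb1 y (hy.trans hx)).trans (by gcongr)
  rwa [mul_assoc, ← sq, sq_abs] at this

section
variable {E : ℝ → ℝ} {c ε : ℝ}

lemma IsFlatEdge.hasDerivAt_scaledEdge (h : IsFlatEdge E c) (hε : 0 < ε) (y : ℝ) :
    HasDerivAt (scaledEdge E ε) (deriv E (ε * y)) y := by
  have h1 : HasDerivAt (fun y : ℝ => ε * y) ε y := by
    simpa using (hasDerivAt_id y).const_mul ε
  have h2 := ((h.contDiff.differentiable two_ne_zero (ε * y)).hasDerivAt.comp y h1).const_mul ε⁻¹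
  refine h2.congr_deriv ?_
  field_simp

lemma IsFlatEdge.hasDerivAt_deriv (h : IsFlatEdge E c) (y : ℝ) :
    HasDerivAt (fun y => deriv E (ε * y)) (ε * deriv (deriv E) (ε * y)) y := by
  have h1 : HasDerivAt (fun y : ℝ => ε * y) ε y := by
    simpa using (hasDerivAt_id y).const_mul ε
  have hE1 : ContDiff ℝ 1 (deriv E) := ((contDiff_succ_iff_deriv (n := 1)).1 h.contDiff).2.2
  exact ((hE1.differentiable one_ne_zero (ε * y)).hasDerivAt.comp y h1).congr_deriv (mul_comm _ _)

lemma IsFlatEdge.continuous_deriv2 (h : IsFlatEdge E c) : Continuous (deriv (deriv E)) :=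
  (((contDiff_succ_iff_deriv (n := 1)).1 h.contDiff).2.2).continuous_deriv le_rfl

lemma IsFlatEdge.contDiff_scaledEdge (h : IsFlatEdge E c) : ContDiff ℝ 2 (scaledEdge E ε) :=
  contDiff_const.mul (h.contDiff.comp (contDiff_const.mul contDiff_id))

lemma abs_mul_le_of_mem {y : ℝ} (hε : 0 < ε) (hε1 : ε ≤ 1 / 32) (hy : y ∈ Icc (-4 : ℝ) 4) :
    |ε * y| ≤ 4 * ε ∧ |ε * y| ≤ 1 := by
  have h1 : |y| ≤ 4 := abs_le.2 hy
  rw [abs_mul, abs_of_pos hε]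
  constructor <;> nlinarith [abs_nonneg y]

lemma IsFlatEdge.abs_scaledEdge_le (h : IsFlatEdge E c) (hε : 0 < ε) (hε1 : ε ≤ 1 / 32) {y : ℝ}
    (hy : y ∈ Icc (-4 : ℝ) 4) : |scaledEdge E ε y| ≤ c := by
  obtain ⟨h1, h2⟩ := abs_mul_le_of_mem hε hε1 hy
  have h3 := h.bound _ h2
  have h4 : (ε * y) ^ 2 ≤ 16 * ε * ε := by
    have := (sq_le_sq' (by linarith [abs_nonneg (ε * y)]) h1)
    rw [sq_abs] at this
    linarith
  have hc := h.nonneg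
  rw [scaledEdge, abs_mul, abs_of_pos (inv_pos.2 hε), inv_mul_le_iff₀ hε]
  calc |E (ε * y)| ≤ c * (16 * ε * ε) := h3.trans (by gcongr)
    _ ≤ c * (1 * ε) := by gcongr; linarith
    _ = ε * c := by ring

lemma IsFlatEdge.abs_deriv_le (h : IsFlatEdge E c) (hε : 0 < ε) (hε1 : ε ≤ 1 / 32) {y : ℝ}
    (hy : y ∈ Icc (-4 : ℝ) 4) : |deriv E (ε * y)| ≤ 4 * c * ε := by
  obtain ⟨h1, h2⟩ := abs_mul_le_of_mem hε hε1 hy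
  have hc := h.nonneg
  calc |deriv E (ε * y)| ≤ c * (4 * ε) := (h.deriv_bound _ h2).trans (by gcongr)
    _ = 4 * c * ε := by ring

lemma IsFlatEdge.abs_deriv_le' (h : IsFlatEdge E c) (hε : 0 < ε) (hε1 : ε ≤ 1 / 32) {y : ℝ}
    (hy : y ∈ Icc (-4 : ℝ) 4) : |deriv E (ε * y)| ≤ c :=
  (h.abs_deriv_le hε hε1 hy).trans (by nlinarith [h.nonneg])

lemma IsFlatEdge.abs_deriv2_le (h : IsFlatEdge E c) (hε : 0 < ε) (hε1 : ε ≤ 1 / 32) {y : ℝ}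
    (hy : y ∈ Icc (-4 : ℝ) 4) : |ε * deriv (deriv E) (ε * y)| ≤ c * ε := by
  obtain ⟨h1, h2⟩ := abs_mul_le_of_mem hε hε1 hy
  rw [abs_mul, abs_of_pos hε, mul_comm]
  exact mul_le_mul_of_nonneg_right (h.deriv2_bound _ h2) hε.le

lemma IsFlatEdge.abs_scaledEdge_sub_le (h : IsFlatEdge E c) (hε : 0 < ε) (hε1 : ε ≤ 1 / 32)
    {x y : ℝ} (hx : x ∈ Icc (-4 : ℝ) 4) (hy : y ∈ Icc (-4 : ℝ) 4) :
    |scaledEdge E ε x - scaledEdge E ε y| ≤ 4 * c * ε * |x - y| :=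
  (convex_Icc (-4 : ℝ) 4).norm_image_sub_le_of_norm_hasDerivWithin_le
    (fun z _ => (h.hasDerivAt_scaledEdge hε z).hasDerivWithinAt)
    (fun _ hz => h.abs_deriv_le hε hε1 hz) hy hx

lemma IsFlatEdge.phase_lower (h : IsFlatEdge E c) {p v : ℝ × ℝ} (hp : IsLineParam ε p v)
    (hpc : 16 * c * ε ≤ |p.2|) {x y : ℝ} (hx : x ∈ Icc (-4 : ℝ) 4) (hy : y ∈ Icc (-4 : ℝ) 4) :
    |p.2| / 2 * |x - y| ≤
      |(p.1 * scaledEdge E ε x + p.2 * x) - (p.1 * scaledEdge E ε y + p.2 * y)| := by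
  have h1 := h.abs_scaledEdge_sub_le hp.pos hp.le hx hy
  have h2 : |p.1 * (scaledEdge E ε x - scaledEdge E ε y)| ≤ |p.2| / 2 * |x - y| := by
    rw [abs_mul]
    calc |p.1| * |scaledEdge E ε x - scaledEdge E ε y| ≤ 2 * (4 * c * ε * |x - y|) := by
          gcongr; exact hp.abs_p_fst
      _ = (16 * c * ε) / 2 * |x - y| := by ring
      _ ≤ _ := by gcongr
  have h3 : (p.1 * scaledEdge E ε x + p.2 * x) - (p.1 * scaledEdge E ε y + p.2 * y) =
      p.2 * (x - y) + p.1 * (scaledEdge E ε x - scaledEdge E ε y) := by ring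
  have h4 := abs_sub_abs_le_abs_add (p.2 * (x - y))
    (p.1 * (scaledEdge E ε x - scaledEdge E ε y))
  rw [h3]
  rw [abs_mul] at h4
  linarith

end

/-- `b` is twice continuously differentiable with derivatives `b'`, `b''`, and all three are
bounded by `M` on `[-4, 4]`. -/
structure IsC2Bound (M : ℝ) (b b' b'' : ℝ → ℂ) : Prop where
  d₁ : ∀ y, HasDerivAt b (b' y) y
  d₂ : ∀ y, HasDerivAt b' (b'' y) y
  cont : Continuous b''
  k₀ : ∀ y ∈ Icc (-4 : ℝ) 4, ‖b y‖ ≤ M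
  k₁ : ∀ y ∈ Icc (-4 : ℝ) 4, ‖b' y‖ ≤ M
  k₂ : ∀ y ∈ Icc (-4 : ℝ) 4, ‖b'' y‖ ≤ M

lemma IsC2Bound.mul {M L : ℝ} {b b' b'' d d' d'' : ℝ → ℂ} (hb : IsC2Bound M b b' b'')
    (hd : IsC2Bound L d d' d'') :
    IsC2Bound (4 * (M * L)) (fun y => b y * d y) (fun y => b' y * d y + b y * d' y)
      (fun y => b'' y * d y + 2 * (b' y * d' y) + b y * d'' y) := by
  have hM : 0 ≤ M := (norm_nonneg _).trans (hb.k₀ 0 (by norm_num))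
  have hL : 0 ≤ L := (norm_nonneg _).trans (hd.k₀ 0 (by norm_num))
  have hML := mul_nonneg hM hL
  have c0 : Continuous b := continuous_iff_continuousAt.2 fun y => (hb.d₁ y).continuousAt
  have c1 : Continuous b' := continuous_iff_continuousAt.2 fun y => (hb.d₂ y).continuousAt
  have c2 : Continuous d := continuous_iff_continuousAt.2 fun y => (hd.d₁ y).continuousAt
  have c3 : Continuous d' := continuous_iff_continuousAt.2 fun y => (hd.d₂ y).continuousAt
  have c4 := hb.cont
  have c5 := hd.cont
  have key : ∀ {x z : ℂ}, ‖x‖ ≤ M → ‖z‖ ≤ L → ‖x * z‖ ≤ M * L := fun hx hz => by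
    rw [norm_mul]; gcongr
  refine ⟨fun y => (hb.d₁ y).mul (hd.d₁ y), fun y => ?_, by fun_prop, fun y hy => ?_,
    fun y hy => ?_, fun y hy => ?_⟩
  · refine (((hb.d₂ y).mul (hd.d₁ y)).add ((hb.d₁ y).mul (hd.d₂ y))).congr_deriv ?_
    ring
  · linarith [key (hb.k₀ y hy) (hd.k₀ y hy)]
  · linarith [key (hb.k₁ y hy) (hd.k₀ y hy), key (hb.k₀ y hy) (hd.k₁ y hy),
      norm_add_le (b' y * d y) (b y * d' y)]
  · have h1 := norm_add₃_le (a := b'' y * d y) (b := 2 * (b' y * d' y)) (c := b y * d'' y)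
    rw [norm_mul 2] at h1
    norm_num only [Complex.norm_ofNat] at h1
    linarith [key (hb.k₂ y hy) (hd.k₀ y hy), key (hb.k₁ y hy) (hd.k₁ y hy),
      key (hb.k₀ y hy) (hd.k₂ y hy)]

lemma IsC2Bound.mono {M L : ℝ} {b b' b'' : ℝ → ℂ} (hb : IsC2Bound M b b' b'') (h : M ≤ L) :
    IsC2Bound L b b' b'' :=
  ⟨hb.d₁, hb.d₂, hb.cont, fun y hy => (hb.k₀ y hy).trans h, fun y hy => (hb.k₁ y hy).trans h,
    fun y hy => (hb.k₂ y hy).trans h⟩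

lemma contDiff_partial₁ {F : ℝ × ℝ → ℂ} {n : ℕ} (hF : ContDiff ℝ (n + 1) F) :
    ContDiff ℝ n (partial₁ F) :=
  (hF.fderiv_right le_rfl).clm_apply contDiff_const

lemma contDiff_partial₂ {F : ℝ × ℝ → ℂ} {n : ℕ} (hF : ContDiff ℝ (n + 1) F) :
    ContDiff ℝ n (partial₂ F) :=
  (hF.fderiv_right le_rfl).clm_apply contDiff_const

lemma exists_box_bound {G : ℝ × ℝ → ℂ} (hG : Continuous G) (L : ℝ) :
    ∃ B, 0 ≤ B ∧ ∀ x y, |x| ≤ L → |y| ≤ L → ‖G (x, y)‖ ≤ B := by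
  obtain ⟨B, hB⟩ := ((isCompact_Icc (a := -L) (b := L)).prod
    (isCompact_Icc (a := -L) (b := L))).exists_bound_of_continuousOn hG.continuousOn
  exact ⟨max B 0, le_max_right _ _, fun x y hx hy =>
    (hB _ ⟨abs_le.1 hx, abs_le.1 hy⟩).trans (le_max_left _ _)⟩

/-- Uniform bounds for a fixed function along a family of curves. -/
lemma exists_isC2Bound_comp {G : ℝ × ℝ → ℂ} (hG : ContDiff ℝ 2 G) (c : ℝ) (hc : 0 ≤ c) (L : ℝ) :
    ∃ M, ∀ (a a' a'' : ℝ → ℝ) (d : ℝ), |d| ≤ 1 → (∀ y, HasDerivAt a (a' y) y) →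
      (∀ y, HasDerivAt a' (a'' y) y) → Continuous a'' →
      (∀ y ∈ Icc (-4 : ℝ) 4, |a y| ≤ L ∧ |d * y| ≤ L) → (∀ y ∈ Icc (-4 : ℝ) 4, |a' y| ≤ c) →
      (∀ y ∈ Icc (-4 : ℝ) 4, |a'' y| ≤ c) →
      ∃ b' b'', IsC2Bound M (fun y => G (a y, d * y)) b' b'' := by
  have h1 := contDiff_partial₁ (n := 1) hG
  have h2 := contDiff_partial₂ (n := 1) hG
  have c0 := hG.continuous
  have c1 := h1.continuous
  have c2 := h2.continuous
  have c11 := continuous_partial₁ h1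
  have c12 := continuous_partial₂ h1
  have c21 := continuous_partial₁ h2
  have c22 := continuous_partial₂ h2
  obtain ⟨B0, hB0, k0⟩ := exists_box_bound c0 L
  obtain ⟨B1, hB1, k1⟩ := exists_box_bound c1 L
  obtain ⟨B2, hB2, k2⟩ := exists_box_bound c2 L
  obtain ⟨B3, hB3, k3⟩ := exists_box_bound c11 L
  obtain ⟨B4, hB4, k4⟩ := exists_box_bound c12 L
  obtain ⟨B5, hB5, k5⟩ := exists_box_bound c21 L
  obtain ⟨B6, hB6, k6⟩ := exists_box_bound c22 L
  refine ⟨B0 + (c * B1 + 1 * B2) + (c * B1 + c * (c * B3 + 1 * B4) + 1 * (c * B5 + 1 * B6)), ?_⟩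
  intro a a' a'' d hd ha ha' ca'' hL ka' ka''
  have ca : Continuous a := continuous_iff_continuousAt.2 fun y => (ha y).continuousAt
  have ca' : Continuous a' := continuous_iff_continuousAt.2 fun y => (ha' y).continuousAt
  have hdy : ∀ y : ℝ, HasDerivAt (fun y => d * y) d y := fun y => by
    simpa using (hasDerivAt_id y).const_mul d
  have D : ∀ {F : ℝ × ℝ → ℂ}, ContDiff ℝ 1 F → ∀ y, HasDerivAt (fun y => F (a y, d * y))
      ((a' y : ℂ) * partial₁ F (a y, d * y) + (d : ℂ) * partial₂ F (a y, d * y)) y :=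
    fun hF y => hasDerivAt_comp_pair (hF.differentiable one_ne_zero) (ha y) (hdy y)
  refine ⟨fun y => (a' y : ℂ) * partial₁ G (a y, d * y) + (d : ℂ) * partial₂ G (a y, d * y),
    fun y => (a'' y : ℂ) * partial₁ G (a y, d * y) +
      (a' y : ℂ) * ((a' y : ℂ) * partial₁ (partial₁ G) (a y, d * y) +
        (d : ℂ) * partial₂ (partial₁ G) (a y, d * y)) +
      (d : ℂ) * ((a' y : ℂ) * partial₁ (partial₂ G) (a y, d * y) +
        (d : ℂ) * partial₂ (partial₂ G) (a y, d * y)),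
    D (hG.of_le one_le_two), fun y => ?_, by fun_prop, fun y hy => ?_, fun y hy => ?_,
    fun y hy => ?_⟩
  · exact (((ha' y).ofReal_comp.mul (D h1 y)).add ((D h2 y).const_mul (d : ℂ)))
  all_goals
    obtain ⟨l1, l2⟩ := hL y hy
    have q0 := k0 _ _ l1 l2
    have q1 := k1 _ _ l1 l2
    have q2 := k2 _ _ l1 l2
    have q3 := k3 _ _ l1 l2
    have q4 := k4 _ _ l1 l2
    have q5 := k5 _ _ l1 l2
    have q6 := k6 _ _ l1 l2
    have r1 := ka' y hy
    have r2 := ka'' y hy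
    have key : ∀ {t s B : ℝ} {z : ℂ}, |t| ≤ s → ‖z‖ ≤ B → ‖(t : ℂ) * z‖ ≤ s * B := by
      intro t s B z ht hz
      rw [norm_mul, Complex.norm_real, Real.norm_eq_abs]
      exact mul_le_mul ht hz (norm_nonneg _) ((abs_nonneg t).trans ht)
    have p1 : ‖(a' y : ℂ) * partial₁ G (a y, d * y) + (d : ℂ) * partial₂ G (a y, d * y)‖ ≤
        c * B1 + 1 * B2 := (norm_add_le _ _).trans (add_le_add (key r1 q1) (key hd q2))
    have p2 := (norm_add_le _ _).trans (add_le_add (key r1 q3) (key hd q4))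
    have p3 := (norm_add_le _ _).trans (add_le_add (key r1 q5) (key hd q6))
    have p4 := norm_add₃_le.trans (add_le_add (add_le_add (key r2 q1) (key r1 p2)) (key hd p3))
    have t1 : 0 ≤ c * B1 + 1 * B2 := by positivity
    have t2 : 0 ≤ c * B1 + c * (c * B3 + 1 * B4) + 1 * (c * B5 + 1 * B6) := by positivity
  · linarith
  · linarith
  · linarith

lemma isC2Bound_cexp {c : ℝ} {a a' a'' : ℝ → ℝ} {v : ℝ × ℝ} (hv1 : |v.1| ≤ 1) (hv2 : |v.2| ≤ 1)
    (ha : ∀ y, HasDerivAt a (a' y) y) (ha' : ∀ y, HasDerivAt a' (a'' y) y) (ca'' : Continuous a'')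
    (ka' : ∀ y ∈ Icc (-4 : ℝ) 4, |a' y| ≤ c) (ka'' : ∀ y ∈ Icc (-4 : ℝ) 4, |a'' y| ≤ c) :
    ∃ b' b'', IsC2Bound (2 * (1 + c) ^ 2)
      (fun y => Complex.exp (-Complex.I * ((v.1 * a y + v.2 * y : ℝ) : ℂ))) b' b'' := by
  have hc : 0 ≤ c := (abs_nonneg _).trans (ka' 0 (by norm_num))
  have ca : Continuous a := continuous_iff_continuousAt.2 fun y => (ha y).continuousAt
  have ca' : Continuous a' := continuous_iff_continuousAt.2 fun y => (ha' y).continuousAt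
  set b : ℝ → ℂ := fun y => Complex.exp (-Complex.I * ((v.1 * a y + v.2 * y : ℝ) : ℂ)) with hb
  set u' : ℝ → ℂ := fun y => -Complex.I * ((v.1 * a' y + v.2 : ℝ) : ℂ) with hu'
  set u'' : ℝ → ℂ := fun y => -Complex.I * ((v.1 * a'' y : ℝ) : ℂ) with hu''
  have d1 : ∀ y, HasDerivAt b (b y * u' y) y := by
    intro y
    have h1 : HasDerivAt (fun y => v.1 * a y + v.2 * y) (v.1 * a' y + v.2) y := by
      refine (((ha y).const_mul v.1).add ((hasDerivAt_id y).const_mul v.2)).congr_deriv ?_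
      rw [mul_one]
    exact (h1.ofReal_comp.const_mul (-Complex.I)).cexp
  have d2 : ∀ y, HasDerivAt u' (u'' y) y := by
    intro y
    exact ((((ha' y).const_mul v.1).add_const v.2).ofReal_comp.const_mul (-Complex.I))
  have nb : ∀ y, ‖b y‖ = 1 := fun y => norm_cexp_neg_I_mul _
  have nu : ∀ y ∈ Icc (-4 : ℝ) 4, ‖u' y‖ ≤ 1 + c := by
    intro y hy
    rw [hu']
    simp only [norm_mul, norm_neg, Complex.norm_I, one_mul, Complex.norm_real, Real.norm_eq_abs]
    have := abs_add_le (v.1 * a' y) v.2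
    rw [abs_mul] at this
    nlinarith [ka' y hy, abs_nonneg v.1, abs_nonneg (a' y)]
  have nu' : ∀ y ∈ Icc (-4 : ℝ) 4, ‖u'' y‖ ≤ c := by
    intro y hy
    rw [hu'']
    simp only [norm_mul, norm_neg, Complex.norm_I, one_mul, Complex.norm_real, Real.norm_eq_abs]
    nlinarith [ka'' y hy, abs_nonneg v.1, abs_nonneg (a'' y)]
  refine ⟨fun y => b y * u' y, fun y => b y * u' y * u' y + b y * u'' y, d1,
    fun y => (d1 y).mul (d2 y), by fun_prop, fun y _ => ?_, fun y hy => ?_, fun y hy => ?_⟩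
  · rw [nb]; nlinarith
  · rw [norm_mul, nb, one_mul]; nlinarith [nu y hy]
  · refine (norm_add_le _ _).trans ?_
    rw [norm_mul (b y * u' y), norm_mul (b y) (u' y), norm_mul (b y), nb, one_mul, one_mul]
    nlinarith [nu y hy, nu' y hy, norm_nonneg (u' y)]

/-- Smooth functions supported in `[-π, π]²`. -/
structure IsBump (ψ : ℝ × ℝ → ℂ) : Prop where
  contDiff : ContDiff ℝ (⊤ : ℕ∞) ψ
  supp : tsupport ψ ⊆ Icc (-π) π ×ˢ Icc (-π) π

namespace IsBump
variable {ψ : ℝ × ℝ → ℂ}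

lemma partial₁ (h : IsBump ψ) : IsBump (partial₁ ψ) :=
  ⟨(h.contDiff.fderiv_right (m := (⊤ : ℕ∞)) (by simp)).clm_apply contDiff_const,
    (tsupport_partial₁_subset ψ).trans h.supp⟩

lemma partial₂ (h : IsBump ψ) : IsBump (partial₂ ψ) :=
  ⟨(h.contDiff.fderiv_right (m := (⊤ : ℕ∞)) (by simp)).clm_apply contDiff_const,
    (tsupport_partial₂_subset ψ).trans h.supp⟩

lemma contDiff_two (h : IsBump ψ) : ContDiff ℝ 2 ψ := contDiff_infty.1 h.contDiff 2

lemma hasCompactSupport (h : IsBump ψ) : HasCompactSupport ψ :=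
  (isCompact_Icc.prod isCompact_Icc).of_isClosed_subset (isClosed_tsupport _) h.supp

lemma eq_zero (h : IsBump ψ) {x y : ℝ} (hxy : π < |x| ∨ π < |y|) : ψ (x, y) = 0 := by
  by_contra hne
  obtain ⟨h1, h2⟩ := h.supp (subset_tsupport _ hne)
  rcases hxy with hx | hy
  · exact absurd (abs_le.2 h1) (not_le.2 hx)
  · exact absurd (abs_le.2 h2) (not_le.2 hy)

lemma eq_zero_of_notMem (h : IsBump ψ) (x : ℝ) {y : ℝ} (hy : y ∉ Icc (-4 : ℝ) 4) :
    ψ (x, y) = 0 := by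
  refine h.eq_zero (Or.inr ?_)
  by_contra h'
  exact hy (abs_le.1 ((not_lt.1 h').trans (by linarith [pi_lt_d2])))

lemma eq_zero_of_notMem_box (h : IsBump ψ) {y : ℝ × ℝ}
    (hy : y ∉ Icc (-4 : ℝ) 4 ×ˢ Icc (-4 : ℝ) 4) : ψ y = 0 := by
  by_contra hne
  obtain ⟨h1, h2⟩ := h.supp (subset_tsupport _ hne)
  have : π ≤ 4 := by linarith [pi_lt_d2]
  exact hy ⟨Icc_subset_Icc (by linarith) this h1, Icc_subset_Icc (by linarith) this h2⟩

end IsBump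

/-- Amplitude of the boundary term in the integration by parts on the half plane. -/
def edgeAmp (E : ℝ → ℝ) (ε : ℝ) (p : ℝ × ℝ) (F : ℝ × ℝ → ℂ) : ℝ → ℂ := fun y =>
  ((p.1 - p.2 * deriv (scaledEdge E ε) y : ℝ) : ℂ) * F (scaledEdge E ε y, y)

lemma edgeInt_linePoint {e : ℝ → ℝ} {b : ℝ → ℂ} (hb : ∀ y ∉ Icc (-4 : ℝ) 4, b y = 0)
    (p v : ℝ × ℝ) (ρ : ℝ) :
    edgeInt e b (linePoint p v ρ) = ∫ y in Icc (-4 : ℝ) 4,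
      (b y * Complex.exp (-Complex.I * ((v.1 * e y + v.2 * y : ℝ) : ℂ))) *
        Complex.exp (-Complex.I * ((ρ * (p.1 * e y + p.2 * y) : ℝ) : ℂ)) := by
  rw [setIntegral_eq_integral_of_forall_compl_eq_zero fun y hy => by rw [hb y hy]; simp, edgeInt]
  congr 1
  funext y
  rw [mul_assoc, ← Complex.exp_add, linePoint]
  congr 2
  push_cast
  ring

section
variable {E : ℝ → ℝ} {c : ℝ} {f ψ : ℝ × ℝ → ℂ}

lemma edgeAmp_eq_zero (hψ : IsBump ψ) {ε : ℝ} {p : ℝ × ℝ} {y : ℝ} (hy : y ∉ Icc (-4 : ℝ) 4) :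
    edgeAmp E ε p (fun y => dilate f ε y * ψ y) y = 0 := by
  simp [edgeAmp, hψ.eq_zero_of_notMem _ hy]

lemma exists_norm_dilate_mul_le (hf : Continuous f) (hψ : IsBump ψ) :
    ∃ B, 0 ≤ B ∧ ∀ ε, 0 < ε → ε ≤ 1 / 32 → ∀ y : ℝ × ℝ, ‖dilate f ε y * ψ y‖ ≤ B := by
  obtain ⟨B, hB, h⟩ := exists_box_bound hf 1
  obtain ⟨D, hD⟩ := hψ.hasCompactSupport.exists_bound_of_continuous hψ.contDiff.continuous
  have hD0 : 0 ≤ D := (norm_nonneg _).trans (hD 0)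
  refine ⟨B * D, by positivity, fun ε h0 h1 y => ?_⟩
  by_cases hy : y ∈ Icc (-4 : ℝ) 4 ×ˢ Icc (-4 : ℝ) 4
  · rw [norm_mul]
    exact mul_le_mul (h _ _ (abs_mul_le_of_mem h0 h1 hy.1).2 (abs_mul_le_of_mem h0 h1 hy.2).2)
      (hD y) (norm_nonneg _) hB
  · rw [hψ.eq_zero_of_notMem_box hy]
    simp only [mul_zero, norm_zero]
    positivity

lemma abs_edge_factor_le (hE : IsFlatEdge E c) {ε : ℝ} {p v : ℝ × ℝ} (hp : IsLineParam ε p v)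
    {y : ℝ} (hy : y ∈ Icc (-4 : ℝ) 4) : |p.1 - p.2 * deriv E (ε * y)| ≤ 2 + 2 * c := by
  have h1 := hE.abs_deriv_le' hp.pos hp.le hy
  have h2 := abs_sub p.1 (p.2 * deriv E (ε * y))
  rw [abs_mul] at h2
  have h3 : |p.2| * |deriv E (ε * y)| ≤ 2 * c :=
    mul_le_mul hp.abs_p_snd h1 (abs_nonneg _) zero_le_two
  linarith [hp.abs_p_fst]

lemma exists_norm_edgeAmp_le (hE : IsFlatEdge E c) (hf : Continuous f) (hψ : IsBump ψ) :
    ∃ B, 0 ≤ B ∧ ∀ ε p v, IsLineParam ε p v → ∀ y,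
      ‖edgeAmp E ε p (fun y => dilate f ε y * ψ y) y‖ ≤ B := by
  obtain ⟨B, hB, h⟩ := exists_norm_dilate_mul_le hf hψ
  have hc := hE.nonneg
  refine ⟨(2 + 2 * c) * B, by positivity, fun ε p v hp y => ?_⟩
  by_cases hy : y ∈ Icc (-4 : ℝ) 4
  · rw [edgeAmp, norm_mul, Complex.norm_real, (hE.hasDerivAt_scaledEdge hp.pos y).deriv]
    exact mul_le_mul (abs_edge_factor_le hE hp hy) (h ε hp.pos hp.le _) (norm_nonneg _)
      (by positivity)
  · rw [edgeAmp_eq_zero hψ hy, norm_zero]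
    positivity

lemma continuous_edgeAmp (hE : IsFlatEdge E c) (hf : Continuous f) (hψ : IsBump ψ) {ε : ℝ}
    {p : ℝ × ℝ} : Continuous (edgeAmp E ε p (fun y => dilate f ε y * ψ y)) := by
  have h1 := hE.contDiff_scaledEdge (ε := ε)
  have h2 := h1.continuous
  have h3 := h1.continuous_deriv one_le_two
  have h4 := hψ.contDiff.continuous
  unfold edgeAmp dilate
  fun_prop

lemma continuous_edgeInt_linePoint (hE : IsFlatEdge E c) (hf : Continuous f) (hψ : IsBump ψ)
    {ε : ℝ} (p v : ℝ × ℝ) : Continuous fun ρ =>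
      edgeInt (scaledEdge E ε) (edgeAmp E ε p (fun y => dilate f ε y * ψ y)) (linePoint p v ρ) := by
  have h1 := hE.contDiff_scaledEdge (ε := ε)
  have h2 := h1.continuous
  have h3 := continuous_edgeAmp hE hf hψ (ε := ε) (p := p)
  simp only [edgeInt_linePoint fun y hy => edgeAmp_eq_zero hψ hy]
  refine continuous_oscillatory ?_ (by fun_prop)
  exact ContinuousOn.integrableOn_compact isCompact_Icc (by fun_prop)

lemma IsLineParam.pow_le {ε : ℝ} {p v : ℝ × ℝ} (hp : IsLineParam ε p v) (h : ε ≤ |p.2|) :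
    1 / |p.2| ≤ 16 / |p.2| ^ 5 := by
  have h0 : 0 < |p.2| := hp.pos.trans_le h
  rw [div_le_div_iff₀ h0 (by positivity)]
  have : |p.2| ^ 4 ≤ 2 ^ 4 := pow_le_pow_left₀ h0.le hp.abs_p_snd 4
  nlinarith

lemma exists_sqBound_edge_zero (hE : IsFlatEdge E c) (hf : Continuous f) (hψ : IsBump ψ) :
    ∃ C, 0 ≤ C ∧ ∀ ε p v, IsLineParam ε p v → 16 * c * ε ≤ |p.2| → ε ≤ |p.2| →
      SqBound ε (C * (ε ^ 0 / |p.2| ^ 5)) fun ρ =>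
        edgeInt (scaledEdge E ε) (edgeAmp E ε p (fun y => dilate f ε y * ψ y))
          (linePoint p v ρ) := by
  obtain ⟨B, hB, h⟩ := exists_norm_edgeAmp_le hE hf hψ
  refine ⟨16 * π * Real.exp 2 * B ^ 2 * 32, by positivity, fun ε p v hp hpc hpε => ?_⟩
  have h0 : 0 < |p.2| := hp.pos.trans_le hpε
  have h2 := (hE.contDiff_scaledEdge (ε := ε)).continuous
  have h3 := continuous_edgeAmp hE hf hψ (ε := ε) (p := p)
  refine ⟨continuous_edgeInt_linePoint hE hf hψ p v, ?_⟩
  simp only [edgeInt_linePoint fun y hy => edgeAmp_eq_zero hψ hy]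
  have := schur_interval (M := B) (b := fun y => edgeAmp E ε p (fun y => dilate f ε y * ψ y) y *
    Complex.exp (-Complex.I * ((v.1 * scaledEdge E ε y + v.2 * y : ℝ) : ℂ)))
    (by fun_prop) (fun y _ => by rw [norm_mul, norm_cexp_neg_I_mul, mul_one]; exact h ε p v hp y)
    (w := fun y => p.1 * scaledEdge E ε y + p.2 * y) (by fun_prop) hp.pos (half_pos h0)
    (fun x hx y hy => hE.phase_lower hp hpc hx hy)
  refine this.trans ?_
  have h5 := hp.pow_le hpε
  calc 16 * π * Real.exp 2 * B ^ 2 / (|p.2| / 2) = 16 * π * Real.exp 2 * B ^ 2 * 2 * (1 / |p.2|) := by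
        field_simp
    _ ≤ 16 * π * Real.exp 2 * B ^ 2 * 2 * (16 / |p.2| ^ 5) := by gcongr
    _ = _ := by ring

lemma exists_sqBound_edge_two (hE : IsFlatEdge E c) (hf : ContDiff ℝ 2 f) (hψ : IsBump ψ) :
    ∃ C, 0 ≤ C ∧ ∀ ε p v, IsLineParam ε p v → 16 * c * ε ≤ |p.2| → ε ≤ |p.2| →
      SqBound ε (C * (ε ^ 4 / |p.2| ^ 5)) fun ρ =>
        edgeInt (scaledEdge E ε) (edgeAmp E ε p (fun y => dilate f ε y * ψ y))
          (linePoint p v ρ) := by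
  have hc := hE.nonneg
  obtain ⟨M1, h1⟩ := exists_isC2Bound_comp hf c hc (c + 4)
  obtain ⟨M2, h2⟩ := exists_isC2Bound_comp hψ.contDiff_two c hc (c + 4)
  set M := max (4 * (4 * (M1 * M2) * (2 * (1 + c) ^ 2))) (2 + 2 * c) with hM
  have hM0 : 0 ≤ M := le_trans (by positivity) (le_max_right _ _)
  refine ⟨50000 * π * Real.exp 2 * (M ^ 2 + M ^ 3) ^ 2 * 32, by positivity,
    fun ε p v hp hpc hpε => ?_⟩
  have h0 : 0 < |p.2| := hp.pos.trans_le hpε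
  have hε := hp.pos
  have hε1 := hp.le
  have hE2 := hE.continuous_deriv2
  set e := scaledEdge E ε with he
  set e' : ℝ → ℝ := fun y => deriv E (ε * y) with he'
  set e'' : ℝ → ℝ := fun y => ε * deriv (deriv E) (ε * y) with he''
  have ce'' : Continuous e'' := by fun_prop
  have de : ∀ y, HasDerivAt e (e' y) y := hE.hasDerivAt_scaledEdge hε
  have de' : ∀ y, HasDerivAt e' (e'' y) y := hE.hasDerivAt_deriv
  have ke' : ∀ y ∈ Icc (-4 : ℝ) 4, |e' y| ≤ c := fun y hy => hE.abs_deriv_le' hε hε1 hy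
  have ke'' : ∀ y ∈ Icc (-4 : ℝ) 4, |e'' y| ≤ c * ε := fun y hy => hE.abs_deriv2_le hε hε1 hy
  have ke''1 : ∀ y ∈ Icc (-4 : ℝ) 4, |e'' y| ≤ c := fun y hy =>
    (ke'' y hy).trans (by nlinarith)
  have ke : ∀ y ∈ Icc (-4 : ℝ) 4, |e y| ≤ c := fun y hy => hE.abs_scaledEdge_le hε hε1 hy
  have kε : ∀ {z k : ℝ}, |z| ≤ k → |ε * z| ≤ k := fun {z k} hz => by
    rw [abs_mul, abs_of_pos hε]
    nlinarith [abs_nonneg z]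
  obtain ⟨f', f'', bf⟩ := h1 (fun y => ε * e y) (fun y => ε * e' y) (fun y => ε * e'' y) ε
    (by rw [abs_of_pos hε]; linarith) (fun y => (de y).const_mul ε) (fun y => (de' y).const_mul ε)
    (by fun_prop) (fun y hy => ⟨(kε (ke y hy)).trans (by linarith),
      (abs_mul_le_of_mem hε hε1 hy).2.trans (by linarith)⟩)
    (fun y hy => kε (ke' y hy)) (fun y hy => kε (ke''1 y hy))
  obtain ⟨g', g'', bg⟩ := h2 e e' e'' 1 (by simp) de de' ce'' (fun y hy => ⟨(ke y hy).trans
    (by linarith), by rw [one_mul]; exact (abs_le.2 hy).trans (by linarith)⟩) ke' ke''1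
  obtain ⟨x', x'', bx⟩ := isC2Bound_cexp hp.abs_fst hp.abs_snd de de' ce'' ke' ke''1
  have bβ := ((bf.mul bg).mul bx).mono (le_max_left _ (2 + 2 * c))
  rw [← hM] at bβ
  set β : ℝ → ℂ := fun y => f (ε * e y, ε * y) * ψ (e y, 1 * y) *
    Complex.exp (-Complex.I * ((v.1 * e y + v.2 * y : ℝ) : ℂ)) with hβ
  obtain ⟨β', hβ'⟩ : ∃ β', β' = fun y => (f' y * ψ (e y, 1 * y) + f (ε * e y, ε * y) * g' y) *
    Complex.exp (-Complex.I * ((v.1 * e y + v.2 * y : ℝ) : ℂ)) +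
    f (ε * e y, ε * y) * ψ (e y, 1 * y) * x' y := ⟨_, rfl⟩
  rw [← hβ'] at bβ
  have zβ : ∀ y : ℝ, π < |y| → β y = 0 := fun y hy => by
    simp [hβ, hψ.eq_zero (x := e y) (Or.inr hy)]
  have zβ' : ∀ y : ℝ, π < |y| → β' y = 0 := fun y hy => by
    have hev : β =ᶠ[nhds y] fun _ => 0 := by
      filter_upwards [(isOpen_lt continuous_const continuous_abs).mem_nhds hy] with z hz
      exact zβ z hz
    exact (bβ.d₁ y).unique ((hasDerivAt_const y (0 : ℂ)).congr_of_eventuallyEq hev)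
  have p4 : π < |(4 : ℝ)| := by norm_num; linarith [pi_lt_d2]
  have p4' : π < |(-4 : ℝ)| := by norm_num; linarith [pi_lt_d2]
  have dw : ∀ y, HasDerivAt (fun y => p.1 * e y + p.2 * y) (p.1 * e' y + p.2) y := fun y => by
    refine (((de y).const_mul p.1).add ((hasDerivAt_id y).const_mul p.2)).congr_deriv ?_
    rw [mul_one]
  have hlow : ∀ y ∈ Icc (-4 : ℝ) 4, |p.2| / 2 ≤ |p.1 * e' y + p.2| := by
    intro y hy
    have q1 : |p.1 * e' y| ≤ 2 * (4 * c * ε) := by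
      rw [abs_mul]
      exact mul_le_mul hp.abs_p_fst (hE.abs_deriv_le hε hε1 hy) (abs_nonneg _) zero_le_two
    have q2 := abs_sub_abs_le_abs_add p.2 (p.1 * e' y)
    rw [add_comm] at q2
    linarith
  have hMc : 2 * c * ε ≤ M * ε := by
    have : 2 * c ≤ M := le_trans (by linarith) (le_max_right _ _)
    gcongr
  have main := sqBound_edge_amplitude (M := M) (m := |p.2| / 2) (w := fun y => p.1 * e y + p.2 * y)
    (w' := fun y => p.1 * e' y + p.2) (w'' := fun y => p.1 * e'' y)
    (κ := fun y => p.1 - p.2 * e' y) (κ' := fun y => -(p.2 * e'' y)) hε (half_pos h0)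
    (by linarith [hp.abs_p_snd]) (by linarith) (by linarith) dw
    (fun y => ((de' y).const_mul p.1).add_const p.2) (by fun_prop)
    (fun y => ((de' y).const_mul p.2).const_sub p.1) (by fun_prop) bβ.d₁ bβ.d₂ bβ.cont
    (zβ _ p4) (zβ _ p4') (zβ' _ p4) (zβ' _ p4')
    (fun x hx y hy => hE.phase_lower hp hpc hx hy) hlow
    (fun y hy => by
      rw [abs_mul]
      refine (mul_le_mul hp.abs_p_fst (ke'' y hy) (abs_nonneg _) zero_le_two).trans ?_
      linarith)
    (fun y hy => (abs_edge_factor_le hE hp hy).trans (le_max_right _ _))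
    (fun y hy => by
      rw [abs_neg, abs_mul]
      refine (mul_le_mul hp.abs_p_snd (ke'' y hy) (abs_nonneg _) zero_le_two).trans ?_
      linarith)
    bβ.k₀ bβ.k₁ bβ.k₂
  refine ⟨continuous_edgeInt_linePoint hE hf.continuous hψ p v, ?_⟩
  simp only [edgeInt_linePoint fun y hy => edgeAmp_eq_zero hψ hy]
  have e1 : ∀ y, edgeAmp E ε p (fun y => dilate f ε y * ψ y) y *
      Complex.exp (-Complex.I * ((v.1 * e y + v.2 * y : ℝ) : ℂ)) =
      ((p.1 - p.2 * e' y : ℝ) : ℂ) * β y := fun y => by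
    rw [edgeAmp, ← he, (de y).deriv, hβ]
    simp only [dilate, one_mul]
    ring
  simp only [e1]
  refine main.le.trans (le_of_eq ?_)
  field_simp
  ring

end

section
variable {e : ℝ → ℝ} {F G : ℝ × ℝ → ℂ}

lemma integrable_halfInt (he : Continuous e) (hF : Continuous F) (hc : HasCompactSupport F)
    (ζ : ℝ × ℝ) : Integrable fun y : ℝ × ℝ => (if e y.2 ≤ y.1 then F y else 0) *
      Complex.exp (-Complex.I * ((ζ.1 * y.1 + ζ.2 * y.2 : ℝ) : ℂ)) := by
  refine (integrable_ite he (J := fun y => F y *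
    Complex.exp (-Complex.I * ((ζ.1 * y.1 + ζ.2 * y.2 : ℝ) : ℂ))) ?_).congr ?_
  · exact (hF.mul (by fun_prop)).integrable_of_hasCompactSupport hc.mul_right
  · exact ae_of_all _ fun y => by dsimp only; split_ifs <;> simp

lemma halfInt_add (he : Continuous e) (hF : Continuous F) (hc : HasCompactSupport F)
    (hG : Continuous G) (hd : HasCompactSupport G) (ζ : ℝ × ℝ) :
    halfInt e (fun y => F y + G y) ζ = halfInt e F ζ + halfInt e G ζ := by
  rw [halfInt, halfInt, halfInt, ← integral_add (integrable_halfInt he hF hc ζ)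
    (integrable_halfInt he hG hd ζ)]
  congr 1
  funext y
  split_ifs <;> ring

lemma halfInt_const_mul (a : ℂ) (ζ : ℝ × ℝ) :
    halfInt e (fun y => a * F y) ζ = a * halfInt e F ζ := by
  rw [halfInt, halfInt, ← integral_const_mul]
  congr 1
  funext y
  split_ifs <;> ring

lemma halfInt_linePoint (p v : ℝ × ℝ) (ρ : ℝ) :
    halfInt e F (linePoint p v ρ) = ∫ y : ℝ × ℝ, ((if e y.2 ≤ y.1 then F y else 0) *
      Complex.exp (-Complex.I * ((v.1 * y.1 + v.2 * y.2 : ℝ) : ℂ))) *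
        Complex.exp (-Complex.I * ((ρ * (p.1 * y.1 + p.2 * y.2) : ℝ) : ℂ)) := by
  rw [halfInt]
  congr 1
  funext y
  rw [mul_assoc, ← Complex.exp_add, linePoint]
  congr 2
  push_cast
  ring

lemma continuous_halfInt_linePoint (he : Continuous e) (hF : Continuous F)
    (hc : HasCompactSupport F) (p v : ℝ × ℝ) :
    Continuous fun ρ => halfInt e F (linePoint p v ρ) := by
  simp only [halfInt_linePoint]
  exact continuous_oscillatory (integrable_halfInt he hF hc v) (by fun_prop)

lemma norm_halfInt_le {B : ℝ} (hB : ∀ y, ‖F y‖ ≤ B)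
    (h0 : ∀ y ∉ Icc (-4 : ℝ) 4 ×ˢ Icc (-4 : ℝ) 4, F y = 0) (ζ : ℝ × ℝ) :
    ‖halfInt e F ζ‖ ≤ B * volume.real (Icc (-4 : ℝ) 4 ×ˢ Icc (-4 : ℝ) 4) := by
  rw [halfInt, ← setIntegral_eq_integral_of_forall_compl_eq_zero (s := Icc (-4 : ℝ) 4 ×ˢ Icc (-4) 4)
    fun y hy => by rw [h0 y hy]; simp]
  refine norm_setIntegral_le_of_norm_le_const
    (isCompact_Icc.prod isCompact_Icc).measure_lt_top fun y _ => ?_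
  rw [norm_mul, norm_cexp_neg_I_mul, mul_one]
  split_ifs
  · exact hB y
  · simpa using (norm_nonneg _).trans (hB y)

lemma norm_edgeInt_le {b : ℝ → ℂ} {B : ℝ} (hB : ∀ y, ‖b y‖ ≤ B)
    (h0 : ∀ y ∉ Icc (-4 : ℝ) 4, b y = 0) (ζ : ℝ × ℝ) :
    ‖edgeInt e b ζ‖ ≤ B * volume.real (Icc (-4 : ℝ) 4) := by
  rw [edgeInt, ← setIntegral_eq_integral_of_forall_compl_eq_zero (s := Icc (-4 : ℝ) 4)
    fun y hy => by rw [h0 y hy]; simp]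
  refine norm_setIntegral_le_of_norm_le_const isCompact_Icc.measure_lt_top fun y _ => ?_
  rw [norm_mul, norm_cexp_neg_I_mul, mul_one]
  exact hB y

end

lemma hasFDerivAt_dilate {f : ℝ × ℝ → ℂ} (hf : Differentiable ℝ f) (ε : ℝ) (y : ℝ × ℝ) :
    HasFDerivAt (dilate f ε) (ε • fderiv ℝ f (ε * y.1, ε * y.2)) y := by
  have h1 : HasFDerivAt (fun y : ℝ × ℝ => (ε * y.1, ε * y.2))
      (ε • ContinuousLinearMap.id ℝ (ℝ × ℝ)) y :=
    (ε • ContinuousLinearMap.id ℝ (ℝ × ℝ)).hasFDerivAt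
  refine ((hf (ε * y.1, ε * y.2)).hasFDerivAt.comp y h1).congr_fderiv ?_
  ext <;> simp

lemma partial₁_dilate_mul {f ψ : ℝ × ℝ → ℂ} (hf : Differentiable ℝ f) (hψ : Differentiable ℝ ψ)
    (ε : ℝ) : partial₁ (fun y => dilate f ε y * ψ y) =
      fun y => (ε : ℂ) * (dilate (partial₁ f) ε y * ψ y) + dilate f ε y * partial₁ ψ y := by
  funext y
  have h := ((hasFDerivAt_dilate hf ε y).mul (hψ y).hasFDerivAt).fderiv
  refine (congrArg (fun L : (ℝ × ℝ) →L[ℝ] ℂ => L (1, 0)) h).trans ?_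
  simp [partial₁, dilate]
  ring

lemma partial₂_dilate_mul {f ψ : ℝ × ℝ → ℂ} (hf : Differentiable ℝ f) (hψ : Differentiable ℝ ψ)
    (ε : ℝ) : partial₂ (fun y => dilate f ε y * ψ y) =
      fun y => (ε : ℂ) * (dilate (partial₂ f) ε y * ψ y) + dilate f ε y * partial₂ ψ y := by
  funext y
  have h := ((hasFDerivAt_dilate hf ε y).mul (hψ y).hasFDerivAt).fderiv
  refine (congrArg (fun L : (ℝ × ℝ) →L[ℝ] ℂ => L (0, 1)) h).trans ?_
  simp [partial₂, dilate]
  ring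

lemma contDiff_dilate {f : ℝ × ℝ → ℂ} {n : ℕ} (hf : ContDiff ℝ n f) (ε : ℝ) :
    ContDiff ℝ n (dilate f ε) :=
  hf.comp ((contDiff_const.mul contDiff_fst).prodMk (contDiff_const.mul contDiff_snd))

section
variable {E : ℝ → ℝ} {c : ℝ} {f ψ : ℝ × ℝ → ℂ}

/-- The half plane integral of `f(ε·)ψ` as a function of the position on a line. -/
def lineHalf (E : ℝ → ℝ) (f ψ : ℝ × ℝ → ℂ) (ε : ℝ) (p v : ℝ × ℝ) : ℝ → ℂ := fun ρ =>
  halfInt (scaledEdge E ε) (fun y => dilate f ε y * ψ y) (linePoint p v ρ)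

/-- The boundary integral of `f(ε·)ψ` as a function of the position on a line. -/
def lineEdge (E : ℝ → ℝ) (f ψ : ℝ × ℝ → ℂ) (ε : ℝ) (p v : ℝ × ℝ) : ℝ → ℂ := fun ρ =>
  edgeInt (scaledEdge E ε) (edgeAmp E ε p (fun y => dilate f ε y * ψ y)) (linePoint p v ρ)

/-- Decay of order `k` of half plane or boundary integrals, away from the edge direction. -/
def HasOrder (c : ℝ) (k : ℕ) (Q : ℝ → ℝ × ℝ → ℝ × ℝ → ℝ → ℂ) : Prop :=
  ∃ C, 0 ≤ C ∧ ∀ ε p v, IsLineParam ε p v → 16 * c * ε ≤ |p.2| → ε ≤ |p.2| →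
    SqBound ε (C * (ε ^ (2 * k) / |p.2| ^ 5)) (Q ε p v)

lemma HasOrder.mono {k l : ℕ} {Q : ℝ → ℝ × ℝ → ℝ × ℝ → ℝ → ℂ} (h : HasOrder c k Q) (hl : l ≤ k) :
    HasOrder c l Q := by
  obtain ⟨C, hC, h⟩ := h
  refine ⟨C, hC, fun ε p v hp h1 h2 => (h ε p v hp h1 h2).mono ?_⟩
  have := pow_le_pow_of_le_one hp.pos.le (by linarith [hp.le]) (show 2 * l ≤ 2 * k by lia)
  gcongr

lemma continuous_dilate_mul (hf : Continuous f) (hψ : IsBump ψ) (ε : ℝ) :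
    Continuous fun y => dilate f ε y * ψ y := by
  have := hψ.contDiff.continuous
  unfold dilate
  fun_prop

lemma hasCompactSupport_dilate_mul (hψ : IsBump ψ) (ε : ℝ) :
    HasCompactSupport fun y => dilate f ε y * ψ y := hψ.hasCompactSupport.mul_left

lemma continuous_lineHalf (hE : IsFlatEdge E c) (hf : Continuous f) (hψ : IsBump ψ) (ε : ℝ)
    (p v : ℝ × ℝ) : Continuous (lineHalf E f ψ ε p v) :=
  continuous_halfInt_linePoint hE.contDiff_scaledEdge.continuous (continuous_dilate_mul hf hψ ε)
    (hasCompactSupport_dilate_mul hψ ε) p v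

lemma hasOrder_lineHalf_zero (hE : IsFlatEdge E c) (hf : Continuous f) (hψ : IsBump ψ) :
    HasOrder c 0 (lineHalf E f ψ) := by
  obtain ⟨B, hB, h⟩ := exists_norm_dilate_mul_le hf hψ
  refine ⟨1024 * π * Real.exp 2 * B ^ 2 * 16, by positivity, fun ε p v hp _ hpε =>
    ⟨continuous_lineHalf hE hf hψ ε p v, ?_⟩⟩
  have h0 : 0 < |p.2| := hp.pos.trans_le hpε
  simp only [lineHalf, halfInt_linePoint]
  have he := (hE.contDiff_scaledEdge (ε := ε)).continuous
  have := schur_square (M := B) (b := fun y : ℝ × ℝ =>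
    (if scaledEdge E ε y.2 ≤ y.1 then dilate f ε y * ψ y else 0) *
      Complex.exp (-Complex.I * ((v.1 * y.1 + v.2 * y.2 : ℝ) : ℂ))) (p := p) (ε := ε)
    ((Measurable.ite (measurableSet_le (by fun_prop) measurable_fst)
      (continuous_dilate_mul hf hψ ε).measurable measurable_const).mul (by fun_prop))
    (fun y => by
      rw [norm_mul, norm_cexp_neg_I_mul, mul_one]
      split_ifs
      · exact h ε hp.pos hp.le y
      · simpa using hB)
    (fun y hy => by simp [hψ.eq_zero_of_notMem_box hy]) hp.pos (abs_pos.1 h0)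
  refine this.trans ?_
  calc 1024 * π * Real.exp 2 * B ^ 2 / |p.2| = 1024 * π * Real.exp 2 * B ^ 2 * (1 / |p.2|) := by
        ring
    _ ≤ 1024 * π * Real.exp 2 * B ^ 2 * (16 / |p.2| ^ 5) := by
        exact mul_le_mul_of_nonneg_left (hp.pow_le hpε) (by positivity)
    _ = _ := by ring

/-- Integration by parts for `lineHalf`. -/
lemma norm_lineHalf_le (hE : IsFlatEdge E c) (hf : ContDiff ℝ 1 f) (hψ : IsBump ψ) {ε : ℝ}
    {p v : ℝ × ℝ} (hp : IsLineParam ε p v) {ρ : ℝ} (hρ : ρ ∈ freqRange ε) :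
    ‖lineHalf E f ψ ε p v ρ‖ ≤ 4 * ε *
      ‖((p.1 : ℂ) * ((ε : ℂ) * lineHalf E (partial₁ f) ψ ε p v ρ + lineHalf E f (partial₁ ψ) ε p v ρ) +
        (p.2 : ℂ) * ((ε : ℂ) * lineHalf E (partial₂ f) ψ ε p v ρ +
          lineHalf E f (partial₂ ψ) ε p v ρ)) + lineEdge E f ψ ε p v ρ‖ := by
  have he := (hE.contDiff_scaledEdge (ε := ε))
  have hd : ContDiff ℝ 1 (dilate f ε) := contDiff_dilate (n := 1) hf ε
  have hψ1 : ContDiff ℝ 1 ψ := hψ.contDiff_two.of_le one_le_two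
  have hibp := halfInt_by_parts (hd.mul hψ1) (hasCompactSupport_dilate_mul hψ ε)
    (he.of_le one_le_two) p (linePoint p v ρ)
  have hP1 := continuous_partial₁ hf
  have hP2 := continuous_partial₂ hf
  rw [partial₁_dilate_mul (hf.differentiable one_ne_zero) (hψ1.differentiable one_ne_zero),
    partial₂_dilate_mul (hf.differentiable one_ne_zero) (hψ1.differentiable one_ne_zero),
    halfInt_add (F := fun y => (ε : ℂ) * (dilate (partial₁ f) ε y * ψ y)) he.continuous
      (continuous_const.mul (continuous_dilate_mul hP1 hψ ε))
      (hasCompactSupport_dilate_mul hψ ε).mul_left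
      (continuous_dilate_mul hf.continuous hψ.partial₁ ε)
      (hasCompactSupport_dilate_mul hψ.partial₁ ε),
    halfInt_add (F := fun y => (ε : ℂ) * (dilate (partial₂ f) ε y * ψ y)) he.continuous
      (continuous_const.mul (continuous_dilate_mul hP2 hψ ε))
      (hasCompactSupport_dilate_mul hψ ε).mul_left
      (continuous_dilate_mul hf.continuous hψ.partial₂ ε)
      (hasCompactSupport_dilate_mul hψ.partial₂ ε), halfInt_const_mul, halfInt_const_mul] at hibp
  set s : ℝ := p.1 * (linePoint p v ρ).1 + p.2 * (linePoint p v ρ).2 with hs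
  have hs' : s = ρ * (p.1 ^ 2 + p.2 ^ 2) + (p.1 * v.1 + p.2 * v.2) := by
    rw [hs, linePoint]; ring
  have hlow : 1 ≤ 4 * ε * |s| := by
    have h1 : |ρ| ≤ |ρ * (p.1 ^ 2 + p.2 ^ 2)| := by
      rw [abs_mul, abs_of_pos (lt_of_lt_of_le one_pos hp.one_le)]
      nlinarith [abs_nonneg ρ, hp.one_le]
    have h2 : |p.1 * v.1 + p.2 * v.2| ≤ 2 := by
      have h3 := abs_add_le (p.1 * v.1) (p.2 * v.2)
      rw [abs_mul, abs_mul] at h3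
      have h4 : |p.1| + |p.2| ≤ 2 := by
        nlinarith [sq_nonneg (|p.1| - |p.2|), sq_abs p.1, sq_abs p.2, hp.le_two, abs_nonneg p.1,
          abs_nonneg p.2]
      nlinarith [hp.abs_fst, hp.abs_snd, abs_nonneg p.1, abs_nonneg p.2]
    have h3 := abs_sub_abs_le_abs_add (ρ * (p.1 ^ 2 + p.2 ^ 2)) (p.1 * v.1 + p.2 * v.2)
    rw [← hs'] at h3
    have h4 : |ρ| - 2 ≤ |s| := by linarith
    have h5 := hρ.1
    nlinarith [hp.pos, hp.le]
  have h := congrArg norm hibp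
  rw [norm_mul, norm_mul, Complex.norm_I, one_mul, Complex.norm_real, Real.norm_eq_abs] at h
  have h' : |s| * ‖lineHalf E f ψ ε p v ρ‖ = ‖((p.1 : ℂ) * ((ε : ℂ) *
      lineHalf E (partial₁ f) ψ ε p v ρ + lineHalf E f (partial₁ ψ) ε p v ρ) +
        (p.2 : ℂ) * ((ε : ℂ) * lineHalf E (partial₂ f) ψ ε p v ρ +
          lineHalf E f (partial₂ ψ) ε p v ρ)) + lineEdge E f ψ ε p v ρ‖ := h
  rw [← h', ← mul_assoc]
  exact le_mul_of_one_le_left (norm_nonneg _) hlow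

lemma SqBound.const_mul {ε K A : ℝ} (hε : 0 < ε) {Q : ℝ → ℂ} (h : SqBound ε K Q) {a : ℝ}
    (ha : |a| ≤ A) : SqBound ε (A ^ 2 * K) fun ρ => (a : ℂ) * Q ρ := by
  have hc := h.cont
  refine h.of_norm_le hε (by fun_prop) fun ρ _ => ?_
  rw [norm_mul, Complex.norm_real]
  exact mul_le_mul_of_nonneg_right ha (norm_nonneg _)

lemma hasOrder_lineHalf_succ (hE : IsFlatEdge E c) (hf : ContDiff ℝ 1 f) (hψ : IsBump ψ)
    {k m : ℕ} (hkm : k ≤ m + 1) (h1 : HasOrder c m (lineHalf E (partial₁ f) ψ))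
    (h2 : HasOrder c m (lineHalf E (partial₂ f) ψ)) (h3 : HasOrder c k (lineHalf E f (partial₁ ψ)))
    (h4 : HasOrder c k (lineHalf E f (partial₂ ψ))) (h5 : HasOrder c k (lineEdge E f ψ)) :
    HasOrder c (k + 1) (lineHalf E f ψ) := by
  obtain ⟨C1, hC1, h1⟩ := h1
  obtain ⟨C2, hC2, h2⟩ := h2
  obtain ⟨C3, hC3, h3⟩ := h3
  obtain ⟨C4, hC4, h4⟩ := h4
  obtain ⟨C5, hC5, h5⟩ := h5
  refine ⟨16 * (2 * (2 * (4 * (2 * C1 + 2 * C3)) + 2 * (4 * (2 * C2 + 2 * C4))) + 2 * C5),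
    by positivity, fun ε p v hp hpc hpε => ?_⟩
  have h0 : 0 < |p.2| := hp.pos.trans_le hpε
  have hε := hp.pos
  have up : ∀ {C : ℝ} {Q : ℝ → ℂ}, 0 ≤ C → SqBound ε (C * (ε ^ (2 * m) / |p.2| ^ 5)) Q →
      SqBound ε (C * (ε ^ (2 * k) / |p.2| ^ 5)) fun ρ => (ε : ℂ) * Q ρ := by
    intro C Q hC hQ
    refine (hQ.const_mul hε (A := ε) (abs_of_pos hε).le).mono ?_
    have := pow_le_pow_of_le_one hε.le (by linarith [hp.le])
      (show 2 * k ≤ 2 + 2 * m by lia)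
    calc ε ^ 2 * (C * (ε ^ (2 * m) / |p.2| ^ 5)) = C * (ε ^ (2 + 2 * m) / |p.2| ^ 5) := by ring
      _ ≤ _ := by gcongr
  have a1 := ((up hC1 (h1 ε p v hp hpc hpε)).add hε (h3 ε p v hp hpc hpε)).const_mul hε hp.abs_p_fst
  have a2 := ((up hC2 (h2 ε p v hp hpc hpε)).add hε (h4 ε p v hp hpc hpε)).const_mul hε hp.abs_p_snd
  have a3 := ((a1.add hε a2).add hε (h5 ε p v hp hpc hpε)).of_norm_le (a := 4 * ε) hε
    (continuous_lineHalf hE hf.continuous hψ ε p v) fun ρ hρ => norm_lineHalf_le hE hf hψ hp hρ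
  refine a3.mono (le_of_eq ?_)
  ring

lemma hasOrder_lineHalf_one (hE : IsFlatEdge E c) (hf : ContDiff ℝ 1 f) (hψ : IsBump ψ) :
    HasOrder c 1 (lineHalf E f ψ) :=
  hasOrder_lineHalf_succ hE hf hψ (m := 0) (k := 0) (by lia)
    (hasOrder_lineHalf_zero hE (continuous_partial₁ hf) hψ)
    (hasOrder_lineHalf_zero hE (continuous_partial₂ hf) hψ)
    (hasOrder_lineHalf_zero hE hf.continuous hψ.partial₁)
    (hasOrder_lineHalf_zero hE hf.continuous hψ.partial₂)
    (exists_sqBound_edge_zero hE hf.continuous hψ)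

lemma hasOrder_lineHalf_three (hE : IsFlatEdge E c) (hf : ContDiff ℝ 2 f) (hψ : IsBump ψ) :
    HasOrder c 3 (lineHalf E f ψ) := by
  have h1 : ContDiff ℝ 1 (partial₁ f) := contDiff_partial₁ (n := 1) hf
  have h2 : ContDiff ℝ 1 (partial₂ f) := contDiff_partial₂ (n := 1) hf
  have hf1 : ContDiff ℝ 1 f := hf.of_le one_le_two
  have step : ∀ k ≤ 3, ∀ {ψ : ℝ × ℝ → ℂ}, IsBump ψ → HasOrder c k (lineHalf E f ψ) := by
    intro k
    induction k with
    | zero => exact fun _ _ hψ => hasOrder_lineHalf_zero hE hf.continuous hψ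
    | succ k ih =>
      intro hk ψ hψ
      have hed : HasOrder c 2 (lineEdge E f ψ) := exists_sqBound_edge_two hE hf hψ
      exact hasOrder_lineHalf_succ hE hf1 hψ (m := 1) (by lia) (hasOrder_lineHalf_one hE h1 hψ)
        (hasOrder_lineHalf_one hE h2 hψ) (ih (by lia) hψ.partial₁) (ih (by lia) hψ.partial₂)
        (hed.mono (by lia))
  exact step 3 le_rfl hψ

lemma exists_sqBound_lineHalf_near (hE : IsFlatEdge E c) (hf : ContDiff ℝ 1 f) (hψ : IsBump ψ) :
    ∃ C, 0 ≤ C ∧ ∀ ε p v, IsLineParam ε p v → SqBound ε (C * ε) (lineHalf E f ψ ε p v) := by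
  obtain ⟨B1, hB1, k1⟩ := exists_norm_dilate_mul_le (continuous_partial₁ hf) hψ
  obtain ⟨B2, hB2, k2⟩ := exists_norm_dilate_mul_le (continuous_partial₂ hf) hψ
  obtain ⟨B3, hB3, k3⟩ := exists_norm_dilate_mul_le hf.continuous hψ.partial₁
  obtain ⟨B4, hB4, k4⟩ := exists_norm_dilate_mul_le hf.continuous hψ.partial₂
  obtain ⟨B5, hB5, k5⟩ := exists_norm_edgeAmp_le hE hf.continuous hψ
  set V := volume.real (Icc (-4 : ℝ) 4 ×ˢ Icc (-4 : ℝ) 4) with hV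
  set W := volume.real (Icc (-4 : ℝ) 4) with hW
  set B := 2 * (1 * (B1 * V) + B3 * V) + 2 * (1 * (B2 * V) + B4 * V) + B5 * W with hB
  have hV0 : 0 ≤ V := measureReal_nonneg
  have hW0 : 0 ≤ W := measureReal_nonneg
  have hB0 : 0 ≤ B := by positivity
  refine ⟨48 * B ^ 2, by positivity, fun ε p v hp => ?_⟩
  have hε := hp.pos
  have hm : ∀ {a A Y : ℝ} {z : ℂ}, |a| ≤ A → ‖z‖ ≤ Y → ‖(a : ℂ) * z‖ ≤ A * Y := by
    intro a A Y z ha hz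
    rw [norm_mul, Complex.norm_real]
    exact mul_le_mul ha hz (norm_nonneg _) ((abs_nonneg a).trans ha)
  have hH : ∀ {f ψ : ℝ × ℝ → ℂ} {B : ℝ}, IsBump ψ → (∀ y, ‖dilate f ε y * ψ y‖ ≤ B) → ∀ ρ,
      ‖lineHalf E f ψ ε p v ρ‖ ≤ B * V := fun hψ hB ρ =>
    norm_halfInt_le hB (fun y hy => by simp [hψ.eq_zero_of_notMem_box hy]) _
  have hε1 : |ε| ≤ 1 := by rw [abs_of_pos hε]; linarith [hp.le]
  refine (SqBound.of_const (a := 4 * ε * B) hε (continuous_lineHalf hE hf.continuous hψ ε p v)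
    fun ρ hρ => ?_).mono (le_of_eq ?_)
  · refine (norm_lineHalf_le hE hf hψ hp hρ).trans ?_
    refine mul_le_mul_of_nonneg_left ?_ (by positivity)
    have b5 : ‖lineEdge E f ψ ε p v ρ‖ ≤ B5 * W :=
      norm_edgeInt_le (k5 ε p v hp) (fun y hy => edgeAmp_eq_zero hψ hy) _
    have b1 := (norm_add_le _ _).trans (add_le_add (hm hε1 (hH hψ (k1 ε hε hp.le) ρ))
      (hH hψ.partial₁ (k3 ε hε hp.le) ρ))
    have b2 := (norm_add_le _ _).trans (add_le_add (hm hε1 (hH hψ (k2 ε hε hp.le) ρ))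
      (hH hψ.partial₂ (k4 ε hε hp.le) ρ))
    exact (norm_add_le _ _).trans (add_le_add ((norm_add_le _ _).trans
      (add_le_add (hm hp.abs_p_fst b1) (hm hp.abs_p_snd b2))) b5)
  · field_simp
    ring

/-- Square integrals of half plane integrals along lines. -/
lemma exists_sqBound_lineHalf (hE : IsFlatEdge E c) (hf : ContDiff ℝ 2 f) (hψ : IsBump ψ) :
    ∃ C, 0 ≤ C ∧ ∀ ε p v, IsLineParam ε p v →
      SqBound ε (C * (ε / (1 + |p.2| / ε) ^ 5)) (lineHalf E f ψ ε p v) := by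
  obtain ⟨C1, hC1, h1⟩ := hasOrder_lineHalf_three hE hf hψ
  obtain ⟨C2, hC2, h2⟩ := exists_sqBound_lineHalf_near hE (hf.of_le one_le_two) hψ
  have hc := hE.nonneg
  refine ⟨C1 * 32 + C2 * (2 + 16 * c) ^ 5, by positivity, fun ε p v hp => ?_⟩
  have hε := hp.pos
  set X := |p.2| / ε with hX
  have hX0 : 0 ≤ X := by positivity
  have hpX : |p.2| = X * ε := by rw [hX]; field_simp
  by_cases h : 1 + 16 * c ≤ X
  · refine (h1 ε p v hp (by rw [hpX]; gcongr; linarith) (by rw [hpX]; nlinarith)).mono ?_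
    have hX1 : 1 ≤ X := by linarith
    have e1 : ε ^ (2 * 3) / |p.2| ^ 5 = ε * (1 / X ^ 5) := by
      rw [hpX]
      field_simp
    have e2 : 1 / X ^ 5 ≤ 32 / (1 + X) ^ 5 := by
      rw [div_le_div_iff₀ (by positivity) (by positivity)]
      have : (1 + X) ^ 5 ≤ (2 * X) ^ 5 := pow_le_pow_left₀ (by positivity) (by linarith) 5
      nlinarith
    calc C1 * (ε ^ (2 * 3) / |p.2| ^ 5) ≤ C1 * (ε * (32 / (1 + X) ^ 5)) := by
          rw [e1]; gcongr
      _ = (C1 * 32) * (ε / (1 + X) ^ 5) := by ring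
      _ ≤ _ := by
          gcongr
          linarith [show 0 ≤ C2 * (2 + 16 * c) ^ 5 by positivity]
  · refine (h2 ε p v hp).mono ?_
    have e1 : (1 + X) ^ 5 ≤ (2 + 16 * c) ^ 5 := pow_le_pow_left₀ (by positivity) (by linarith) 5
    calc C2 * ε = C2 * (1 + X) ^ 5 * (ε / (1 + X) ^ 5) := by field_simp
      _ ≤ C2 * (2 + 16 * c) ^ 5 * (ε / (1 + X) ^ 5) := by gcongr
      _ ≤ _ := by
          gcongr
          linarith [show 0 ≤ C1 * 32 by positivity]

end

section
variable {g : ℝ → ℝ}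

lemma IsWindow.eq_zero (hg : IsWindow g) {x : ℝ} (hx : 2 / 3 ≤ |x|) : g x = 0 := by
  by_contra h
  have h1 : x ∈ Function.support g := h
  rw [hg.supp_eq] at h1
  linarith [abs_lt.2 h1]

lemma IsWindow.eq_one (hg : IsWindow g) {x : ℝ} (hx : |x| ≤ 1 / 3) : g x = 1 := by
  have h := hg.partition x
  have h1 : ∀ z : ℤ, z ≠ 0 → g (x + z) = 0 := fun z hz => hg.eq_zero (by
    have h2 : (1 : ℝ) ≤ |(z : ℝ)| := by exact_mod_cast Int.one_le_abs hz
    have h3 := abs_sub_abs_le_abs_add (z : ℝ) x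
    rw [add_comm (z : ℝ)] at h3
    linarith)
  have h2 := (hasSum_single 0 h1).unique h
  simpa using h2

lemma IsWindow.gtilde_eq_zero (hg : IsWindow g) {x : ℝ} (hx : |x| ≤ 1 / 3 ∨ 4 / 3 ≤ |x|) :
    gtilde g x = 0 := by
  have h2 : |x / 2| = |x| / 2 := by rw [abs_div, abs_two]
  rcases hx with hx | hx
  · rw [gtilde, hg.eq_one hx, hg.eq_one (x := x / 2) (by rw [h2]; linarith [abs_nonneg x]), sub_self]
  · rw [gtilde, hg.eq_zero (x := x) (by linarith),
      hg.eq_zero (x := x / 2) (by rw [h2]; linarith), sub_self]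

lemma contDiff_gtilde {n : ℕ} (hg : ContDiff ℝ n g) : ContDiff ℝ n (gtilde g) :=
  (hg.comp (contDiff_id.div_const 2)).sub hg

lemma iteratedDeriv_eq_zero_of_isOpen {s : Set ℝ} (hs : IsOpen s) (h : ∀ x ∈ s, g x = 0) (k : ℕ)
    {x : ℝ} (hx : x ∈ s) : iteratedDeriv k g x = 0 := by
  have h1 : g =ᶠ[nhds x] fun _ => (0 : ℝ) := by
    filter_upwards [hs.mem_nhds hx] with y hy using h y hy
  rw [h1.iteratedDeriv_eq]
  simp

lemma IsWindow.iteratedDeriv_eq_zero (hg : IsWindow g) (k : ℕ) {x : ℝ} (hx : 2 / 3 < |x|) :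
    iteratedDeriv k g x = 0 :=
  iteratedDeriv_eq_zero_of_isOpen (isOpen_lt continuous_const continuous_abs)
    (fun _ hy => hg.eq_zero (le_of_lt hy)) k hx

lemma IsWindow.iteratedDeriv_gtilde_eq_zero (hg : IsWindow g) (k : ℕ) {x : ℝ}
    (hx : |x| < 1 / 3 ∨ 4 / 3 < |x|) : iteratedDeriv k (gtilde g) x = 0 :=
  iteratedDeriv_eq_zero_of_isOpen (s := {x | |x| < 1 / 3} ∪ {x | 4 / 3 < |x|})
    ((isOpen_lt continuous_abs continuous_const).union (isOpen_lt continuous_const continuous_abs))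
    (fun _ hy => hg.gtilde_eq_zero (hy.imp le_of_lt le_of_lt)) k hx

lemma exists_abs_iteratedDeriv_le {n : ℕ} {r : ℝ} (hg : ContDiff ℝ n g)
    (h0 : ∀ k x, r < |x| → iteratedDeriv k g x = 0) :
    ∃ M, 0 ≤ M ∧ ∀ k ≤ n, ∀ x, |iteratedDeriv k g x| ≤ M := by
  have h : ∀ k : ℕ, ∃ M, 0 ≤ M ∧ (k ≤ n → ∀ x, |iteratedDeriv k g x| ≤ M) := fun k => by
    by_cases hk : k ≤ n
    · obtain ⟨M, hM⟩ := (isCompact_Icc (a := -r) (b := r)).exists_bound_of_continuousOn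
        (hg.continuous_iteratedDeriv k (by exact_mod_cast hk)).continuousOn
      refine ⟨|M|, abs_nonneg M, fun _ x => ?_⟩
      by_cases hx : |x| ≤ r
      · exact (hM x (abs_le.1 hx)).trans (le_abs_self M)
      · rw [h0 k x (not_le.1 hx), abs_zero]
        exact abs_nonneg M
    · exact ⟨0, le_rfl, fun h => absurd h hk⟩
  choose M hM0 hM using h
  refine ⟨∑ k ∈ Finset.range (n + 1), M k, Finset.sum_nonneg fun k _ => hM0 k,
    fun k hk x => (hM k hk x).trans ?_⟩
  exact Finset.single_le_sum (f := M) (fun k _ => hM0 k) (Finset.mem_range.2 (by omega))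

lemma hasDerivAt_iteratedDeriv {n k : ℕ} (hg : ContDiff ℝ n g) (hk : k < n) (x : ℝ) :
    HasDerivAt (iteratedDeriv k g) (iteratedDeriv (k + 1) g x) x := by
  rw [iteratedDeriv_succ]
  exact ((hg.differentiable_iteratedDeriv k (by exact_mod_cast hk)) x).hasDerivAt

end

/-- Differentiation of half plane integrals along lines. -/
lemma hasDerivAt_halfInt_linePoint {e : ℝ → ℝ} {F : ℝ × ℝ → ℂ} (he : Continuous e)
    (hF : Continuous F) (hc : HasCompactSupport F) (p v : ℝ × ℝ) (ρ : ℝ) :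
    HasDerivAt (fun s => halfInt e F (linePoint p v s))
      (-Complex.I * (p.1 : ℂ) * halfInt e (fun y => (y.1 : ℂ) * F y) (linePoint p v ρ) +
        -Complex.I * (p.2 : ℂ) * halfInt e (fun y => (y.2 : ℂ) * F y) (linePoint p v ρ)) ρ := by
  have hF1 : Continuous fun y : ℝ × ℝ => (y.1 : ℂ) * F y := by fun_prop
  have hF2 : Continuous fun y : ℝ × ℝ => (y.2 : ℂ) * F y := by fun_prop
  have hbc : Continuous fun y : ℝ × ℝ => ((|p.1 * y.1 + p.2 * y.2| : ℝ) : ℂ) * F y := by fun_prop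
  have key := hasDerivAt_integral_of_dominated_loc_of_deriv_le (μ := volume) (𝕜 := ℝ)
    (F := fun s y => (if e y.2 ≤ y.1 then F y else 0) *
      Complex.exp (-Complex.I * (((linePoint p v s).1 * y.1 + (linePoint p v s).2 * y.2 : ℝ) : ℂ)))
    (F' := fun s y => -Complex.I * ((p.1 * y.1 + p.2 * y.2 : ℝ) : ℂ) *
      ((if e y.2 ≤ y.1 then F y else 0) * Complex.exp
        (-Complex.I * (((linePoint p v s).1 * y.1 + (linePoint p v s).2 * y.2 : ℝ) : ℂ))))
    (bound := fun y => ‖((|p.1 * y.1 + p.2 * y.2| : ℝ) : ℂ) * F y‖)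
    (x₀ := ρ) (s := Set.univ) Filter.univ_mem
    (Filter.Eventually.of_forall fun s => (integrable_halfInt he hF hc _).aestronglyMeasurable)
    (integrable_halfInt he hF hc _)
    ((Continuous.aestronglyMeasurable (by fun_prop)).mul
      (integrable_halfInt he hF hc _).aestronglyMeasurable)
    (ae_of_all _ fun y s _ => ?_)
    (hbc.integrable_of_hasCompactSupport hc.mul_left).norm
    (ae_of_all _ fun y s _ => ?_)
  · refine key.2.congr_deriv ?_
    rw [halfInt, halfInt, ← integral_const_mul, ← integral_const_mul, ← integral_add
      ((integrable_halfInt he hF1 hc.mul_left _).const_mul _)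
      ((integrable_halfInt he hF2 hc.mul_left _).const_mul _)]
    congr 1
    funext y
    split_ifs
    · push_cast; ring
    · simp
  · rw [norm_mul, norm_mul, norm_mul, norm_cexp_neg_I_mul, mul_one, norm_neg, Complex.norm_I,
      one_mul, norm_mul, Complex.norm_real, Complex.norm_real, Real.norm_eq_abs, Real.norm_eq_abs,
      abs_abs]
    refine mul_le_mul_of_nonneg_left ?_ (abs_nonneg _)
    split_ifs
    · exact le_rfl
    · simp
  · have h1 : HasDerivAt (fun s : ℝ =>
        (((linePoint p v s).1 * y.1 + (linePoint p v s).2 * y.2 : ℝ) : ℂ))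
        ((p.1 * y.1 + p.2 * y.2 : ℝ) : ℂ) s := by
      refine HasDerivAt.ofReal_comp ?_
      have h2 := (((hasDerivAt_id s).mul_const p.1).add_const v.1).mul_const y.1
      have h3 := (((hasDerivAt_id s).mul_const p.2).add_const v.2).mul_const y.2
      refine (h2.add h3).congr_deriv ?_
      simp
    refine (((h1.const_mul (-Complex.I)).cexp).const_mul (if e y.2 ≤ y.1 then F y else 0)).congr_deriv
      ?_
    ring

/-- Square integrable continuous functions with a bound on the square integral. -/
structure L2Bound (K : ℝ) (F : ℝ × ℝ → ℂ) : Prop where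
  cont : Continuous F
  integrable : Integrable fun w => ‖F w‖ ^ 2
  le : ∫ w, ‖F w‖ ^ 2 ≤ K

lemma L2Bound.add {K L : ℝ} {F G : ℝ × ℝ → ℂ} (hF : L2Bound K F) (hG : L2Bound L G) :
    L2Bound (2 * (K + L)) fun w => F w + G w := by
  have h1 : ∀ w, ‖F w + G w‖ ^ 2 ≤ 2 * (‖F w‖ ^ 2 + ‖G w‖ ^ 2) := fun w => by
    nlinarith [norm_add_le (F w) (G w), sq_nonneg (‖F w‖ - ‖G w‖), norm_nonneg (F w + G w),
      norm_nonneg (F w), norm_nonneg (G w)]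
  have h2 : Integrable fun w => 2 * (‖F w‖ ^ 2 + ‖G w‖ ^ 2) :=
    (hF.integrable.add hG.integrable).const_mul 2
  refine ⟨hF.cont.add hG.cont, ?_, ?_⟩
  · refine h2.mono' ((hF.cont.add hG.cont).norm.pow 2).aestronglyMeasurable
      (ae_of_all _ fun w => ?_)
    rw [Real.norm_of_nonneg (by positivity)]
    exact h1 w
  · calc ∫ w, ‖F w + G w‖ ^ 2 ≤ ∫ w, 2 * (‖F w‖ ^ 2 + ‖G w‖ ^ 2) :=
          integral_mono_of_nonneg (ae_of_all _ fun w => by positivity) h2 (ae_of_all _ h1)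
      _ = 2 * ((∫ w, ‖F w‖ ^ 2) + ∫ w, ‖G w‖ ^ 2) := by
          rw [integral_const_mul, integral_add hF.integrable hG.integrable]
      _ ≤ _ := by linarith [hF.le, hG.le]

lemma L2Bound.const_mul {K : ℝ} {F : ℝ × ℝ → ℂ} (hF : L2Bound K F) {c : ℂ} (hc : ‖c‖ ≤ 1) :
    L2Bound K fun w => c * F w := by
  have h1 : ∀ w, ‖c * F w‖ ^ 2 = ‖c‖ ^ 2 * ‖F w‖ ^ 2 := fun w => by rw [norm_mul, mul_pow]
  refine ⟨continuous_const.mul hF.cont, ?_, ?_⟩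
  · simp only [h1]
    exact hF.integrable.const_mul _
  · simp only [h1]
    rw [integral_const_mul]
    have h2 : ‖c‖ ^ 2 ≤ 1 := pow_le_one₀ (norm_nonneg c) hc
    have h3 : 0 ≤ ∫ w, ‖F w‖ ^ 2 := integral_nonneg fun w => by positivity
    nlinarith [hF.le]

/-- Linear combinations, with coefficients in the unit disc, of those members of the family `V`
that have order `m`; the natural number measures the number of summands. -/
inductive IsComb {ι : Type} (V : ι → ℝ × ℝ → ℂ) (o : ι → ℕ) (m : ℕ) :
    ℕ → (ℝ × ℝ → ℂ) → Prop
  | single {c : ℂ} {i : ι} (hc : ‖c‖ ≤ 1) (hi : o i = m) : IsComb V o m 1 fun w => c * V i w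
  | add {a b : ℕ} {F G : ℝ × ℝ → ℂ} (hF : IsComb V o m a F) (hG : IsComb V o m b G) :
      IsComb V o m (2 * (a + b)) fun w => F w + G w

namespace IsComb
variable {ι : Type} {V : ι → ℝ × ℝ → ℂ} {o : ι → ℕ} {m a : ℕ} {F : ℝ × ℝ → ℂ}

lemma l2Bound {K : ℝ} (hV : ∀ i, o i = m → L2Bound K (V i)) (h : IsComb V o m a F) :
    L2Bound (a * K) F := by
  induction h with
  | single hc hi => simpa using (hV _ hi).const_mul hc
  | add _ _ hF hG =>
    have := hF.add hG
    rw [← add_mul, ← mul_assoc] at this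
    exact_mod_cast this

lemma const_mul {c : ℂ} (hc : ‖c‖ ≤ 1) (h : IsComb V o m a F) :
    IsComb V o m a fun w => c * F w := by
  induction h with
  | @single d i hd hi =>
    have := single (V := V) (c := c * d) (i := i)
      (by rw [norm_mul]; exact mul_le_one₀ hc (norm_nonneg d) hd) hi
    simpa only [mul_assoc] using this
  | add _ _ hF hG => simpa only [mul_add] using hF.add hG

lemma hasDerivAt {u : ℝ → ℝ × ℝ → ℝ × ℝ} {x : ℝ × ℝ → ℝ} {k : ℕ}
    (hV : ∀ i, o i = m → ∃ D, IsComb V o (m + 1) k D ∧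
      ∀ w, HasDerivAt (fun s => V i (u s w)) (D w) (x w)) (h : IsComb V o m a F) :
    ∃ D, IsComb V o (m + 1) (k * a) D ∧ ∀ w, HasDerivAt (fun s => F (u s w)) (D w) (x w) := by
  induction h with
  | @single d i hd hi =>
    obtain ⟨D, hD, h⟩ := hV i hi
    exact ⟨fun w => d * D w, by simpa using hD.const_mul hd, fun w => (h w).const_mul d⟩
  | @add a b F G _ _ hF hG =>
    obtain ⟨D, hD, h⟩ := hF
    obtain ⟨D', hD', h'⟩ := hG
    refine ⟨fun w => D w + D' w, ?_, fun w => (h w).add (h' w)⟩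
    rw [show k * (2 * (a + b)) = 2 * (k * a + k * b) by ring]
    exact hD.add hD'

lemma iterate_deriv {u : ℝ → ℝ × ℝ → ℝ × ℝ} {x : ℝ × ℝ → ℝ} {k q : ℕ}
    (hV : ∀ i, o i < q → ∃ D, IsComb V o (o i + 1) k D ∧
      ∀ w, HasDerivAt (fun s => V i (u s w)) (D w) (x w)) (r : ℕ) (hr : m + r ≤ q)
    (h : IsComb V o m a F) :
    IsComb V o (m + r) (k ^ r * a) ((fun F w => deriv (fun s => F (u s w)) (x w))^[r] F) := by
  induction r with
  | zero => simpa using h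
  | succ r ih =>
    obtain ⟨D, hD, h⟩ := (ih (by omega)).hasDerivAt (u := u) (x := x) (k := k)
      fun i hi => by rw [← hi]; exact hV i (by omega)
    rw [Function.iterate_succ_apply', pow_succ', mul_assoc, ← add_assoc]
    convert hD using 1
    funext w
    exact (h w).deriv

end IsComb

lemma iterate_deriv_comp_mul {D : (ℝ × ℝ → ℂ) → ℝ × ℝ → ℂ} {ε : ℝ}
    (hD : ∀ (c : ℂ) (F : ℝ × ℝ → ℂ), D (fun w => c * F (ε * w.1, ε * w.2)) =
      fun w => (c * ε) * D F (ε * w.1, ε * w.2)) (c : ℂ) (r : ℕ) (F : ℝ × ℝ → ℂ) :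
    D^[r] (fun w => c * F (ε * w.1, ε * w.2)) =
      fun w => (c * (ε : ℂ) ^ r) * D^[r] F (ε * w.1, ε * w.2) := by
  induction r generalizing c F with
  | zero => simp
  | succ r ih =>
    rw [Function.iterate_succ_apply, hD, ih, Function.iterate_succ_apply]
    funext w
    ring

lemma pd_comp_mul (r : ℕ × ℕ) (c : ℂ) (ε : ℝ) (F : ℝ × ℝ → ℂ) :
    pd r (fun w => c * F (ε * w.1, ε * w.2)) =
      fun w => (c * (ε : ℂ) ^ (r.1 + r.2)) * pd r F (ε * w.1, ε * w.2) := by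
  rw [pd, iterate_deriv_comp_mul, iterate_deriv_comp_mul, pd]
  · funext w
    ring
  · intro c F
    funext w
    have h := deriv_comp_mul_left ε (fun s => F (s, ε * w.2)) w.1
    simp only [pd1, deriv_const_mul_field, h, Complex.real_smul]
    ring
  · intro c F
    funext w
    have h := deriv_comp_mul_left ε (fun s => F (ε * w.1, s)) w.2
    simp only [pd2, deriv_const_mul_field, h, Complex.real_smul]
    ring

lemma integral_norm_sq_pd_comp_mul (r : ℕ × ℕ) (c : ℂ) {ε : ℝ} (hε : 0 < ε) (F : ℝ × ℝ → ℂ) :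
    ∫ w, ‖pd r (fun w => c * F (ε * w.1, ε * w.2)) w‖ ^ 2 =
      ‖c‖ ^ 2 * ε ^ (2 * (r.1 + r.2)) * (ε ^ 2)⁻¹ * ∫ w, ‖pd r F w‖ ^ 2 := by
  rw [pd_comp_mul]
  have h := Measure.integral_comp_smul (volume : Measure (ℝ × ℝ)) (fun w => ‖pd r F w‖ ^ 2) ε
  simp only [Module.finrank_prod, Module.finrank_self, Prod.smul_def, smul_eq_mul] at h
  simp only [norm_mul, norm_pow, Complex.norm_real, mul_pow, Real.norm_of_nonneg hε.le]
  rw [integral_const_mul, h, abs_of_pos (by positivity)]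
  ring

/-- The moment `y ↦ y₁ ^ n₁ y₂ ^ n₂ ψ(y)`. -/
def moment (ψ : ℝ × ℝ → ℂ) (n : ℕ × ℕ) : ℝ × ℝ → ℂ := fun y =>
  (y.1 : ℂ) ^ n.1 * (y.2 : ℂ) ^ n.2 * ψ y

lemma IsBump.moment {ψ : ℝ × ℝ → ℂ} (h : IsBump ψ) (n : ℕ × ℕ) : IsBump (moment ψ n) := by
  refine ⟨ContDiff.mul (ContDiff.mul (ContDiff.pow ?_ _) (ContDiff.pow ?_ _)) h.contDiff,
    (closure_mono (Function.support_mul_subset_right _ _)).trans h.supp⟩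
  · exact Complex.ofRealCLM.contDiff.comp contDiff_fst
  · exact Complex.ofRealCLM.contDiff.comp contDiff_snd

/-- The rotated half plane integral. -/
def rotHalf (E : ℝ → ℝ) (f ψ : ℝ × ℝ → ℂ) (ε γ : ℝ) : ℝ × ℝ → ℂ := fun w =>
  halfInt (scaledEdge E ε) (fun y => dilate f ε y * ψ y) (rotT γ w)

/-- The coordinate along the frequency cone. -/
def coneFst (i : Bool) (w : ℝ × ℝ) : ℝ := if i then w.1 else w.2

/-- The sheared coordinate across the frequency cone. -/
def coneSnd (i : Bool) (t : ℝ) (w : ℝ × ℝ) : ℝ := if i then w.2 - t * w.1 else w.1 - t * w.2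

/-- The frequency point with given cone coordinates. -/
def conePoint (i : Bool) (t : ℝ) (z : ℝ × ℝ) : ℝ × ℝ :=
  if i then (z.1, z.2 + t * z.1) else (z.2 + t * z.1, z.1)

lemma coneFst_conePoint (i : Bool) (t : ℝ) (z : ℝ × ℝ) : coneFst i (conePoint i t z) = z.1 := by
  cases i <;> simp [coneFst, conePoint]

lemma coneSnd_conePoint (i : Bool) (t : ℝ) (z : ℝ × ℝ) : coneSnd i t (conePoint i t z) = z.2 := by
  cases i <;> simp [coneSnd, conePoint]

lemma continuous_coneFst (i : Bool) : Continuous (coneFst i) := by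
  cases i
  exacts [continuous_snd, continuous_fst]

lemma continuous_coneSnd (i : Bool) (t : ℝ) : Continuous (coneSnd i t) := by
  cases i
  · exact continuous_fst.sub (continuous_const.mul continuous_snd)
  · exact continuous_snd.sub (continuous_const.mul continuous_fst)

/-- The shear `(ρ, τ) ↦ (ρ, τ + tρ)`. -/
def shearHomeomorph (t : ℝ) : ℝ × ℝ ≃ₜ ℝ × ℝ where
  toFun z := (z.1, z.2 + t * z.1)
  invFun z := (z.1, z.2 - t * z.1)
  left_inv z := by simp
  right_inv z := by simp
  continuous_toFun := by fun_prop
  continuous_invFun := by fun_prop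

lemma measurePreserving_shearHomeomorph (t : ℝ) :
    MeasurePreserving (shearHomeomorph t) (volume : Measure (ℝ × ℝ)) volume :=
  (MeasurePreserving.id (volume : Measure ℝ)).skew_product (g := fun x y => y + t * x)
    (by fun_prop) (ae_of_all _ fun x => (measurePreserving_add_right volume (t * x)).map_eq)

/-- The map `conePoint` as a homeomorphism. -/
def coneHomeomorph (i : Bool) (t : ℝ) : ℝ × ℝ ≃ₜ ℝ × ℝ :=
  if i then shearHomeomorph t else (shearHomeomorph t).trans (Homeomorph.prodComm ℝ ℝ)

lemma coneHomeomorph_apply (i : Bool) (t : ℝ) (z : ℝ × ℝ) :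
    coneHomeomorph i t z = conePoint i t z := by
  cases i <;> simp [coneHomeomorph, conePoint, shearHomeomorph]

lemma measurePreserving_coneHomeomorph (i : Bool) (t : ℝ) :
    MeasurePreserving (coneHomeomorph i t) (volume : Measure (ℝ × ℝ)) volume := by
  cases i
  · exact Measure.measurePreserving_swap.comp (measurePreserving_shearHomeomorph t)
  · exact measurePreserving_shearHomeomorph t

/-- Integration over a cone in cone coordinates. -/
lemma l2Bound_of_cone {F : ℝ × ℝ → ℂ} {i : Bool} {t R K : ℝ} (hF : Continuous F)
    (h0 : ∀ z : ℝ × ℝ, R < |z.1| ∨ 2 / 3 < |z.2| → F (conePoint i t z) = 0)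
    (hK : ∀ τ, |τ| ≤ 2 / 3 → ∫ ρ, ‖F (conePoint i t (ρ, τ))‖ ^ 2 ≤ K) :
    L2Bound (4 / 3 * K) F := by
  have hmp := measurePreserving_coneHomeomorph i t
  have hme := (coneHomeomorph i t).measurableEmbedding
  have hK0 : 0 ≤ K := (integral_nonneg fun ρ => by positivity).trans (hK 0 (by norm_num))
  have hs : HasCompactSupport fun z => ‖F (coneHomeomorph i t z)‖ ^ 2 := by
    refine HasCompactSupport.intro (K := Icc (-R) R ×ˢ Icc (-(2 / 3)) (2 / 3))
      (isCompact_Icc.prod isCompact_Icc) fun z hz => ?_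
    have : R < |z.1| ∨ 2 / 3 < |z.2| := by
      by_contra! h
      exact hz ⟨abs_le.1 h.1, abs_le.1 h.2⟩
    rw [coneHomeomorph_apply, h0 z this]
    simp
  have hi : Integrable fun z => ‖F (coneHomeomorph i t z)‖ ^ 2 :=
    ((hF.comp (coneHomeomorph i t).continuous).norm.pow 2).integrable_of_hasCompactSupport hs
  refine ⟨hF, (hmp.integrable_comp_emb hme (g := fun w => ‖F w‖ ^ 2)).1 hi, ?_⟩
  rw [← hmp.integral_comp hme (fun w => ‖F w‖ ^ 2)]
  have hi' : Integrable (fun z : ℝ × ℝ => ‖F (coneHomeomorph i t z)‖ ^ 2)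
    ((volume : Measure ℝ).prod volume) := hi
  have h1 := integral_prod_symm _ hi'
  rw [← Measure.volume_eq_prod] at h1
  rw [h1]
  simp only [coneHomeomorph_apply]
  calc ∫ τ, ∫ ρ, ‖F (conePoint i t (ρ, τ))‖ ^ 2
      ≤ ∫ τ, (Icc (-(2 / 3) : ℝ) (2 / 3)).indicator (fun _ => K) τ := by
        refine integral_mono_of_nonneg
          (ae_of_all _ fun τ => integral_nonneg fun ρ => by positivity) ?_
          (ae_of_all _ fun τ => ?_)
        · exact (integrable_indicator_iff measurableSet_Icc).2
            (integrableOn_const (by simp))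
        · by_cases hτ : |τ| ≤ 2 / 3
          · have hm : τ ∈ Icc (-(2 / 3) : ℝ) (2 / 3) := abs_le.1 hτ
            rw [indicator_of_mem hm]
            exact hK τ hτ
          · have hm : τ ∉ Icc (-(2 / 3) : ℝ) (2 / 3) := fun h => hτ (abs_le.2 h)
            rw [indicator_of_notMem hm]
            simp [h0 (_, τ) (Or.inr (not_le.1 hτ))]
    _ = 4 / 3 * K := by
        rw [integral_indicator measurableSet_Icc]
        simp
        norm_num

/-- The members of the family of products of moments and window derivatives. -/
def windowTerm (g : ℝ → ℝ) (i : Bool) (E : ℝ → ℝ) (f ψ : ℝ × ℝ → ℂ) (ε γ t : ℝ)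
    (I : (ℕ × ℕ) × ℕ × ℕ) : ℝ × ℝ → ℂ := fun w =>
  rotHalf E f (moment ψ I.1) ε γ w * ((iteratedDeriv I.2.1 (gtilde g) (ε * coneFst i w) *
    iteratedDeriv I.2.2 g (coneSnd i t w) : ℝ) : ℂ)

/-- The order of a member of the family `windowTerm`. -/
def termOrder (I : (ℕ × ℕ) × ℕ × ℕ) : ℕ := I.1.1 + I.1.2 + (I.2.1 + I.2.2)

lemma IsComb.four {ι : Type} {V : ι → ℝ × ℝ → ℂ} {o : ι → ℕ} {m : ℕ} {c₁ c₂ c₃ c₄ : ℂ}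
    {i₁ i₂ i₃ i₄ : ι} (h₁ : ‖c₁‖ ≤ 1) (h₂ : ‖c₂‖ ≤ 1) (h₃ : ‖c₃‖ ≤ 1) (h₄ : ‖c₄‖ ≤ 1)
    (k₁ : o i₁ = m) (k₂ : o i₂ = m) (k₃ : o i₃ = m) (k₄ : o i₄ = m) :
    IsComb V o m 16 fun w => c₁ * V i₁ w + c₂ * V i₂ w + (c₃ * V i₃ w + c₄ * V i₄ w) :=
  ((IsComb.single h₁ k₁).add (IsComb.single h₂ k₂)).add
    ((IsComb.single h₃ k₃).add (IsComb.single h₄ k₄))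

lemma linePoint_rotT (γ : ℝ) (d v : ℝ × ℝ) (s : ℝ) :
    rotT γ (linePoint d v s) = linePoint (rotT γ d) (rotT γ v) s := by
  simp only [rotT, linePoint, Prod.mk.injEq]
  constructor <;> ring

lemma hasDerivAt_rotHalf {ε : ℝ} {E : ℝ → ℝ} {f ψ : ℝ × ℝ → ℂ} (hE : Continuous (scaledEdge E ε))
    (hf : Continuous f) (hψ : IsBump ψ) (n : ℕ × ℕ) (γ : ℝ) (d v : ℝ × ℝ) (s : ℝ) :
    HasDerivAt (fun s => rotHalf E f (moment ψ n) ε γ (linePoint d v s))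
      (-Complex.I * ((rotT γ d).1 : ℂ) *
          rotHalf E f (moment ψ (n.1 + 1, n.2)) ε γ (linePoint d v s) +
        -Complex.I * ((rotT γ d).2 : ℂ) *
          rotHalf E f (moment ψ (n.1, n.2 + 1)) ε γ (linePoint d v s)) s := by
  simp only [rotHalf, linePoint_rotT]
  refine (hasDerivAt_halfInt_linePoint hE (continuous_dilate_mul hf (hψ.moment n) ε)
    (hasCompactSupport_dilate_mul (hψ.moment n) ε) _ _ s).congr_deriv ?_
  congr 4
  · funext y
    simp only [moment]
    ring
  · funext y
    simp only [moment]
    ring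

lemma continuous_halfInt {e : ℝ → ℝ} {F : ℝ × ℝ → ℂ} (he : Continuous e) (hF : Continuous F)
    (hc : HasCompactSupport F) : Continuous (halfInt e F) := by
  refine continuous_of_dominated (bound := fun y => ‖F y‖)
    (fun ζ => (integrable_halfInt he hF hc ζ).aestronglyMeasurable)
    (fun ζ => ae_of_all _ fun y => ?_) (hF.integrable_of_hasCompactSupport hc).norm
    (ae_of_all _ fun y => by fun_prop)
  rw [norm_mul, norm_cexp_neg_I_mul, mul_one]
  split_ifs <;> simp

section
variable {g : ℝ → ℝ} {q : ℕ} {i : Bool} {E : ℝ → ℝ} {f ψ : ℝ × ℝ → ℂ} {ε γ t : ℝ}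

lemma continuous_rotHalf (hE : Continuous (scaledEdge E ε)) (hf : Continuous f)
    (hψ : IsBump ψ) : Continuous (rotHalf E f ψ ε γ) :=
  (continuous_halfInt hE (continuous_dilate_mul hf hψ ε)
    (hasCompactSupport_dilate_mul hψ ε)).comp (by unfold rotT; fun_prop)

lemma continuous_windowTerm (hg : ContDiff ℝ q g) (hE : Continuous (scaledEdge E ε))
    (hf : Continuous f) (hψ : IsBump ψ) {I : (ℕ × ℕ) × ℕ × ℕ} (hI : termOrder I ≤ q) :
    Continuous (windowTerm g i E f ψ ε γ t I) := by
  have h1 : I.2.1 ≤ q := by rw [termOrder] at hI; omega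
  have h2 : I.2.2 ≤ q := by rw [termOrder] at hI; omega
  refine (continuous_rotHalf hE hf (hψ.moment I.1)).mul (Complex.continuous_ofReal.comp ?_)
  exact (((contDiff_gtilde hg).continuous_iteratedDeriv _ (by exact_mod_cast h1)).comp
    (continuous_const.mul (continuous_coneFst i))).mul
      ((hg.continuous_iteratedDeriv _ (by exact_mod_cast h2)).comp (continuous_coneSnd i t))

lemma hasDerivAt_coneFst (d v : ℝ × ℝ) (s : ℝ) :
    HasDerivAt (fun s => coneFst i (linePoint d v s)) (coneFst i d) s := by
  cases i
  · exact (((hasDerivAt_id s).mul_const d.2).add_const v.2).congr_deriv (one_mul _)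
  · exact (((hasDerivAt_id s).mul_const d.1).add_const v.1).congr_deriv (one_mul _)

lemma hasDerivAt_coneSnd (d v : ℝ × ℝ) (s : ℝ) :
    HasDerivAt (fun s => coneSnd i t (linePoint d v s)) (coneSnd i t d) s := by
  have h1 := ((hasDerivAt_id s).mul_const d.1).add_const v.1
  have h2 := ((hasDerivAt_id s).mul_const d.2).add_const v.2
  cases i
  · refine (h1.sub (h2.const_mul t)).congr_deriv ?_
    simp [coneSnd]
  · refine (h2.sub (h1.const_mul t)).congr_deriv ?_
    simp [coneSnd]

lemma exists_hasDerivAt_windowTerm (hg : ContDiff ℝ q g) (hE : Continuous (scaledEdge E ε))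
    (hf : Continuous f) (hψ : IsBump ψ) (hε : |ε| ≤ 1) (ht : |t| ≤ 1) {d : ℝ × ℝ}
    (hd : d = (1, 0) ∨ d = (0, 1)) {u : ℝ → ℝ × ℝ → ℝ × ℝ} {x : ℝ × ℝ → ℝ}
    (hu : ∀ w, ∃ v, (fun s => u s w) = linePoint d v) (hux : ∀ w, u (x w) w = w)
    {I : (ℕ × ℕ) × ℕ × ℕ} (hI : termOrder I < q) :
    ∃ D, IsComb (windowTerm g i E f ψ ε γ t) termOrder (termOrder I + 1) 16 D ∧
      ∀ w, HasDerivAt (fun s => windowTerm g i E f ψ ε γ t I (u s w)) (D w) (x w) := by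
  obtain ⟨n, k, l⟩ := I
  have hk : k < q := by simp only [termOrder] at hI; omega
  have hl : l < q := by simp only [termOrder] at hI; omega
  have hr : ∀ a : ℝ, |a| ≤ 1 → ‖-Complex.I * (a : ℂ)‖ ≤ 1 := fun a ha => by simpa using ha
  have hr' : ∀ a : ℝ, |a| ≤ 1 → ‖(a : ℂ)‖ ≤ 1 := fun a ha => by simpa using ha
  have p1 : |(rotT γ d).1| ≤ 1 := by
    rcases hd with rfl | rfl <;> simp [rotT, abs_cos_le_one, abs_sin_le_one]
  have p2 : |(rotT γ d).2| ≤ 1 := by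
    rcases hd with rfl | rfl <;> simp [rotT, abs_cos_le_one, abs_sin_le_one]
  have p3 : |ε * coneFst i d| ≤ 1 := by
    rcases hd with rfl | rfl <;> cases i <;> simp [coneFst, hε]
  have p4 : |coneSnd i t d| ≤ 1 := by
    rcases hd with rfl | rfl <;> cases i <;> simp [coneSnd, ht]
  refine ⟨_, IsComb.four (hr _ p1) (hr _ p2) (hr' _ p3) (hr' _ p4)
    (i₁ := ((n.1 + 1, n.2), k, l)) (i₂ := ((n.1, n.2 + 1), k, l)) (i₃ := (n, k + 1, l))
    (i₄ := (n, k, l + 1)) (by simp only [termOrder]; omega) (by simp only [termOrder]; omega)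
    (by simp only [termOrder]; omega) (by simp only [termOrder]; omega), fun w => ?_⟩
  obtain ⟨v, hv⟩ := hu w
  have hw : linePoint d v (x w) = w := by rw [← hv]; exact hux w
  have hv' : ∀ s, u s w = linePoint d v s := fun s => congrFun hv s
  simp only [hv']
  have h1 := hasDerivAt_rotHalf (γ := γ) hE hf hψ n d v (x w)
  have h2 := (hasDerivAt_iteratedDeriv (contDiff_gtilde hg) hk
    (ε * coneFst i (linePoint d v (x w)))).comp (x w)
      ((hasDerivAt_coneFst (i := i) d v (x w)).const_mul ε)
  have h3 := (hasDerivAt_iteratedDeriv hg hl (coneSnd i t (linePoint d v (x w)))).comp (x w)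
      (hasDerivAt_coneSnd (i := i) (t := t) d v (x w))
  refine (h1.mul (h2.mul h3).ofReal_comp).congr_deriv ?_
  simp only [windowTerm, Pi.mul_apply, Function.comp_apply, hw]
  push_cast
  ring

/-- Derivatives of products of moments and window derivatives. -/
lemma isComb_pd_windowTerm (hg : ContDiff ℝ q g) (hE : Continuous (scaledEdge E ε))
    (hf : Continuous f) (hψ : IsBump ψ) (hε : |ε| ≤ 1) (ht : |t| ≤ 1) {r : ℕ × ℕ}
    (hr : r.1 + r.2 ≤ q) :
    IsComb (windowTerm g i E f ψ ε γ t) termOrder (r.1 + r.2) (16 ^ (r.1 + r.2))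
      (pd r (windowTerm g i E f ψ ε γ t ((0, 0), 0, 0))) := by
  have h0 : IsComb (windowTerm g i E f ψ ε γ t) termOrder 0 1
      (windowTerm g i E f ψ ε γ t ((0, 0), 0, 0)) := by
    have h := IsComb.single (V := windowTerm g i E f ψ ε γ t) (o := termOrder) (m := 0) (c := 1)
      (i := ((0, 0), 0, 0)) (by simp) rfl
    simp only [one_mul] at h
    exact h
  have h2 := h0.iterate_deriv (u := fun s w => (w.1, s)) (x := fun w => w.2) (q := q)
    (fun I hI => exists_hasDerivAt_windowTerm hg hE hf hψ hε ht (d := (0, 1)) (Or.inr rfl)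
      (fun w => ⟨(w.1, 0), by funext s; simp [linePoint]⟩) (fun w => rfl) hI) r.2 (by omega)
  have h1 := h2.iterate_deriv (u := fun s w => (s, w.2)) (x := fun w => w.1) (q := q)
    (fun I hI => exists_hasDerivAt_windowTerm hg hE hf hψ hε ht (d := (1, 0)) (Or.inl rfl)
      (fun w => ⟨(0, w.2), by funext s; simp [linePoint]⟩) (fun w => rfl) hI) r.1 (by omega)
  have e1 : 16 ^ r.1 * (16 ^ r.2 * 1) = 16 ^ (r.1 + r.2) := by ring
  have e2 : 0 + r.2 + r.1 = r.1 + r.2 := by ring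
  rw [e1, e2] at h1
  exact h1

end

/-- The direction of a frequency cone of slope `t`. -/
def coneDir (i : Bool) (t : ℝ) : ℝ × ℝ := if i then (1, t) else (t, 1)

lemma rotT_conePoint (i : Bool) (γ t τ ρ : ℝ) : rotT γ (conePoint i t (ρ, τ)) =
    linePoint (rotT γ (coneDir i t)) (rotT γ (conePoint i t (0, τ))) ρ := by
  rw [← linePoint_rotT]
  congr 1
  cases i <;> simp [conePoint, coneDir, linePoint] <;> ring

lemma abs_cos_mul_add_sin_mul_le (γ a b : ℝ) {c : ℝ} (hc : 0 ≤ c) (h : a ^ 2 + b ^ 2 ≤ c ^ 2) :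
    |(rotT γ (a, b)).1| ≤ c ∧ |(rotT γ (a, b)).2| ≤ c := by
  have h1 := Real.sin_sq_add_cos_sq γ
  have h2 : (cos γ * a + sin γ * b) ^ 2 + (-sin γ * a + cos γ * b) ^ 2 ≤ c ^ 2 := by
    have : (cos γ * a + sin γ * b) ^ 2 + (-sin γ * a + cos γ * b) ^ 2 =
        (sin γ ^ 2 + cos γ ^ 2) * (a ^ 2 + b ^ 2) := by ring
    rw [this, h1, one_mul]
    exact h
  exact ⟨abs_le_of_sq_le_sq (by dsimp only [rotT]; nlinarith) hc,
    abs_le_of_sq_le_sq (by dsimp only [rotT]; nlinarith) hc⟩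

lemma isLineParam_cone {i : Bool} {ε γ t τ : ℝ} (hε : 0 < ε) (hε1 : ε ≤ 1 / 32) (ht : |t| ≤ 1)
    (hτ : |τ| ≤ 2 / 3) :
    IsLineParam ε (rotT γ (coneDir i t)) (rotT γ (conePoint i t (0, τ))) := by
  have h1 := Real.sin_sq_add_cos_sq γ
  have ht2 : t ^ 2 ≤ 1 := (sq_le_one_iff_abs_le_one t).2 ht
  have hτ2 : τ ^ 2 ≤ 1 ^ 2 := sq_le_sq.2 (by rw [abs_one]; linarith)
  have h2 : (rotT γ (coneDir i t)).1 ^ 2 + (rotT γ (coneDir i t)).2 ^ 2 =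
      (sin γ ^ 2 + cos γ ^ 2) * (1 + t ^ 2) := by
    cases i <;> simp only [rotT, coneDir, Bool.false_eq_true, if_false, if_true] <;> ring
  have h3 := abs_cos_mul_add_sin_mul_le γ (conePoint i t (0, τ)).1 (conePoint i t (0, τ)).2
    one_pos.le (by cases i <;> simpa [conePoint] using hτ2)
  rw [h1, one_mul] at h2
  exact ⟨hε, hε1, by nlinarith, by nlinarith, h3.1, h3.2⟩

/-- The second component of the rotated cone direction controls the angle. -/
lemma abs_sin_le_rotT_coneDir (i : Bool) (γ t : ℝ) :
    |sin ((if i then arctan t else π / 2 - arctan t) - γ)| ≤ |(rotT γ (coneDir i t)).2| := by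
  have h0 : sin (arctan t) = cos (arctan t) * t := by
    rw [sin_arctan, cos_arctan]
    ring
  have h1 : |sin ((if i then arctan t else π / 2 - arctan t) - γ)| =
      |cos (arctan t)| * |(rotT γ (coneDir i t)).2| := by
    rw [← abs_mul]
    cases i
    · simp only [rotT, coneDir, Bool.false_eq_true, if_false, sub_sub,
        sin_pi_div_two_sub, cos_add, h0]
      congr 1
      ring
    · simp only [rotT, coneDir, if_true, sin_sub, h0]
      congr 1
      ring
  rw [h1]
  exact mul_le_of_le_one_left (abs_nonneg _) (abs_cos_le_one _)

lemma exists_l2Bound_windowTerm {g : ℝ → ℝ} {q : ℕ} (hg : IsWindowQ g q) (i : Bool) {E : ℝ → ℝ}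
    {c : ℝ} {f ψ : ℝ × ℝ → ℂ} (hE : IsFlatEdge E c) (hf : ContDiff ℝ 2 f) (hψ : IsBump ψ) :
    ∃ K, 0 ≤ K ∧ ∀ ε γ t, 0 < ε → ε ≤ 1 / 32 → |t| ≤ 1 → ∀ I, termOrder I ≤ q →
      L2Bound (K * (ε / (1 + |sin ((if i then arctan t else π / 2 - arctan t) - γ)| / ε) ^ 5))
        (windowTerm g i E f ψ ε γ t I) := by
  choose C hC0 hC using fun n => exists_sqBound_lineHalf hE hf (hψ.moment n)
  obtain ⟨M, hM0, hM⟩ := exists_abs_iteratedDeriv_le (r := 2 / 3) hg.2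
    fun k x hx => hg.1.iteratedDeriv_eq_zero k hx
  obtain ⟨L, hL0, hL⟩ := exists_abs_iteratedDeriv_le (r := 4 / 3) (contDiff_gtilde hg.2)
    fun k x hx => hg.1.iteratedDeriv_gtilde_eq_zero k (Or.inr hx)
  set S := ∑ n ∈ Finset.range (q + 1) ×ˢ Finset.range (q + 1), C n with hS
  have hS0 : 0 ≤ S := Finset.sum_nonneg fun n _ => hC0 n
  refine ⟨4 / 3 * ((L * M) ^ 2 * S), by positivity, fun ε γ t hε hε1 ht I hI => ?_⟩
  obtain ⟨n, k, l⟩ := I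
  have hI' : n.1 ≤ q ∧ n.2 ≤ q ∧ k ≤ q ∧ l ≤ q := by simp only [termOrder] at hI; omega
  have hCn : C n ≤ S := Finset.single_le_sum (f := C) (fun n _ => hC0 n)
    (Finset.mem_product.2 ⟨Finset.mem_range.2 (by omega), Finset.mem_range.2 (by omega)⟩)
  have hcont := continuous_windowTerm (i := i) (γ := γ) (t := t) hg.2
    (hE.contDiff_scaledEdge (ε := ε)).continuous hf.continuous hψ hI
  have hval : ∀ z, windowTerm g i E f ψ ε γ t (n, k, l) (conePoint i t z) =
      rotHalf E f (moment ψ n) ε γ (conePoint i t z) *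
        ((iteratedDeriv k (gtilde g) (ε * z.1) * iteratedDeriv l g z.2 : ℝ) : ℂ) := fun z => by
    simp only [windowTerm, coneFst_conePoint, coneSnd_conePoint]
  rw [mul_assoc]
  refine l2Bound_of_cone (i := i) (t := t) (R := 4 / 3 / ε) hcont (fun z hz => ?_) fun τ hτ => ?_
  · rw [hval]
    rcases hz with hz | hz
    · rw [hg.1.iteratedDeriv_gtilde_eq_zero k (x := ε * z.1)]
      · simp
      · right
        rw [abs_mul, abs_of_pos hε]
        rwa [div_lt_iff₀' hε] at hz
    · rw [hg.1.iteratedDeriv_eq_zero l hz]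
      simp
  · have hp := isLineParam_cone (i := i) (γ := γ) hε hε1 ht hτ
    have hb := hC n ε _ _ hp
    set p := rotT γ (coneDir i t) with hpdef
    set v := rotT γ (conePoint i t (0, τ)) with hv
    have hline : ∀ ρ, rotHalf E f (moment ψ n) ε γ (conePoint i t (ρ, τ)) =
        lineHalf E f (moment ψ n) ε p v ρ := fun ρ => by
      rw [rotHalf, rotT_conePoint, lineHalf]
    have hz : ∀ ρ ∉ freqRange ε,
        ‖windowTerm g i E f ψ ε γ t (n, k, l) (conePoint i t (ρ, τ))‖ ^ 2 = 0 := fun ρ hρ => by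
      rw [hval, hg.1.iteratedDeriv_gtilde_eq_zero k (x := ε * ρ)]
      · simp
      · rw [abs_mul, abs_of_pos hε]
        by_contra! h
        exact hρ h
    rw [← setIntegral_eq_integral_of_forall_compl_eq_zero hz]
    have hcl : Continuous (lineHalf E f (moment ψ n) ε p v) := hb.cont
    have hcw : Continuous fun ρ => windowTerm g i E f ψ ε γ t (n, k, l) (conePoint i t (ρ, τ)) := by
      refine hcont.comp ?_
      simp only [← coneHomeomorph_apply]
      exact (coneHomeomorph i t).continuous.comp (by fun_prop)
    calc ∫ ρ in freqRange ε, ‖windowTerm g i E f ψ ε γ t (n, k, l) (conePoint i t (ρ, τ))‖ ^ 2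
        ≤ ∫ ρ in freqRange ε, (L * M) ^ 2 * ‖lineHalf E f (moment ψ n) ε p v ρ‖ ^ 2 := by
          refine setIntegral_mono_on (integrableOn_freqRange hε (by fun_prop))
            (integrableOn_freqRange hε (by fun_prop)) (isClosed_freqRange ε).measurableSet
            fun ρ hρ => ?_
          rw [hval, hline, norm_mul, Complex.norm_real, mul_comm, ← mul_pow, Real.norm_eq_abs,
            abs_mul]
          have h1 := hL k hI'.2.2.1 (ε * ρ)
          have h2 := hM l hI'.2.2.2 τ
          gcongr
      _ = (L * M) ^ 2 * ∫ ρ in freqRange ε, ‖lineHalf E f (moment ψ n) ε p v ρ‖ ^ 2 :=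
          integral_const_mul _ _
      _ ≤ (L * M) ^ 2 * (S * (ε / (1 + |p.2| / ε) ^ 5)) := by
          gcongr
          exact hb.le.trans (by gcongr)
      _ = (L * M) ^ 2 * S * (ε / (1 + |p.2| / ε) ^ 5) := by ring
      _ ≤ _ := by
          have := abs_sin_le_rotT_coneDir i γ t
          gcongr

lemma IsBump.ofReal {φ : ℝ × ℝ → ℝ} (hφ : ContDiff ℝ (⊤ : ℕ∞) φ)
    (hφs : tsupport φ ⊆ Icc (-π) π ×ˢ Icc (-π) π) : IsBump fun y => (φ y : ℂ) := by
  refine ⟨Complex.ofRealCLM.contDiff.comp hφ, (closure_mono fun y hy => ?_).trans hφs⟩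
  simpa using hy

/-- Parabolic rescaling of the Fourier transform of an edge fragment. -/
lemma FT_edgeFragment_rotT (f φ : ℝ × ℝ → ℝ) (E : ℝ → ℝ) (j : ℕ) {ε γ : ℝ} (hε : 0 < ε)
    (hj : (2 : ℝ) ^ ((j : ℝ) / 2) * ε = 1) (z : ℝ × ℝ) :
    FT (fun x => (edgeFragment f φ E j x : ℂ)) (rotT γ z) = (((2 * π) ^ 2 : ℂ)⁻¹ * (ε : ℂ) ^ 2) *
      rotHalf E (fun y => (f y : ℂ)) (moment (fun y => (φ y : ℂ)) (0, 0)) ε γ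
        (ε * z.1, ε * z.2) := by
  set ζ := rotT γ z with hζ
  have h := Measure.integral_comp_smul (volume : Measure (ℝ × ℝ))
    (fun ξ => (edgeFragment f φ E j ξ : ℂ) *
      Complex.exp (-Complex.I * ((ξ.1 * ζ.1 + ξ.2 * ζ.2 : ℝ) : ℂ))) ε
  simp only [Module.finrank_prod, Module.finrank_self, Prod.smul_def, smul_eq_mul] at h
  rw [abs_of_pos (by positivity), Complex.real_smul] at h
  have h2 : (ε : ℂ) ^ 2 ≠ 0 := by exact_mod_cast (pow_pos hε 2).ne'
  rw [FT, rotHalf, mul_assoc]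
  congr 1
  rw [show ∀ a b : ℂ, a = (ε : ℂ) ^ 2 * b ↔ b = ((((ε ^ (1 + 1))⁻¹ : ℝ)) : ℂ) * a from
    fun a b => by push_cast; field_simp; rw [eq_div_iff h2, mul_comm b, eq_comm], ← h, halfInt]
  congr 1
  funext y
  have e1 : (2 : ℝ) ^ ((j : ℝ) / 2) * (ε * y.1) = y.1 := by rw [← mul_assoc, hj, one_mul]
  have e2 : (2 : ℝ) ^ ((j : ℝ) / 2) * (ε * y.2) = y.2 := by rw [← mul_assoc, hj, one_mul]
  have e3 : (rotT γ (ε * z.1, ε * z.2)).1 * y.1 + (rotT γ (ε * z.1, ε * z.2)).2 * y.2 =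
      ε * y.1 * ζ.1 + ε * y.2 * ζ.2 := by
    simp only [hζ, rotT]
    ring
  have e4 : scaledEdge E ε y.2 ≤ y.1 ↔ E (ε * y.2) ≤ ε * y.1 := inv_mul_le_iff₀ hε
  rw [e3]
  congr 1
  simp only [edgeFragment, e1, e2, e4, dilate, moment]
  split_ifs <;> simp

lemma FT_edge_mul_PsiJL (g : ℝ → ℝ) (i : Bool) (f φ : ℝ × ℝ → ℝ) (E : ℝ → ℝ) (j : ℕ) (ℓ : ℤ)
    {ε : ℝ} (γ : ℝ) (hε : ε = (2 : ℝ) ^ (-(j : ℝ) / 2)) (z : ℝ × ℝ) :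
    FT (fun x => (edgeFragment f φ E j x : ℂ)) (rotT γ z) * (PsiJL g i j ℓ z : ℂ) =
      (((2 * π) ^ 2 : ℂ)⁻¹ * (ε : ℂ) ^ 2) *
        windowTerm g i E (fun y => (f y : ℂ)) (fun y => (φ y : ℂ)) ε γ (ℓ * ε) ((0, 0), 0, 0)
          (ε * z.1, ε * z.2) := by
  have hε0 : 0 < ε := by rw [hε]; positivity
  have h1 : (2 : ℝ) ^ (-(j : ℝ)) = ε * ε := by
    rw [hε, ← Real.rpow_add two_pos]
    congr 1
    ring
  have hj : (2 : ℝ) ^ ((j : ℝ) / 2) * ε = 1 := by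
    rw [hε, ← Real.rpow_add two_pos, neg_div, add_neg_cancel, Real.rpow_zero]
  have h2 : PsiJL g i j ℓ z = gtilde g (ε * coneFst i (ε * z.1, ε * z.2)) *
      g (coneSnd i (ℓ * ε) (ε * z.1, ε * z.2)) := by
    cases i
    · simp only [PsiJL, PsiV, ← hε, h1, coneFst, coneSnd, Bool.false_eq_true, if_false]
      rw [mul_comm]
      congr 2 <;> ring
    · simp only [PsiJL, PsiH, ← hε, h1, coneFst, coneSnd, if_true]
      congr 2 <;> ring
  rw [FT_edgeFragment_rotT f φ E j hε0 hj, h2]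
  simp only [windowTerm, iteratedDeriv_zero]
  ring

/-- For `Ψ^{(i)} ∈ 𝒲₂^q`, a standard edge fragment `ℰ_j`, a rotation
`R_γ` and any multi-index `r` with `|r|₁ ≤ q`,
`‖∂^r[𝓕ℰ_j(R_γᵀ·)·Ψ_{j,ℓ}^{(i)}]‖²_{L₂(ℝ²)}
  ≤ C(q) 2^{-j(3/2+|r|₁)} (1 + 2^{j/2}|sin(θ_{j,ℓ}^{(i)} − γ)|)^{-5}`. -/
theorem norm_FT_edge_Psi_bound (g : ℝ → ℝ) (q : ℕ) (hg : IsWindowQ g q) (i : Bool)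
    (φ : ℝ × ℝ → ℝ) (hφ : ContDiff ℝ (⊤ : ℕ∞) φ)
    (hφs : tsupport φ ⊆ Icc (-π) π ×ˢ Icc (-π) π)
    (E : ℝ → ℝ) (hE : ContDiff ℝ 2 E) (hE0 : E 0 = 0) (hE0' : deriv E 0 = 0)
    (f : ℝ × ℝ → ℝ) (hf : ContDiff ℝ 2 f) (r : ℕ × ℕ) (hr : r.1 + r.2 ≤ q) :
    ∃ C > 0, ∀ j : ℕ, Even j → 10 ≤ j → ∀ ℓ : ℤ, |(ℓ : ℝ)| ≤ (2:ℝ)^((j:ℝ)/2) →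
      ∀ γ ∈ Ico (0:ℝ) (2*π),
      (∫ ξ : ℝ × ℝ,
          ‖pd r (fun z => FT (fun x => (edgeFragment f φ E j x : ℂ)) (rotT γ z)
              * (PsiJL g i j ℓ z : ℂ)) ξ‖^2)
        ≤ C * (2:ℝ)^(-(j:ℝ)*(3/2+(r.1:ℝ)+(r.2:ℝ)))
            * (1 + (2:ℝ)^((j:ℝ)/2) * |Real.sin (thetaJL i j ℓ - γ)|)^(-(5:ℝ)) := by
  obtain ⟨c, hc⟩ := exists_isFlatEdge hE hE0 hE0'
  have hψ := IsBump.ofReal hφ hφs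
  have hfc : ContDiff ℝ 2 fun y => (f y : ℂ) := Complex.ofRealCLM.contDiff.comp hf
  obtain ⟨K, hK0, hK⟩ := exists_l2Bound_windowTerm hg i hc hfc hψ
  refine ⟨16 ^ (r.1 + r.2) * K + 1, by positivity, fun j _ hj ℓ hℓ γ _ => ?_⟩
  set ε : ℝ := (2 : ℝ) ^ (-(j : ℝ) / 2) with hε
  have hε0 : 0 < ε := by positivity
  have hN : (2 : ℝ) ^ ((j : ℝ) / 2) = ε⁻¹ := by rw [hε, neg_div, Real.rpow_neg zero_le_two, inv_inv]
  have hε1 : ε ≤ 1 / 32 := by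
    have hj' : (10 : ℝ) ≤ j := by exact_mod_cast hj
    calc ε ≤ (2 : ℝ) ^ (-5 : ℝ) := Real.rpow_le_rpow_of_exponent_le one_le_two (by linarith)
      _ = 1 / 32 := by
        rw [Real.rpow_neg zero_le_two, show (5 : ℝ) = (5 : ℕ) by norm_num, Real.rpow_natCast]
        norm_num
  have ht : |(ℓ : ℝ) * ε| ≤ 1 := by
    rw [hN] at hℓ
    rw [abs_mul, abs_of_pos hε0]
    calc |(ℓ : ℝ)| * ε ≤ ε⁻¹ * ε := by gcongr
      _ = 1 := inv_mul_cancel₀ hε0.ne'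
  have hθ : thetaJL i j ℓ = if i then arctan (ℓ * ε) else π / 2 - arctan (ℓ * ε) := rfl
  set X : ℝ := |sin (thetaJL i j ℓ - γ)| / ε with hX
  have hX0 : 0 ≤ X := by positivity
  have hcomb := isComb_pd_windowTerm (i := i) (γ := γ) hg.2 (hc.contDiff_scaledEdge (ε := ε)).continuous
    hfc.continuous hψ (by rw [abs_of_pos hε0]; linarith) ht hr
  have hle := (hcomb.l2Bound fun I hI => hK ε γ (ℓ * ε) hε0 hε1 ht I (by omega)).le
  rw [← hθ, ← hX] at hle
  simp only [FT_edge_mul_PsiJL g i f φ E j ℓ γ hε]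
  rw [integral_norm_sq_pd_comp_mul r _ hε0]
  have hnorm : ‖((2 * π) ^ 2 : ℂ)⁻¹ * (ε : ℂ) ^ 2‖ ^ 2 ≤ ε ^ 4 := by
    have h1 : ((2 * π) ^ 2 : ℂ)⁻¹ * (ε : ℂ) ^ 2 = ((((2 * π) ^ 2)⁻¹ * ε ^ 2 : ℝ) : ℂ) := by
      push_cast; rfl
    have h2 : ((2 * π) ^ 2)⁻¹ ≤ 1 := inv_le_one_of_one_le₀ (by nlinarith [pi_gt_three])
    rw [h1, Complex.norm_real, Real.norm_of_nonneg (by positivity)]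
    calc (((2 * π) ^ 2)⁻¹ * ε ^ 2) ^ 2 ≤ (1 * ε ^ 2) ^ 2 := by gcongr
      _ = ε ^ 4 := by ring
  have e1 : (2 : ℝ) ^ (-(j : ℝ) * (3 / 2 + (r.1 : ℝ) + (r.2 : ℝ))) = ε ^ (3 + 2 * (r.1 + r.2)) := by
    rw [hε, ← Real.rpow_natCast, ← Real.rpow_mul zero_le_two]
    congr 1
    push_cast
    ring
  have e2 : (1 + (2 : ℝ) ^ ((j : ℝ) / 2) * |sin (thetaJL i j ℓ - γ)|) ^ (-(5 : ℝ)) =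
      ((1 + X) ^ 5)⁻¹ := by
    rw [hN, inv_mul_eq_div, ← hX, Real.rpow_neg (by positivity),
      show (5 : ℝ) = (5 : ℕ) by norm_num, Real.rpow_natCast]
  rw [e1, e2]
  calc _ ≤ ε ^ 4 * ε ^ (2 * (r.1 + r.2)) * (ε ^ 2)⁻¹ *
        (((16 ^ (r.1 + r.2) : ℕ) : ℝ) * (K * (ε / (1 + X) ^ 5))) := by gcongr
    _ = (16 ^ (r.1 + r.2) * K) * ε ^ (3 + 2 * (r.1 + r.2)) * ((1 + X) ^ 5)⁻¹ := by
        push_cast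
        rw [pow_add ε 3]
        field_simp
    _ ≤ _ := by
        gcongr
        linarith

end
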